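/- arXiv:1511.07689 — 3 statements merged into one kernel-verified Lean document; each statement's English description precedes it below -/
import Mathlib

section
/- For every algebraic number field K and every positive integer k, there exists an element α of the ring of integers O_K of K that cannot be written as a sum of k units of O_K. Equivalently, the ring of integers of an algebraic number field is not k-good for any k. -/
open NumberField

open Ideal UniqueFactorizationMonoid in
lemma sum_absNorm_rpow_le_prod {E : Type*} [Field E] [NumberField E] {s : ℝ} (hs : 0 < s)
    (T : Finset (Ideal (𝓞 E))) (hT : ∀ I ∈ T, I ≠ ⊥) :
    ∃ S : Finset (Ideal (𝓞 E)), (∀ Q ∈ S, Q.IsPrime ∧ Q ≠ ⊥) ∧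
      ∑ I ∈ T, (absNorm I : ℝ) ^ (-s) ≤ ∏ Q ∈ S, (1 - (absNorm Q : ℝ) ^ (-s))⁻¹ := by
  classical
  set S := T.biUnion fun I ↦ (normalizedFactors I).toFinset with hS
  have hprime : ∀ Q ∈ S, Q.IsPrime ∧ Q ≠ ⊥ := by
    intro Q hQ
    obtain ⟨I, hI, hQI⟩ := Finset.mem_biUnion.mp hQ
    have := prime_of_normalized_factor Q (Multiset.mem_toFinset.mp hQI)
    exact ⟨isPrime_of_prime this, this.ne_zero⟩
  refine ⟨S, hprime, ?_⟩
  set x : Ideal (𝓞 E) → ℝ := fun I ↦ (absNorm I : ℝ) ^ (-s) with hx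
  have hx0 : ∀ I, 0 ≤ x I := fun I ↦ by positivity
  have hx1 : ∀ Q ∈ S, x Q < 1 := by
    intro Q hQ
    refine Real.rpow_lt_one_of_one_lt_of_neg ?_ (by linarith)
    have h0 : absNorm Q ≠ 0 := by simpa [absNorm_eq_zero_iff] using (hprime Q hQ).2
    have h1 : absNorm Q ≠ 1 := by simpa [absNorm_eq_one_iff] using (hprime Q hQ).1.ne_top
    exact_mod_cast (by omega : 1 < absNorm Q)
  set N := T.sup (fun I ↦ (normalizedFactors I).card) + 1 with hN
  have hfac : ∀ I ∈ T, ∏ Q : S, (Q : Ideal (𝓞 E)) ^ (normalizedFactors I).count (Q : Ideal (𝓞 E))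
      = I := by
    intro I hI
    rw [Finset.prod_coe_sort S (fun Q ↦ Q ^ (normalizedFactors I).count Q),
      ← Finset.prod_multiset_count_of_subset _ _
        (Finset.subset_biUnion_of_mem (fun I ↦ (normalizedFactors I).toFinset) hI)]
    exact Ideal.prod_normalizedFactors_eq_self (hT I hI)
  have hxfac : ∀ I ∈ T, x I = ∏ Q : S, x Q ^ (normalizedFactors I).count (Q : Ideal (𝓞 E)) := by
    intro I hI
    conv_lhs => rw [← hfac I hI]
    simp only [hx, map_prod, map_pow, Nat.cast_prod, Nat.cast_pow]
    rw [← Real.finsetProd_rpow _ _ (fun _ _ ↦ by positivity)]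
    refine Finset.prod_congr rfl fun Q _ ↦ ?_
    rw [← Real.rpow_natCast, ← Real.rpow_natCast, ← Real.rpow_mul (by positivity),
      ← Real.rpow_mul (by positivity), mul_comm]
  set e : Ideal (𝓞 E) → (S → ℕ) := fun I Q ↦ (normalizedFactors I).count (Q : Ideal (𝓞 E)) with he
  have hinj : Set.InjOn e T := by
    intro I hI J hJ hIJ
    rw [← hfac I hI, ← hfac J hJ]
    exact Finset.prod_congr rfl fun Q _ ↦ by exact congrArg _ (congrFun hIJ Q)
  calc ∑ I ∈ T, x I = ∑ I ∈ T, ∏ Q : S, x Q ^ e I Q := Finset.sum_congr rfl hxfac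
    _ = ∑ f ∈ T.image e, ∏ Q : S, x Q ^ f Q :=
      (Finset.sum_image (f := fun f ↦ ∏ Q : S, x Q ^ f Q) hinj).symm
    _ ≤ ∑ f ∈ Fintype.piFinset fun _ : S ↦ Finset.range N, ∏ Q : S, x Q ^ f Q := by
      refine Finset.sum_le_sum_of_subset_of_nonneg ?_
        fun _ _ _ ↦ Finset.prod_nonneg fun Q _ ↦ pow_nonneg (hx0 _) _
      intro f hf
      obtain ⟨I, hI, rfl⟩ := Finset.mem_image.mp hf
      refine Fintype.mem_piFinset.mpr fun Q ↦ Finset.mem_range.mpr ?_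
      exact Nat.lt_succ_of_le ((Multiset.count_le_card _ _).trans
        (Finset.le_sup (f := fun I ↦ (normalizedFactors I).card) hI))
    _ = ∏ Q : S, ∑ k ∈ Finset.range N, x Q ^ k := (Finset.prod_univ_sum _ _).symm
    _ ≤ ∏ Q : S, (1 - x Q)⁻¹ := by
      refine Finset.prod_le_prod (fun Q _ ↦ Finset.sum_nonneg fun k _ ↦ pow_nonneg (hx0 _) _)
        fun Q _ ↦ ?_
      rw [← tsum_geometric_of_lt_one (hx0 _) (hx1 Q Q.2)]
      exact (summable_geometric_of_lt_one (hx0 _) (hx1 Q Q.2)).sum_le_tsum _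
        fun k _ ↦ pow_nonneg (hx0 _) _
    _ = _ := Finset.prod_coe_sort S fun Q ↦ (1 - x Q)⁻¹

lemma inv_one_sub_le_exp {x : ℝ} (hx : x ≤ 1 / 2) :
    (1 - x)⁻¹ ≤ Real.exp (x + 2 * x ^ 2) := by
  rw [inv_le_iff_one_le_mul₀ (by linarith)]
  have := Real.add_one_le_exp (x + 2 * x ^ 2)
  nlinarith [mul_nonneg (sq_nonneg x) (by linarith : 0 ≤ 1 - 2 * x)]

open Ideal in
lemma card_le_finrank_of_mem {E : Type*} [Field E] [NumberField E] {p : ℕ} (hp : p.Prime)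
    (S : Finset (Ideal (𝓞 E))) (hS : ∀ Q ∈ S, Q.IsPrime ∧ Q ≠ ⊥ ∧ p ∣ absNorm Q) :
    S.card ≤ Module.finrank ℚ E := by
  have hmem : ∀ Q ∈ S, Q ∣ span {(p : 𝓞 E)} := by
    intro Q hQ
    obtain ⟨h1, h2, h3⟩ := hS Q hQ
    rw [Ideal.dvd_span_singleton]
    have := h1.isMaximal h2
    obtain ⟨q, n, -, hqQ, hq, hn⟩ := exists_prime_and_absNorm_eq_pow Q
    rwa [(Nat.prime_dvd_prime_iff_eq hp hq).mp (hp.dvd_of_dvd_pow (hn ▸ h3))]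
  have hdvd : ∏ Q ∈ S, Q ∣ span {(p : 𝓞 E)} :=
    Finset.prod_primes_dvd _ (fun Q hQ ↦ prime_of_isPrime (hS Q hQ).2.1 (hS Q hQ).1) hmem
  have h := map_dvd (absNorm (S := 𝓞 E)) hdvd
  rw [map_prod, absNorm_span_natCast, RingOfIntegers.rank] at h
  rw [← Nat.pow_dvd_pow_iff_le_right hp.one_lt]
  refine dvd_trans ?_ h
  rw [← Finset.prod_const]
  exact Finset.prod_dvd_prod_of_dvd _ _ fun Q hQ ↦ (hS Q hQ).2.2

open Ideal in
lemma sum_absNorm_rpow_le_exp {E : Type*} [Field E] [NumberField E] {s : ℝ} (hs : 1 < s)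
    (T : Finset (Ideal (𝓞 E))) (hT : ∀ I ∈ T, I ≠ ⊥) :
    ∃ P : Finset ℕ, (∀ p ∈ P, p.Prime ∧ ∃ Q : Ideal (𝓞 E), absNorm Q = p) ∧
      ∑ I ∈ T, (absNorm I : ℝ) ^ (-s) ≤ Real.exp (Module.finrank ℚ E *
        (∑ p ∈ P, (p : ℝ) ^ (-s) + ∑' m : ℕ, 3 * ((m : ℝ) ^ 2)⁻¹)) := by
  classical
  obtain ⟨S, hS, hle⟩ := sum_absNorm_rpow_le_prod (by linarith : 0 < s) T hT
  set π : Ideal (𝓞 E) → ℕ := fun Q ↦ (absNorm Q).minFac with hπ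
  set n := Module.finrank ℚ E
  have hpow : ∀ Q ∈ S, (π Q).Prime ∧ ∃ k, 0 < k ∧ absNorm Q = π Q ^ k := by
    intro Q hQ
    have := (hS Q hQ).1.isMaximal (hS Q hQ).2
    obtain ⟨q, k, hk, -, hq, hn⟩ := exists_prime_and_absNorm_eq_pow Q
    have : π Q = q := by simp only [hπ, hn, hq.pow_minFac hk.ne']
    exact this ▸ ⟨hq, k, hk, this ▸ hn⟩
  have hfiber (A : Finset (Ideal (𝓞 E))) (hA : A ⊆ S) (f : ℕ → ℝ) (hf : ∀ m, 0 ≤ f m) :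
      ∑ Q ∈ A, f (π Q) ≤ n * ∑ p ∈ A.image π, f p := by
    rw [← Finset.sum_fiberwise_of_maps_to (fun Q hQ ↦ Finset.mem_image_of_mem π hQ),
      Finset.mul_sum]
    refine Finset.sum_le_sum fun p hp ↦ ?_
    obtain ⟨Q₀, hQ₀, rfl⟩ := Finset.mem_image.mp hp
    rw [Finset.sum_congr rfl (g := fun _ ↦ f (π Q₀))
      (fun Q hQ ↦ by rw [(Finset.mem_filter.mp hQ).2]), Finset.sum_const, nsmul_eq_mul]
    refine mul_le_mul_of_nonneg_right ?_ (hf _)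
    refine Nat.cast_le.mpr (card_le_finrank_of_mem (hpow _ (hA hQ₀)).1 _ fun Q hQ ↦ ?_)
    obtain ⟨hQ, hQ'⟩ := Finset.mem_filter.mp hQ
    exact ⟨(hS Q (hA hQ)).1, (hS Q (hA hQ)).2, hQ' ▸ Nat.minFac_dvd _⟩
  set A := S.filter fun Q ↦ absNorm Q = π Q with hA
  refine ⟨A.image π, ?_, hle.trans ?_⟩
  · intro p hp
    obtain ⟨Q, hQ, rfl⟩ := Finset.mem_image.mp hp
    exact ⟨(hpow Q (Finset.mem_filter.mp hQ).1).1, Q, (Finset.mem_filter.mp hQ).2⟩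
  have hpow_neg : ∀ Q ∈ S, (absNorm Q : ℝ) ^ (-s) ≤ (absNorm Q : ℝ)⁻¹ := by
    intro Q hQ
    obtain ⟨hp, k, hk, h⟩ := hpow Q hQ
    rw [← Real.rpow_neg_one]
    refine Real.rpow_le_rpow_of_exponent_le ?_ (by linarith)
    rw [h]
    exact_mod_cast Nat.one_le_pow _ _ hp.pos
  have hterm : ∀ Q ∈ S, (1 - (absNorm Q : ℝ) ^ (-s))⁻¹ ≤
      Real.exp ((if absNorm Q = π Q then (π Q : ℝ) ^ (-s) else 0) + 3 * ((π Q : ℝ) ^ 2)⁻¹) := by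
    intro Q hQ
    obtain ⟨hp, k, hk, h⟩ := hpow Q hQ
    have h1 := hpow_neg Q hQ
    have h0 : (0 : ℝ) ≤ (absNorm Q : ℝ) ^ (-s) := by positivity
    have h2 : (2 : ℝ) ≤ π Q := by exact_mod_cast hp.two_le
    have h3 : (π Q : ℝ) ≤ absNorm Q := by
      rw [h]; exact_mod_cast Nat.le_self_pow hk.ne' _
    have h4 : (absNorm Q : ℝ)⁻¹ ≤ (π Q : ℝ)⁻¹ := by gcongr
    have h5 : (π Q : ℝ)⁻¹ ≤ 1 / 2 := by rw [one_div]; gcongr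
    refine (inv_one_sub_le_exp (by linarith)).trans (Real.exp_le_exp.mpr ?_)
    have h6 : ((absNorm Q : ℝ) ^ (-s)) ^ 2 ≤ ((π Q : ℝ) ^ 2)⁻¹ := by
      rw [← inv_pow]; gcongr; linarith
    have h7 : (0 : ℝ) ≤ ((π Q : ℝ) ^ 2)⁻¹ := by positivity
    split_ifs with hc
    · rw [hc] at h6 ⊢; linarith
    · have hk2 : 2 ≤ k := by
        by_contra hlt
        exact hc (by rw [h, show k = 1 by omega, pow_one])
      have : (absNorm Q : ℝ)⁻¹ ≤ ((π Q : ℝ) ^ 2)⁻¹ := by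
        gcongr
        rw [h]; exact_mod_cast Nat.pow_le_pow_right hp.pos hk2
      linarith
  have hsum : Summable fun m : ℕ ↦ 3 * ((m : ℝ) ^ 2)⁻¹ :=
    (Real.summable_nat_pow_inv.mpr one_lt_two).mul_left 3
  calc ∏ Q ∈ S, (1 - (absNorm Q : ℝ) ^ (-s))⁻¹
      ≤ ∏ Q ∈ S, Real.exp ((if absNorm Q = π Q then (π Q : ℝ) ^ (-s) else 0)
          + 3 * ((π Q : ℝ) ^ 2)⁻¹) := by
        refine Finset.prod_le_prod (fun Q hQ ↦ ?_) hterm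
        have := hpow_neg Q hQ
        have : (absNorm Q : ℝ)⁻¹ ≤ 1 := Nat.cast_inv_le_one _
        exact inv_nonneg.mpr (by linarith)
    _ = Real.exp (∑ Q ∈ A, (π Q : ℝ) ^ (-s) + ∑ Q ∈ S, 3 * ((π Q : ℝ) ^ 2)⁻¹) := by
        rw [← Real.exp_sum, Finset.sum_add_distrib, hA, Finset.sum_filter]
    _ ≤ _ := by
        refine Real.exp_le_exp.mpr ?_
        rw [mul_add]
        refine add_le_add (hfiber A (Finset.filter_subset _ _) (fun m ↦ (m : ℝ) ^ (-s))
          fun m ↦ by positivity) ((hfiber S subset_rfl (fun m ↦ 3 * ((m : ℝ) ^ 2)⁻¹)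
          fun m ↦ by positivity).trans ?_)
        gcongr
        exact hsum.sum_le_tsum _ fun m _ ↦ by positivity

open Ideal Filter Topology in
/-- The degree-one primes of a number field account for the pole of its Dedekind zeta function. -/
lemma exists_finset_log_le {E : Type*} [Field E] [NumberField E] :
    ∃ C : ℝ, ∀ᶠ s : ℝ in 𝓝[>] 1, ∃ P : Finset ℕ,
      (∀ p ∈ P, p.Prime ∧ ∃ Q : Ideal (𝓞 E), absNorm Q = p) ∧
      -Real.log (s - 1) - C ≤ Module.finrank ℚ E * ∑ p ∈ P, (p : ℝ) ^ (-s) := by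
  classical
  set ρ := dedekindZeta_residue E with hρ
  have hρ0 : 0 < ρ := dedekindZeta_residue_pos E
  refine ⟨Module.finrank ℚ E * ∑' m : ℕ, 3 * ((m : ℝ) ^ 2)⁻¹ - Real.log (ρ / 2), ?_⟩
  have h1 := (tendsto_sub_one_mul_dedekindZeta_nhdsGT E).norm.eventually_const_lt
    (u := ρ / 2) (by rw [← hρ, Complex.norm_real, Real.norm_of_nonneg hρ0.le]; linarith)
  filter_upwards [h1, self_mem_nhdsWithin] with s h1 hs
  have hs1 : 0 < s - 1 := sub_pos.mpr hs
  have h2 : ρ / 2 / (s - 1) < ‖dedekindZeta E s‖ := by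
    rw [div_lt_iff₀ hs1]
    rw [norm_mul, ← Complex.ofReal_one, ← Complex.ofReal_sub, Complex.norm_real,
      Real.norm_of_nonneg hs1.le] at h1
    linarith
  have hne : dedekindZeta E s ≠ 0 :=
    norm_ne_zero_iff.mp ((by positivity : 0 < ρ / 2 / (s - 1)).trans h2).ne'
  have hsum : LSeriesSummable (fun n ↦ (Nat.card {I : Ideal (𝓞 E) // absNorm I = n} : ℂ)) s := by
    by_contra hcon
    exact hne (tsum_eq_zero_of_not_summable hcon)
  obtain ⟨F, hF⟩ := (hsum.hasSum.norm.eventually_const_lt h2).exists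
  set T : Finset (Ideal (𝓞 E)) :=
    (F.erase 0).biUnion fun n ↦ (finite_setOfPred_absNorm_eq (S := 𝓞 E) n).toFinset with hT
  have hFT : ‖∑ n ∈ F, LSeries.term (fun n ↦ (Nat.card {I : Ideal (𝓞 E) // absNorm I = n} : ℂ)) s n‖
      ≤ ∑ I ∈ T, (absNorm I : ℝ) ^ (-s) := by
    rw [hT, Finset.sum_biUnion, ← Finset.sum_erase F (LSeries.term_zero _ _)]
    · refine (norm_sum_le _ _).trans (Finset.sum_le_sum fun n hn ↦ ?_)
      have hn0 := Finset.ne_of_mem_erase hn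
      rw [LSeries.term_of_ne_zero hn0, norm_div, Complex.norm_natCast,
        Complex.norm_natCast_cpow_of_pos (Nat.pos_of_ne_zero hn0), Complex.ofReal_re,
        Finset.sum_congr rfl (g := fun _ ↦ (n : ℝ) ^ (-s)) (fun I hI ↦ by
          rw [(Set.Finite.mem_toFinset _).mp hI]), Finset.sum_const, nsmul_eq_mul,
        Real.rpow_neg n.cast_nonneg, div_eq_mul_inv]
      refine le_of_eq ?_
      congr 2
      rw [← Set.ncard_eq_toFinset_card _ (finite_setOfPred_absNorm_eq n)]
      rfl
    · intro m _ n _ hmn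
      refine Finset.disjoint_left.mpr fun I hI hI' ↦ hmn ?_
      rw [← (Set.Finite.mem_toFinset _).mp hI, ← (Set.Finite.mem_toFinset _).mp hI']
  obtain ⟨P, hP, hPle⟩ := sum_absNorm_rpow_le_exp hs T (by
    intro I hI
    simp only [hT, Finset.mem_biUnion, Finset.mem_erase, Set.Finite.mem_toFinset] at hI
    obtain ⟨n, ⟨hn, -⟩, rfl⟩ := hI
    rintro rfl
    simp at hn)
  refine ⟨P, hP, ?_⟩
  have := (hF.le.trans hFT).trans hPle
  rw [← Real.log_le_iff_le_exp (by positivity), Real.log_div (by positivity) hs1.ne',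
    mul_add] at this
  linarith

lemma finrank_cyclotomicField_le (K : Type*) [Field K] [CharZero K] (d : ℕ) [NeZero d] :
    Module.finrank K (CyclotomicField d K) ≤ d.totient := by
  have hζ := IsCyclotomicExtension.zeta_spec d K (CyclotomicField d K)
  rw [(hζ.powerBasis K).finrank, IsPrimitiveRoot.powerBasis_dim,
    ← Polynomial.natDegree_cyclotomic d K]
  refine Polynomial.natDegree_le_of_dvd (minpoly.dvd _ _ ?_) (Polynomial.cyclotomic_ne_zero d K)
  rw [Polynomial.aeval_def, ← Polynomial.eval_map, Polynomial.map_cyclotomic]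
  exact hζ.isRoot_cyclotomic (NeZero.pos d)

open Ideal in
lemma nonempty_ringHom_zmod_of_absNorm_eq {E : Type*} [Field E] [NumberField E] {p : ℕ}
    (hp : p.Prime) {Q : Ideal (𝓞 E)} (hQ : absNorm Q = p) : Nonempty (𝓞 E →+* ZMod p) := by
  have hcard : Nat.card (𝓞 E ⧸ Q) = p := hQ
  have : Finite (𝓞 E ⧸ Q) := Nat.finite_of_card_ne_zero (hcard ▸ hp.ne_zero)
  have := Fintype.ofFinite (𝓞 E ⧸ Q)
  rw [Nat.card_eq_fintype_card] at hcard
  exact ⟨((ZMod.ringEquivOfPrime _ hp hcard).symm : 𝓞 E ⧸ Q →+* ZMod p).comp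
    (Ideal.Quotient.mk Q)⟩

open Filter Topology in
/-- The primes `p ≡ 1` modulo `d` admitting a degree-one prime of `K` have logarithmic density at
least `1 / ([K : ℚ] φ(d))`. -/
lemma exists_finset_modEq_one_log_le (K : Type*) [Field K] [NumberField K] (d : ℕ) [NeZero d] :
    ∃ C : ℝ, ∀ᶠ s : ℝ in 𝓝[>] 1, ∃ P : Finset ℕ,
      (∀ p ∈ P, p.Prime ∧ Nonempty (𝓞 K →+* ZMod p) ∧ d ∣ p - 1) ∧
      -Real.log (s - 1) - C ≤
        Module.finrank ℚ K * (d.totient * ∑ p ∈ P, (p : ℝ) ^ (-s)) := by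
  classical
  let E := CyclotomicField d K
  have : FiniteDimensional K E := IsCyclotomicExtension.finiteDimensional {d} K E
  have : NumberField E := IsCyclotomicExtension.numberField {d} K E
  obtain ⟨C, hC⟩ := exists_finset_log_le (E := E)
  set t := Units.torsionOrder E with ht
  have ht0 : 0 < t := Units.torsionOrder_pos E
  have hdt : d ∣ t := by
    exact Units.dvd_torsionOrder_of_isPrimitiveRoot (IsCyclotomicExtension.zeta_spec d K E)
  have hrank : Module.finrank ℚ E ≤ Module.finrank ℚ K * d.totient := by
    rw [← Module.finrank_mul_finrank ℚ K E]
    exact Nat.mul_le_mul_left _ (finrank_cyclotomicField_le K d)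
  refine ⟨C + Module.finrank ℚ E * t.primeFactors.card, ?_⟩
  filter_upwards [hC, self_mem_nhdsWithin] with s ⟨P, hP, hle⟩ hs
  refine ⟨P \ t.primeFactors, ?_, ?_⟩
  · intro p hp
    obtain ⟨hpP, hpt⟩ := Finset.mem_sdiff.mp hp
    obtain ⟨hprime, Q, hQ⟩ := hP p hpP
    refine ⟨hprime, ?_, ?_⟩
    · obtain ⟨f⟩ := nonempty_ringHom_zmod_of_absNorm_eq hprime hQ
      exact ⟨f.comp (algebraMap (𝓞 K) (𝓞 E))⟩
    · have hco : p.Coprime t := (Nat.Prime.coprime_iff_not_dvd hprime).mpr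
        fun h ↦ hpt (Nat.mem_primeFactors.mpr ⟨hprime, h, ht0.ne'⟩)
      have hQ0 : Q ≠ ⊥ := by rintro rfl; simp at hQ; exact hprime.ne_zero hQ.symm
      have hQ1 : Q.IsPrime := Ideal.isPrime_of_irreducible_absNorm (hQ ▸ hprime)
      exact hdt.trans (hQ ▸ torsionOrder_dvd_absNorm_sub_one hQ0 hQ1 (hQ ▸ hco))
  · have h1 : ∑ p ∈ P, (p : ℝ) ^ (-s) ≤
        ∑ p ∈ P \ t.primeFactors, (p : ℝ) ^ (-s) + t.primeFactors.card := by
      rw [← Finset.sum_inter_add_sum_sdiff P t.primeFactors, add_comm]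
      gcongr
      refine (Finset.sum_le_card_nsmul _ _ 1 fun p hp ↦ ?_).trans ?_
      · exact Real.rpow_le_one_of_one_le_of_nonpos
          (by exact_mod_cast (hP p (Finset.mem_inter.mp hp).1).1.one_le)
          (by linarith [Set.mem_Ioi.mp hs])
      · rw [nsmul_one]
        exact_mod_cast Finset.card_le_card Finset.inter_subset_right
    have h2 : (Module.finrank ℚ E : ℝ) ≤ Module.finrank ℚ K * d.totient := by exact_mod_cast hrank
    have h3 : 0 ≤ ∑ p ∈ P \ t.primeFactors, (p : ℝ) ^ (-s) :=
      Finset.sum_nonneg fun p _ ↦ by positivity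
    calc -Real.log (s - 1) - (C + Module.finrank ℚ E * t.primeFactors.card)
        ≤ Module.finrank ℚ E * ∑ p ∈ P \ t.primeFactors, (p : ℝ) ^ (-s) := by
          nlinarith [mul_le_mul_of_nonneg_left h1 (Module.finrank ℚ E).cast_nonneg (α := ℝ)]
      _ ≤ _ := by rw [← mul_assoc]; gcongr

open Filter Topology in
lemma exists_finset_gcd_log_le (K : Type*) [Field K] [NumberField K] (M : ℕ) [NeZero M] :
    ∃ C : ℝ, ∀ᶠ s : ℝ in 𝓝[>] 1, ∃ P : Finset ℕ,
      (∀ p ∈ P, p.Prime ∧ Nonempty (𝓞 K →+* ZMod p)) ∧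
      M.divisors.card * -Real.log (s - 1) - C ≤
        Module.finrank ℚ K * ∑ p ∈ P, (p - 1).gcd M * (p : ℝ) ^ (-s) := by
  classical
  have key : ∀ d ∈ M.divisors, ∃ C : ℝ, ∀ᶠ s : ℝ in 𝓝[>] 1, ∃ P : Finset ℕ,
      (∀ p ∈ P, p.Prime ∧ Nonempty (𝓞 K →+* ZMod p) ∧ d ∣ p - 1) ∧
      -Real.log (s - 1) - C ≤
        Module.finrank ℚ K * (d.totient * ∑ p ∈ P, (p : ℝ) ^ (-s)) := fun d hd ↦
    have : NeZero d := ⟨(Nat.pos_of_mem_divisors hd).ne'⟩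
    exists_finset_modEq_one_log_le K d
  choose! C hC using key
  refine ⟨∑ d ∈ M.divisors, C d, ?_⟩
  filter_upwards [(Filter.eventually_all_finset _).mpr hC] with s hs
  choose! P hP hle using hs
  refine ⟨M.divisors.biUnion P, ?_, ?_⟩
  · intro p hp
    obtain ⟨d, hd, hp⟩ := Finset.mem_biUnion.mp hp
    exact ⟨(hP d hd p hp).1, (hP d hd p hp).2.1⟩
  · rw [← nsmul_eq_mul, ← Finset.sum_const, ← Finset.sum_sub_distrib]
    refine (Finset.sum_le_sum hle).trans ?_
    rw [← Finset.mul_sum]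
    refine mul_le_mul_of_nonneg_left ?_ (Nat.cast_nonneg _)
    have hg (p : ℕ) (h : p.Prime) : ((p - 1).gcd M : ℝ) =
        ∑ d ∈ M.divisors, if d ∣ p - 1 then (d.totient : ℝ) else 0 := by
      rw [← Finset.sum_filter, ← Nat.cast_sum]
      refine congrArg Nat.cast ((Nat.sum_totient _).symm.trans (Finset.sum_congr ?_ fun _ _ ↦ rfl))
      ext d
      have := h.two_le
      simp [Nat.dvd_gcd_iff, NeZero.ne M, and_comm]
    have hswap : ∑ p ∈ M.divisors.biUnion P, ((p - 1).gcd M : ℝ) * (p : ℝ) ^ (-s) =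
        ∑ d ∈ M.divisors, ∑ p ∈ M.divisors.biUnion P,
          (if d ∣ p - 1 then (d.totient : ℝ) else 0) * (p : ℝ) ^ (-s) := by
      rw [Finset.sum_comm]
      refine Finset.sum_congr rfl fun p hp ↦ ?_
      obtain ⟨d, hd, hp⟩ := Finset.mem_biUnion.mp hp
      rw [hg p (hP d hd p hp).1, Finset.sum_mul]
    rw [hswap]
    refine Finset.sum_le_sum fun d hd ↦ ?_
    rw [Finset.mul_sum]
    refine (Finset.sum_le_sum fun p hp ↦ ?_).trans
      (Finset.sum_le_sum_of_subset_of_nonneg (Finset.subset_biUnion_of_mem P hd)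
        fun p _ _ ↦ by positivity)
    rw [if_pos (hP d hd p hp).2.2]

lemma sum_gcd_mul_log_div_le {P : Finset ℕ} (hP : ∀ p ∈ P, p.Prime) {C A : ℝ} (hC : 0 ≤ C)
    (h : ∀ L : ℕ, L ≠ 0 → ∑ p ∈ P with p - 1 ∣ L, Real.log p ≤ C * Real.log L + A)
    {M : ℕ} (hM : M ≠ 0) {X : ℕ} (hX : X ≠ 0) :
    ∑ p ∈ P with p ≤ X, (p - 1).gcd M * (Real.log p / p) ≤
      2 * C * Real.log X + 2 * (C * Real.log M + A) := by
  have hX0 : (0 : ℝ) < X := by positivity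
  have hcount : ∀ p ∈ P, p ≤ X → (X : ℝ) * ((p - 1).gcd M / p) ≤
      2 * ((Finset.Ioc 0 X).filter fun j ↦ p - 1 ∣ M * j).card := by
    intro p hp hpX
    have hp2 := (hP p hp).two_le
    set g := (p - 1).gcd M with hg
    obtain ⟨n, hn⟩ : g ∣ p - 1 := Nat.gcd_dvd_left _ _
    have hn0 : 0 < n := Nat.pos_of_ne_zero (by rintro rfl; omega)
    have hg0 : 0 < g := Nat.pos_of_ne_zero (by intro h0; rw [h0] at hn; omega)
    have hnX : n ≤ X := by nlinarith [Nat.sub_add_cancel (by omega : 1 ≤ p)]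
    have hle : X / n ≤ ((Finset.Ioc 0 X).filter fun j ↦ p - 1 ∣ M * j).card := by
      rw [← Nat.Ioc_filter_dvd_card_eq_div]
      refine Finset.card_le_card (Finset.monotone_filter_right _ fun j _ hj ↦ ?_)
      rw [hn]
      exact Nat.mul_dvd_mul (Nat.gcd_dvd_right _ _) hj
    have hlt : X ≤ 2 * (X / n) * n := by
      have h1 : 1 ≤ X / n := (Nat.one_le_div_iff hn0).mpr hnX
      have h2 := Nat.lt_mul_div_succ X hn0
      nlinarith
    have hkey : X * g ≤ 2 * ((Finset.Ioc 0 X).filter fun j ↦ p - 1 ∣ M * j).card * p := by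
      calc X * g ≤ 2 * (X / n) * n * g := Nat.mul_le_mul_right _ hlt
        _ = 2 * (X / n) * (p - 1) := by rw [hn]; ring
        _ ≤ _ := Nat.mul_le_mul (Nat.mul_le_mul_left _ hle) (Nat.sub_le _ _)
    rw [← mul_div_assoc, div_le_iff₀ (by positivity)]
    exact_mod_cast hkey
  have hupper : ∑ j ∈ Finset.Ioc 0 X, ∑ p ∈ P with p - 1 ∣ M * j, Real.log p ≤
      X * (C * Real.log X + C * Real.log M + A) := by
    refine (Finset.sum_le_card_nsmul _ _ (C * Real.log X + C * Real.log M + A)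
      fun j hj ↦ ?_).trans_eq (by rw [Nat.card_Ioc, Nat.sub_zero, nsmul_eq_mul])
    obtain ⟨hj0, hjX⟩ := Finset.mem_Ioc.mp hj
    refine (h (M * j) (by positivity)).trans ?_
    rw [Nat.cast_mul, Real.log_mul (by positivity) (by positivity)]
    have : Real.log j ≤ Real.log X := Real.log_le_log (by positivity) (by exact_mod_cast hjX)
    nlinarith
  have hswap : ∑ j ∈ Finset.Ioc 0 X, ∑ p ∈ P with p - 1 ∣ M * j, Real.log p =
      ∑ p ∈ P, ((Finset.Ioc 0 X).filter fun j ↦ p - 1 ∣ M * j).card * Real.log p := by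
    simp_rw [Finset.sum_filter]
    rw [Finset.sum_comm]
    refine Finset.sum_congr rfl fun p _ ↦ ?_
    rw [← Finset.sum_filter, Finset.sum_const, nsmul_eq_mul]
  have hlower : (X : ℝ) * ∑ p ∈ P with p ≤ X, (p - 1).gcd M * (Real.log p / p) ≤
      2 * ∑ p ∈ P, ((Finset.Ioc 0 X).filter fun j ↦ p - 1 ∣ M * j).card * Real.log p := by
    rw [Finset.mul_sum, Finset.mul_sum]
    refine (Finset.sum_le_sum fun p hp ↦ ?_).trans
      (Finset.sum_le_sum_of_subset_of_nonneg (Finset.filter_subset _ _) fun p _ _ ↦ by positivity)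
    obtain ⟨hp, hpX⟩ := Finset.mem_filter.mp hp
    calc (X : ℝ) * ((p - 1).gcd M * (Real.log p / p))
        = X * ((p - 1).gcd M / p) * Real.log p := by ring
      _ ≤ _ := by
        rw [← mul_assoc]
        exact mul_le_mul_of_nonneg_right (hcount p hp hpX) (by positivity)
  rw [← hswap] at hlower
  refine le_of_mul_le_mul_left (hlower.trans ?_) hX0
  nlinarith

lemma sum_mul_rpow_le_of_sum_mul_log_div_le {P : Finset ℕ} (hP : ∀ p ∈ P, 2 ≤ p) {g : ℕ → ℝ}
    (hg : ∀ p, 0 ≤ g p) {c B : ℝ} (hc : 0 ≤ c) (hB : 0 ≤ B)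
    (h : ∀ X : ℕ, X ≠ 0 → ∑ p ∈ P with p ≤ X, g p * (Real.log p / p) ≤ c * Real.log X + B)
    (m : ℕ) :
    ∑ p ∈ P, g p * (p : ℝ) ^ (-(1 + (2 : ℝ)⁻¹ ^ m)) ≤
      2 * c * (m + 2) + 2 * (B / Real.log 2) := by
  classical
  have hlog2 : 0 < Real.log 2 := Real.log_pos one_lt_two
  set δ : ℝ := (2 : ℝ)⁻¹ ^ m with hδ
  have hδ0 : 0 < δ := by positivity
  set i : ℕ → ℕ := fun p ↦ Nat.log 2 (Nat.log 2 p) with hi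
  have hi_le : ∀ p ∈ P, 2 ^ 2 ^ i p ≤ p ∧ p ≤ 2 ^ 2 ^ (i p + 1) := by
    intro p hp
    have hp2 := hP p hp
    have hl : Nat.log 2 p ≠ 0 := (Nat.log_pos one_lt_two hp2).ne'
    constructor
    · exact (Nat.pow_le_pow_right two_pos (Nat.pow_log_le_self 2 hl)).trans
        (Nat.pow_log_le_self 2 (by omega))
    · exact (Nat.lt_pow_succ_log_self one_lt_two p).le.trans
        (Nat.pow_le_pow_right two_pos (Nat.lt_pow_succ_log_self one_lt_two _))
  set w : ℕ → ℝ := fun j ↦ (2 : ℝ) ^ (-(2 ^ j * δ)) with hw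
  have hfiber (j : ℕ) : ∑ p ∈ P with i p = j, g p * (p : ℝ) ^ (-(1 + δ)) ≤
      2 * c * w j + B / Real.log 2 * (1 / 2) ^ j := by
    have hterm : ∀ p ∈ P.filter (i · = j), g p * (p : ℝ) ^ (-(1 + δ)) ≤
        g p * (Real.log p / p) * ((2 ^ j * Real.log 2)⁻¹ * w j) := by
      intro p hp
      obtain ⟨hpP, rfl⟩ := Finset.mem_filter.mp hp
      have hp2 := hP p hpP
      have hp0 : (0 : ℝ) < p := by positivity
      have h1 : ((2 : ℝ) ^ 2 ^ i p) ≤ p := by exact_mod_cast (hi_le p hpP).1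
      have h2 : 2 ^ i p * Real.log 2 ≤ Real.log p := by
        have := Real.log_le_log (by positivity) h1
        rwa [Real.log_pow, Nat.cast_pow, Nat.cast_ofNat] at this
      have h3 : (p : ℝ) ^ (-δ) ≤ w (i p) := by
        have h4 := Real.rpow_le_rpow_of_nonpos (by positivity) h1 (by linarith : -δ ≤ 0)
        rw [← Real.rpow_natCast, ← Real.rpow_mul (by norm_num)] at h4
        simpa [hw] using h4
      have h5 : 1 ≤ Real.log p * (2 ^ i p * Real.log 2)⁻¹ := by
        rw [← div_eq_mul_inv, one_le_div (by positivity)]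
        exact h2
      rw [mul_assoc]
      refine mul_le_mul_of_nonneg_left ?_ (hg p)
      rw [neg_add, Real.rpow_add hp0, Real.rpow_neg_one]
      calc (p : ℝ)⁻¹ * (p : ℝ) ^ (-δ) ≤ (p : ℝ)⁻¹ * (1 * w (i p)) := by rw [one_mul]; gcongr
        _ ≤ (p : ℝ)⁻¹ * ((Real.log p * (2 ^ i p * Real.log 2)⁻¹) * w (i p)) := by
          have : 0 ≤ w (i p) := by positivity
          gcongr
        _ = _ := by ring
    have hsub : ∑ p ∈ P with i p = j, g p * (Real.log p / p) ≤
        c * (2 ^ (j + 1) * Real.log 2) + B := by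
      have hX := h (2 ^ 2 ^ (j + 1)) (by positivity)
      rw [Nat.cast_pow, Nat.cast_ofNat, Real.log_pow, Nat.cast_pow, Nat.cast_ofNat] at hX
      refine le_trans (Finset.sum_le_sum_of_subset_of_nonneg (fun p hp ↦ ?_)
        fun p _ _ ↦ mul_nonneg (hg p) (by positivity)) hX
      obtain ⟨hpP, rfl⟩ := Finset.mem_filter.mp hp
      exact Finset.mem_filter.mpr ⟨hpP, (hi_le p hpP).2⟩
    have hw0 : 0 ≤ w j := by positivity
    have hw1 : w j ≤ 1 := Real.rpow_le_one_of_one_le_of_nonpos one_le_two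
      (by have : 0 ≤ 2 ^ j * δ := by positivity
          linarith)
    refine (Finset.sum_le_sum hterm).trans ?_
    rw [← Finset.sum_mul]
    calc _ ≤ (c * (2 ^ (j + 1) * Real.log 2) + B) * ((2 ^ j * Real.log 2)⁻¹ * w j) := by gcongr
      _ = 2 * c * w j + B / Real.log 2 * (1 / 2) ^ j * w j := by
        rw [pow_succ, one_div, inv_pow]; field_simp
      _ ≤ 2 * c * w j + B / Real.log 2 * (1 / 2) ^ j * 1 := by gcongr
      _ = _ := by rw [mul_one]
  set N := P.sup i + 1 with hN
  have hmaps : ∀ p ∈ P, i p ∈ Finset.range (m + N) := fun p hp ↦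
    Finset.mem_range.mpr (by have := Finset.le_sup (f := i) hp; omega)
  have hgeom (n : ℕ) : ∑ j ∈ Finset.range n, (1 / 2 : ℝ) ^ j ≤ 2 :=
    (summable_geometric_two.sum_le_tsum _ fun j _ ↦ by positivity).trans_eq tsum_geometric_two
  have hwsum : ∑ j ∈ Finset.range (m + N), w j ≤ m + 2 := by
    rw [Finset.sum_range_add]
    refine add_le_add ((Finset.sum_le_card_nsmul _ _ 1 fun j _ ↦ ?_).trans (by simp))
      ((Finset.sum_le_sum fun j _ ↦ ?_).trans (hgeom N))
    · refine Real.rpow_le_one_of_one_le_of_nonpos one_le_two ?_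
      have : 0 ≤ 2 ^ j * δ := by positivity
      linarith
    · have : (2 : ℝ) ^ (m + j) * δ = 2 ^ j := by
        rw [hδ, pow_add, inv_pow]; field_simp
      simp only [hw, this]
      rw [one_div, inv_pow, ← Real.rpow_natCast 2 j, ← Real.rpow_neg (by norm_num)]
      refine Real.rpow_le_rpow_of_exponent_le one_le_two (neg_le_neg ?_)
      rw [Real.rpow_natCast]
      exact_mod_cast (Nat.lt_two_pow_self (n := j)).le
  rw [← Finset.sum_fiberwise_of_maps_to hmaps]
  refine (Finset.sum_le_sum fun j _ ↦ hfiber j).trans ?_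
  rw [Finset.sum_add_distrib, ← Finset.mul_sum, ← Finset.mul_sum]
  have hBl : 0 ≤ B / Real.log 2 := by positivity
  nlinarith [hgeom (m + N), mul_le_mul_of_nonneg_left hwsum hc,
    mul_le_mul_of_nonneg_left (hgeom (m + N)) hBl]

open Units in
/-- If `p - 1 ∣ L` for all `p ∈ P`, then the image of the units in `∏ p ∈ P, 𝔽_p` has exponent
dividing `L`, so sums of `k` units can only cover it when the product of the primes is small. -/
lemma prod_le_of_forall_eq_sum_units {K : Type*} [Field K] [NumberField K] {k : ℕ}
    (hk : ∀ α : 𝓞 K, ∃ u : Fin k → (𝓞 K)ˣ, α = ∑ i, (u i : 𝓞 K)) {L : ℕ} (hL : L ≠ 0)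
    {P : Finset ℕ} (hP : ∀ p ∈ P, p.Prime ∧ Nonempty (𝓞 K →+* ZMod p) ∧ p - 1 ∣ L) :
    ∏ p ∈ P, p ≤ (torsionOrder K * L ^ rank K) ^ k := by
  classical
  have : NeZero L := ⟨hL⟩
  have hprime (p : P) : Fact (p : ℕ).Prime := ⟨(hP p p.2).1⟩
  have f (p : P) : 𝓞 K →+* ZMod p := (hP p p.2).2.1.some
  set φ : 𝓞 K →+* ∀ p : P, ZMod p := RingHom.pi f with hφ
  set Φ := Units.map (φ : 𝓞 K →* ∀ p : P, ZMod p) with hΦ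
  have hΦL (x : (𝓞 K)ˣ) : Φ x ^ L = 1 := by
    ext p
    obtain ⟨c, hc⟩ := (hP p p.2).2.2
    have : (f p x) ^ (p - 1 : ℕ) = 1 :=
      ZMod.pow_card_sub_one_eq_one ((x.isUnit.map (f p)).ne_zero)
    simp only [hc, pow_mul]
    exact (congrArg (· ^ c) this).trans (one_pow c)
  let g : torsion K × (Fin (rank K) → Fin L) → ∀ p : P, ZMod p := fun ζe ↦
    Φ (ζe.1 * ∏ i, fundSystem K i ^ (ζe.2 i : ℕ))
  have hg (x : (𝓞 K)ˣ) : ∃ y, g y = φ x := by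
    obtain ⟨⟨ζ, e⟩, hx, -⟩ := exist_unique_eq_mul_prod K x
    have hLZ : (L : ℤ) ≠ 0 := by exact_mod_cast hL
    have hnn (i) : 0 ≤ e i % L := Int.emod_nonneg _ hLZ
    refine ⟨(ζ, fun i ↦ ⟨(e i % L).toNat, by
      have := Int.emod_lt_of_pos (e i) (by positivity : (0 : ℤ) < L)
      have := hnn i
      omega⟩), ?_⟩
    change ((Φ _ : (∀ p : P, ZMod p)ˣ) : ∀ p : P, ZMod p) = (Φ x : (∀ p : P, ZMod p)ˣ)
    congr 1
    conv_rhs => rw [hx]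
    simp only [map_mul, map_prod, map_pow, map_zpow]
    congr 1
    refine Finset.prod_congr rfl fun i _ ↦ ?_
    rw [zpow_eq_zpow_emod' (e i) (hΦL _), ← zpow_natCast, Int.toNat_of_nonneg (hnn i)]
  have hsurj : Function.Surjective fun y : Fin k → torsion K × (Fin (rank K) → Fin L) ↦
      ∑ i, g (y i) := by
    intro z
    have hco : Pairwise (Function.onFun Nat.Coprime fun p : P ↦ (p : ℕ)) := fun p q hpq ↦
      (Nat.coprime_primes (hprime p).out (hprime q).out).mpr (Subtype.coe_ne_coe.mpr hpq)
    obtain ⟨b, rfl⟩ := (ZMod.prodEquivPi (fun p : P ↦ (p : ℕ)) hco).surjective z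
    obtain ⟨n, rfl⟩ := ZMod.intCast_surjective b
    obtain ⟨u, hu⟩ := hk n
    choose y hy using fun i ↦ hg (u i)
    refine ⟨y, ?_⟩
    simp only [hy]
    rw [← map_sum, ← hu, map_intCast, map_intCast]
  have hle := Nat.card_le_card_of_surjective _ hsurj
  rw [Nat.card_pi, Finset.prod_congr rfl fun p _ ↦ Nat.card_zmod _,
    Finset.prod_coe_sort P fun p ↦ p] at hle
  simpa [Nat.card_pi, Nat.card_prod, torsionOrder] using hle

lemma sum_log_le_of_forall_eq_sum_units {K : Type*} [Field K] [NumberField K] {k : ℕ}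
    (hk : ∀ α : 𝓞 K, ∃ u : Fin k → (𝓞 K)ˣ, α = ∑ i, (u i : 𝓞 K)) {L : ℕ} (hL : L ≠ 0)
    {P : Finset ℕ} (hP : ∀ p ∈ P, p.Prime ∧ Nonempty (𝓞 K →+* ZMod p) ∧ p - 1 ∣ L) :
    ∑ p ∈ P, Real.log p ≤
      k * Units.rank K * Real.log L + k * Real.log (Units.torsionOrder K) := by
  have ht := Units.torsionOrder_pos K
  have h : ((∏ p ∈ P, p : ℕ) : ℝ) ≤ ((Units.torsionOrder K * L ^ Units.rank K) ^ k : ℕ) :=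
    Nat.cast_le.mpr (prod_le_of_forall_eq_sum_units hk hL hP)
  have h0 : ∀ p ∈ P, (p : ℝ) ≠ 0 := fun p hp ↦ Nat.cast_ne_zero.mpr (hP p hp).1.ne_zero
  push_cast at h
  have := Real.log_le_log (Finset.prod_pos fun p hp ↦ by have := (hP p hp).1.pos; positivity) h
  rw [Real.log_prod h0, Real.log_pow, Real.log_mul (by positivity) (by positivity),
    Real.log_pow] at this
  linarith

open Filter Topology in
/-- Corollary 1 (Jarden–Narkiewicz): the ring of integers of a number field is
not `k`-good for any `k`: there is an element which is not a sum of `k`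
units. -/
theorem ring_of_integers_not_k_good (K : Type) [Field K] [NumberField K]
    (k : ℕ) (hk : 1 ≤ k) :
    ∃ α : 𝓞 K, ¬∃ u : Fin k → (𝓞 K)ˣ, α = ∑ i, (u i : 𝓞 K) := by
  by_contra! hgood
  have hlog2 : 0 < Real.log 2 := Real.log_pos one_lt_two
  set n : ℝ := ((Module.finrank ℚ K : ℕ) : ℝ)
  set C : ℝ := k * Units.rank K
  set A : ℝ := k * Real.log (Units.torsionOrder K)
  have hC : 0 ≤ C := by positivity
  have hA : 0 ≤ A := by positivity
  obtain ⟨t, ht⟩ := exists_nat_gt ((4 * n * C + 1) / Real.log 2)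
  rw [div_lt_iff₀ hlog2] at ht
  obtain ⟨D, hD⟩ := exists_finset_gcd_log_le K (2 ^ t)
  set B : ℝ := 2 * (C * Real.log (2 ^ t : ℕ) + A)
  have hB : 0 ≤ B := by positivity
  have hlim : Tendsto (fun m : ℕ ↦ 1 + (2 : ℝ)⁻¹ ^ m) atTop (𝓝[>] 1) := by
    refine tendsto_nhdsWithin_iff.mpr ⟨?_, .of_forall fun m ↦ ?_⟩
    · simpa using (tendsto_pow_atTop_nhds_zero_of_lt_one (r := (2 : ℝ)⁻¹) (by norm_num)
        (by norm_num)).const_add 1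
    · have : (0 : ℝ) < 2⁻¹ ^ m := by positivity
      exact lt_add_of_pos_right _ this
  obtain ⟨m, ⟨P, hP, hle⟩, hm⟩ := ((hlim.eventually hD).and
    (tendsto_natCast_atTop_atTop.eventually_gt_atTop
      (D + n * (8 * C + 2 * (B / Real.log 2))))).exists
  have hup := sum_mul_rpow_le_of_sum_mul_log_div_le (P := P) (fun p hp ↦ (hP p hp).1.two_le)
    (g := fun p ↦ ((p - 1).gcd (2 ^ t) : ℕ)) (fun p ↦ by positivity)
    (by positivity : (0 : ℝ) ≤ 2 * C) hB
    (fun X hX ↦ sum_gcd_mul_log_div_le (fun p hp ↦ (hP p hp).1) hC (fun L hL ↦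
      sum_log_le_of_forall_eq_sum_units hgood hL fun p hp ↦
        ⟨(hP p (Finset.mem_filter.mp hp).1).1, (hP p (Finset.mem_filter.mp hp).1).2,
          (Finset.mem_filter.mp hp).2⟩) (by positivity) hX) m
  have hcard : ((2 ^ t : ℕ).divisors.card : ℝ) = t + 1 := by
    rw [Nat.divisors_prime_pow Nat.prime_two]; simp
  have hlog : -Real.log (1 + (2 : ℝ)⁻¹ ^ m - 1) = m * Real.log 2 := by
    rw [add_sub_cancel_left, Real.log_pow, Real.log_inv]; ring
  rw [hcard, hlog] at hle
  have hn : 0 ≤ n := Nat.cast_nonneg _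
  have h1 := hle.trans (mul_le_mul_of_nonneg_left hup hn)
  have h2 : (m : ℝ) * (4 * n * C + 1) ≤ m * (t * Real.log 2) := by gcongr
  have h3 : 0 ≤ (m : ℝ) * Real.log 2 := by positivity
  nlinarith
end

section
/- Let d and ℓ be integers with d ≥ 2 and ℓ ≥ d + 1, and let g ∈ ℂ[x] be a nonzero polynomial. If the d-th power g^d has at most ℓ nonzero coefficients, i.e. N(g^d) ≤ ℓ, then N(g) ≤ 1 + (4d)^{2^{ℓ−d−1}·d}. -/
open Polynomial

theorem Polynomial.Bivariate.coeff_coeff_swap {R : Type*} [CommRing R] (p : R[X][X]) (i j : ℕ) :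
    ((Bivariate.swap p).coeff i).coeff j = (p.coeff j).coeff i := by
  induction p using Polynomial.induction_on' with
  | add p q hp hq => simp [hp, hq]
  | monomial n p =>
    induction p using Polynomial.induction_on' with
    | add p q hp hq => simp_all [map_add]
    | monomial m a =>
      rw [Bivariate.swap_monomial_monomial]
      simp only [coeff_monomial]
      split_ifs <;> simp_all [coeff_monomial]

theorem Polynomial.Bivariate.natDegree_swap_le_iff {R : Type*} [CommRing R] {p : R[X][X]} {D : ℕ} :
    (Bivariate.swap p).natDegree ≤ D ↔ ∀ j, (p.coeff j).natDegree ≤ D := by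
  simp only [natDegree_le_iff_coeff_eq_zero]
  constructor
  · intro h j i hi
    rw [← coeff_coeff_swap, h i hi, coeff_zero]
  · intro h i hi
    ext j
    rw [coeff_coeff_swap, h j i hi, coeff_zero]

theorem Polynomial.Bivariate.natDegree_coeff_le_of_dvd {R : Type*} [CommRing R] [IsDomain R]
    {p q : R[X][X]} {D : ℕ} (h : p ∣ q) (hq : q ≠ 0) (hD : ∀ j, (q.coeff j).natDegree ≤ D) (j : ℕ) :
    (p.coeff j).natDegree ≤ D :=
  Bivariate.natDegree_swap_le_iff.1 ((natDegree_le_of_dvd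
    (_root_.map_dvd (Bivariate.swap (R := R)) h)
    ((map_ne_zero_iff _ Bivariate.swap.injective).2 hq)).trans
    (Bivariate.natDegree_swap_le_iff.2 hD)) j

/-- Evaluation of a bivariate polynomial of small `x`-degree at `y = x ^ N` only spreads out the
coefficients. -/
theorem Polynomial.coeff_eval_X_pow {R : Type*} [CommRing R] {N : ℕ} {p : R[X][X]}
    (hp : ∀ j, (p.coeff j).natDegree < N) {j r : ℕ} (hr : r < N) :
    (p.eval (X ^ N)).coeff (N * j + r) = (p.coeff j).coeff r := by
  rw [eval_eq_sum, Polynomial.sum, finsetSum_coeff, Finset.sum_eq_single j]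
  · rw [← pow_mul, add_comm, coeff_mul_X_pow]
  · intro i _ hij
    rw [← pow_mul, coeff_mul_X_pow']
    split_ifs with h
    · have : i < j := by
        by_contra! h'
        have : j + 1 ≤ i := by omega
        have := Nat.mul_le_mul_left N this
        rw [mul_add] at this
        omega
      apply coeff_eq_zero_of_natDegree_lt
      have h1 := hp i
      have := Nat.mul_le_mul_left N (Nat.succ_le_of_lt this)
      rw [Nat.succ_eq_add_one, mul_add] at this
      omega
    · rfl
  · intro h
    simp [notMem_support_iff.1 h]

/-- The Euler derivation `x ∂/∂x + N y ∂/∂y` of `R[x][y]`, which corresponds to `x d/dx` under the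
substitution `y = x ^ N`. -/
noncomputable def weightedEuler (R : Type*) [CommRing R] (N : ℕ) : Derivation R R[X][X] R[X][X] :=
  (PolynomialModule.equivPolynomialSelf (R := R[X])).toLinearMap.compDer
    ((X : R[X]) • (derivative' : Derivation R R[X] R[X])).mapCoeffs +
  ((N : R[X][X]) * X) • (derivative' : Derivation R[X] R[X][X] R[X][X]).restrictScalars R

theorem coeff_weightedEuler {R : Type*} [CommRing R] (N : ℕ) (p : R[X][X]) (j : ℕ) :
    (weightedEuler R N p).coeff j = X * derivative (p.coeff j) + (N * j : R[X]) * p.coeff j := by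
  have h : ((N : R[X][X]) * X * derivative p).coeff j = (N * j : R[X]) * p.coeff j := by
    rw [mul_assoc, ← C_eq_natCast, coeff_C_mul]
    cases j with
    | zero => simp
    | succ j =>
      rw [coeff_X_mul, coeff_derivative]
      push_cast
      ring
  rw [← h]
  rfl

theorem eval_weightedEuler {R : Type*} [CommRing R] (N : ℕ) (p : R[X][X]) :
    (weightedEuler R N p).eval (X ^ N) = X * derivative (p.eval (X ^ N)) := by
  induction p using Polynomial.induction_on' with
  | add p q hp hq => simp [hp, hq, mul_add]
  | monomial n a =>
    have : weightedEuler R N (monomial n a) =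
        monomial n (X * derivative a + (N * n : R[X]) * a) := by
      ext1 j
      rw [coeff_weightedEuler]
      simp only [coeff_monomial]
      split_ifs with h <;> simp [h]
    rw [this]
    simp only [eval_monomial, derivative_mul, ← pow_mul, derivative_X_pow]
    rcases Nat.eq_zero_or_pos (N * n) with h | h
    · have h' : (N * n : R[X]) = 0 := by exact_mod_cast congrArg (Nat.cast : ℕ → R[X]) h
      simp [h, h']
    · obtain ⟨k, hk⟩ : ∃ k, N * n = k + 1 := ⟨N * n - 1, by omega⟩
      have h' : (N * n : R[X]) = k + 1 := by exact_mod_cast congrArg (Nat.cast : ℕ → R[X]) hk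
      rw [hk, h']
      simp
      ring

theorem natDegree_weightedEuler_le {R : Type*} [CommRing R] (N : ℕ) (p : R[X][X]) :
    (weightedEuler R N p).natDegree ≤ p.natDegree := by
  rw [natDegree_le_iff_coeff_eq_zero]
  intro j hj
  simp [coeff_weightedEuler, coeff_eq_zero_of_natDegree_lt hj]

theorem natDegree_coeff_weightedEuler_le {R : Type*} [CommRing R] (N : ℕ) (p : R[X][X]) (j : ℕ) :
    ((weightedEuler R N p).coeff j).natDegree ≤ (p.coeff j).natDegree := by
  rw [natDegree_le_iff_coeff_eq_zero]
  intro i hi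
  have h : (p.coeff j).coeff i = 0 := coeff_eq_zero_of_natDegree_lt hi
  rw [coeff_weightedEuler, ← Nat.cast_mul, ← C_eq_natCast, coeff_add, coeff_C_mul, h]
  cases i <;> simp [coeff_derivative, h]

theorem Polynomial.resultant_ne_zero_of_isRelPrime {R : Type*} [CommRing R] [IsDomain R]
    [DecompositionMonoid R[X]] {f g : R[X]} (hf : f ≠ 0) (h : IsRelPrime f g) :
    resultant f g ≠ 0 := by
  intro h0
  obtain ⟨v, hv, hv0⟩ := Matrix.exists_mulVec_eq_zero_iff.2 h0
  rw [← toMatrix_sylvesterMap' f g le_rfl le_rfl] at hv0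
  set b := (((degreeLT.basis R f.natDegree).prod (degreeLT.basis R g.natDegree)).reindex
    finSumFinEquiv) with hb
  set w := b.equivFun.symm v with hw
  have hv' : v = b.repr w := by
    rw [hw, ← b.equivFun_apply, LinearEquiv.apply_symm_apply]
  rw [hv', LinearMap.toMatrix_mulVec_repr] at hv0
  have h1 : sylvesterMap f g le_rfl le_rfl w = 0 := by
    simpa using hv0
  have h2 : f * w.2 + g * w.1 = 0 := by
    have := congrArg Subtype.val h1
    simpa using this
  have h3 : f ∣ w.1 := by
    refine h.dvd_of_dvd_mul_left (Dvd.intro (-w.2 : R[X]) ?_)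
    linear_combination - h2
  have h4 : (w.1 : R[X]) = 0 := by
    refine eq_zero_of_dvd_of_degree_lt h3 ?_
    rw [degree_eq_natDegree hf]
    exact mem_degreeLT.1 w.1.2
  rw [h4, mul_zero, add_zero, mul_eq_zero, or_iff_right hf] at h2
  have : w = 0 := Prod.ext (Subtype.ext h4) (Subtype.ext h2)
  rw [this] at hv'
  simp at hv'
  exact hv hv'

theorem Polynomial.natDegree_det_le {R n : Type*} [CommRing R] [Fintype n] [DecidableEq n]
    {M : Matrix n n R[X]} {D : ℕ} (h : ∀ i j, (M i j).natDegree ≤ D) :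
    M.det.natDegree ≤ Fintype.card n * D := by
  rw [Matrix.det_apply]
  refine natDegree_sum_le_of_forall_le _ _ fun σ _ => ?_
  refine (natDegree_smul_le _ _).trans ((natDegree_prod_le _ _).trans ?_)
  refine (Finset.sum_le_card_nsmul _ _ D fun i _ => h _ _).trans ?_
  simp

theorem Polynomial.natDegree_resultant_le {R : Type*} [CommRing R] {f g : R[X][X]} {D : ℕ}
    (hf : ∀ j, (f.coeff j).natDegree ≤ D) (hg : ∀ j, (g.coeff j).natDegree ≤ D) (m n : ℕ) :
    (resultant f g m n).natDegree ≤ (m + n) * D := by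
  refine (natDegree_det_le (D := D) fun i j => ?_).trans_eq (by simp)
  induction j using Fin.addCases <;> simp only [sylvester, Matrix.of_apply, Fin.addCases_left,
    Fin.addCases_right] <;> split_ifs <;> simp [hf, hg]

/-- An eigenvector of the Euler derivation of small `x`-degree is a monomial. -/
theorem dvd_of_dvd_weightedEuler {k : Type*} [Field k] [CharZero k] {N : ℕ} {H : k[X][X]}
    (hN : ∀ j, (H.coeff j).natDegree < N) (hH : ¬ IsUnit H) (hdvd : H ∣ weightedEuler k N H) :
    C X ∣ H ∨ X ∣ H := by
  by_cases hH0 : H = 0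
  · simp [hH0]
  obtain ⟨q, hq⟩ := hdvd
  have hle : (weightedEuler k N H).natDegree ≤ H.natDegree := natDegree_weightedEuler_le N H
  -- the cofactor is constant
  obtain ⟨c, rfl⟩ : ∃ c : k, q = C (C c) := by
    by_cases hq0 : q = 0
    · exact ⟨0, by simp [hq0]⟩
    rw [hq, natDegree_mul hH0 hq0] at hle
    obtain ⟨a, rfl⟩ := natDegree_eq_zero.1 (show q.natDegree = 0 by omega)
    have ha : a ≠ 0 := by rintro rfl; simp at hq0
    have h1 := natDegree_coeff_weightedEuler_le N H H.natDegree
    rw [hq, coeff_mul_C, natDegree_mul (by simpa using hH0) ha] at h1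
    obtain ⟨c, rfl⟩ := natDegree_eq_zero.1 (show a.natDegree = 0 by omega)
    exact ⟨c, rfl⟩
  have key : ∀ j r, (H.coeff j).coeff r ≠ 0 → ((N * j + r : ℕ) : k) = c := by
    intro j r h
    have h1 := congrArg (fun p => (p.coeff j).coeff r) hq
    simp only [coeff_weightedEuler, coeff_mul_C] at h1
    rw [← Nat.cast_mul, ← C_eq_natCast, coeff_add, coeff_C_mul] at h1
    have h2 : (X * derivative (H.coeff j)).coeff r = r * (H.coeff j).coeff r := by
      cases r with
      | zero => simp
      | succ r => rw [coeff_X_mul, coeff_derivative]; push_cast; ring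
    rw [h2] at h1
    apply mul_right_cancel₀ h
    push_cast at h1 ⊢
    linear_combination h1
  obtain ⟨j, hj⟩ := support_nonempty.2 hH0
  obtain ⟨r, hr⟩ := support_nonempty.2 (mem_support_iff.1 hj)
  rw [mem_support_iff] at hr
  have uniq : ∀ j' r', (H.coeff j').coeff r' ≠ 0 → j' = j ∧ r' = r := by
    intro j' r' h
    have h1 : N * j' + r' = N * j + r := by
      exact_mod_cast (key _ _ h).trans (key _ _ hr).symm
    have h2 : r < N := (le_natDegree_of_ne_zero hr).trans_lt (hN j)
    have h3 : r' < N := (le_natDegree_of_ne_zero h).trans_lt (hN j')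
    have h4 : r' = r := by
      have := congrArg (· % N) h1
      simpa [Nat.mul_add_mod, Nat.mod_eq_of_lt, h2, h3] using this
    have h5 : N * j' = N * j := by omega
    exact ⟨Nat.eq_of_mul_eq_mul_left (by omega) h5, h4⟩
  have hmon : H = C (C ((H.coeff j).coeff r)) * C X ^ r * X ^ j := by
    ext j' r'
    rw [← C_pow, ← C_mul, coeff_C_mul_X_pow]
    by_cases h : (H.coeff j').coeff r' = 0
    · rw [h]
      split_ifs with h1
      · subst h1
        rw [coeff_C_mul_X_pow, if_neg]
        rintro rfl
        exact hr h
      · simp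
    · obtain ⟨rfl, rfl⟩ := uniq _ _ h
      simp
  rcases Nat.eq_zero_or_pos r with h0 | h0
  · rcases Nat.eq_zero_or_pos j with h1 | h1
    · subst h0 h1
      refine absurd ?_ hH
      rw [hmon]
      simpa using hr
    · right
      rw [hmon]
      exact (dvd_pow_self _ h1.ne').mul_left _
  · left
    rw [hmon]
    exact ((dvd_pow_self _ h0.ne').mul_left _).mul_right _

/-- If the prime `H` does not divide its own derivative, iterating the derivation removes all
factors `H`. -/
theorem Derivation.not_dvd_iterate {k A : Type*} [CommRing k] [CommRing A] [Algebra k A]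
    (δ : Derivation k A A) {H : A} (hH : Prime H) (hδ : ¬ H ∣ δ H)
    (hunit : ∀ n : ℕ, n ≠ 0 → ¬ H ∣ n) (e : ℕ) {V : A} (hV : ¬ H ∣ V) :
    ¬ H ∣ (δ^[e]) (H ^ e * V) := by
  induction e generalizing V with
  | zero => simpa using hV
  | succ e ih =>
    have : δ (H ^ (e + 1) * V) = H ^ e * ((e + 1 : ℕ) * δ H * V + H * δ V) := by
      rw [Derivation.leibniz, Derivation.leibniz_pow]
      simp only [smul_eq_mul, nsmul_eq_mul, Nat.add_sub_cancel]
      ring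
    rw [Function.iterate_succ_apply, this]
    apply ih
    rw [dvd_add_left (dvd_mul_right _ _)]
    intro h
    rcases hH.dvd_or_dvd h with h | h
    · rcases hH.dvd_or_dvd h with h | h
      · exact hunit _ e.succ_ne_zero h
      · exact hδ h
    · exact hV h

theorem exists_eq_mul_pow_of_wfDvdMonoid {A : Type*} [CommRing A] [IsDomain A] [WfDvdMonoid A]
    {d : ℕ} (hd : d ≠ 0) {a : A} (ha : a ≠ 0) :
    ∃ w s, a = w * s ^ d ∧ ∀ H, Prime H → ¬ H ^ d ∣ w := by
  induction a using (wellFounded_dvdNotUnit (α := A)).induction with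
  | _ a ih =>
    by_cases h : ∃ H, Prime H ∧ H ^ d ∣ a
    · obtain ⟨H, hH, b, rfl⟩ := h
      have hb : b ≠ 0 := by rintro rfl; simp at ha
      obtain ⟨w, s, rfl, hw⟩ := ih b ⟨hb, H ^ d, fun hu => hH.not_isUnit
        ((isUnit_pow_iff hd).1 hu), mul_comm _ _⟩ hb
      exact ⟨w, H * s, by ring, hw⟩
    · push Not at h
      exact ⟨a, 1, by simp, h⟩

theorem pow_dvd_iterate_X_mul_derivative {k : Type*} [CommRing k] {t : k[X]} {d : ℕ} (i : ℕ)
    {p : k[X]} (h : t ^ (d + i) ∣ p) : t ^ d ∣ (fun q => X * derivative q)^[i] p := by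
  induction i generalizing p with
  | zero => simpa using h
  | succ i ih =>
    rw [Function.iterate_succ_apply]
    apply ih
    obtain ⟨q, rfl⟩ := h
    refine Dvd.dvd.mul_left ?_ _
    rw [derivative_mul, derivative_pow]
    refine dvd_add ?_ ?_
    · exact Dvd.intro_left (C ((d + (i + 1) : ℕ) : k) * derivative t * q) (by
        rw [show d + (i + 1) - 1 = d + i by omega]; ring)
    · exact ((pow_dvd_pow t (by omega)).mul_right _)

/-- Some combination of `a 0, …, a (d - 1)` is coprime to `w` as soon as no prime divides all. -/
theorem exists_isRelPrime_sum {k A : Type*} [Field k] [Infinite k] [CommRing A] [IsDomain A]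
    [UniqueFactorizationMonoid A] [Algebra k A] {w : A} (hw : w ≠ 0) {d : ℕ} (a : ℕ → A)
    (h : ∀ H, Prime H → H ∣ w → ∃ i < d, ¬ H ∣ a i) :
    ∃ c : k, IsRelPrime w (∑ i ∈ Finset.range d, c ^ i • a i) := by
  classical
  let bad (H : A) : Set k := {c | H ∣ ∑ i ∈ Finset.range d, c ^ i • a i}
  obtain ⟨f, hf, hfw⟩ := UniqueFactorizationMonoid.exists_prime_factors w hw
  have hbad : ∀ H ∈ f.toFinset, (bad H).Finite := by
    intro H hHf
    rw [Multiset.mem_toFinset] at hHf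
    have hH := hf H hHf
    have := (Ideal.span_singleton_prime hH.ne_zero).2 hH
    let B := A ⧸ Ideal.span {H}
    let P : B[X] := ∑ i ∈ Finset.range d, monomial i (Ideal.Quotient.mk _ (a i))
    have hP : P ≠ 0 := by
      obtain ⟨i, hi, hHi⟩ := h H hH ((Multiset.dvd_prod hHf).trans hfw.dvd)
      intro h0
      have := congrArg (fun p => p.coeff i) h0
      simp only [P, finsetSum_coeff, coeff_monomial, Finset.sum_ite_eq', Finset.mem_range, hi,
        if_true, coeff_zero] at this
      rw [Ideal.Quotient.eq_zero_iff_mem, Ideal.mem_span_singleton] at this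
      exact hHi this
    refine Set.Finite.subset (P.roots.toFinset.finite_toSet.preimage
      (FaithfulSMul.algebraMap_injective k B).injOn) fun c hc => ?_
    have hc' : H ∣ ∑ i ∈ Finset.range d, c ^ i • a i := hc
    simp only [Set.mem_preimage, Finset.mem_coe, Multiset.mem_toFinset, mem_roots hP, IsRoot.def]
    rw [← Ideal.mem_span_singleton, ← Ideal.Quotient.eq_zero_iff_mem] at hc'
    rw [← hc']
    simp only [P, eval_finsetSum, eval_monomial, map_sum, Algebra.smul_def, map_mul, map_pow]
    exact Finset.sum_congr rfl fun i _ => mul_comm _ _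
  obtain ⟨c, hc⟩ := (Set.Finite.biUnion (f.toFinset.finite_toSet) hbad).exists_notMem
  refine ⟨c, (UniqueFactorizationMonoid.isRelPrime_iff_no_prime_factors hw).2 ?_⟩
  intro H hHw hHs hH
  obtain ⟨H', hH', hdvd⟩ := Prime.exists_mem_multiset_dvd hH (hHw.trans hfw.symm.dvd)
  simp only [Set.mem_iUnion, not_exists] at hc
  exact hc H' (by simpa using hH') ((Prime.associated_of_dvd hH (hf H' hH') hdvd).symm.dvd.trans hHs)

theorem le_natDegree_eval_X_pow {R : Type*} [CommRing R] {N : ℕ} {p : R[X][X]}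
    (hp : ∀ j, (p.coeff j).natDegree < N) (hp0 : p ≠ 0) :
    p.eval (X ^ N) ≠ 0 ∧ N * p.natDegree ≤ (p.eval (X ^ N)).natDegree := by
  have h : (p.eval (X ^ N)).coeff (N * p.natDegree + p.leadingCoeff.natDegree) ≠ 0 := by
    rw [coeff_eval_X_pow hp (r := p.leadingCoeff.natDegree) (hp p.natDegree)]
    simpa using hp0
  refine ⟨fun h0 => h (by rw [h0, coeff_zero]), ?_⟩
  exact (Nat.le_add_right _ _).trans (le_natDegree_of_ne_zero h)

theorem iterate_weightedEuler {R : Type*} [CommRing R] (N : ℕ) (p : R[X][X]) (i : ℕ) :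
    ((weightedEuler R N)^[i] p).natDegree ≤ p.natDegree ∧
    (∀ j, (((weightedEuler R N)^[i] p).coeff j).natDegree ≤ (p.coeff j).natDegree) ∧
    ((weightedEuler R N)^[i] p).eval (X ^ N) =
      (fun q => X * derivative q)^[i] (p.eval (X ^ N)) := by
  induction i with
  | zero => simp
  | succ i ih =>
    obtain ⟨h1, h2, h3⟩ := ih
    simp only [Function.iterate_succ_apply']
    refine ⟨(natDegree_weightedEuler_le N _).trans h1,
      fun j => (natDegree_coeff_weightedEuler_le N _ j).trans (h2 j), ?_⟩
    rw [eval_weightedEuler, h3]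

/-- A bivariate polynomial free of `d`-th powers, of positive `y`-degree and small `x`-degree does
not become a `d`-th power under the substitution `y = x ^ N`. -/
theorem eval_X_pow_ne_pow {k : Type*} [Field k] [CharZero k] {d D N : ℕ}
    (hN : 2 * d * D < N) {W : k[X][X]} (hW : W.natDegree ≠ 0)
    (hD : ∀ j, (W.coeff j).natDegree ≤ D) (hX : ¬ C X ∣ W) (hY : ¬ X ∣ W)
    (hfree : ∀ H, Prime H → ¬ H ^ d ∣ W) (t : k[X]) :
    W.eval (X ^ N) ≠ t ^ d := by
  intro ht
  have hW0 : W ≠ 0 := by rintro rfl; simp at hW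
  have hd : d ≠ 0 := by
    rintro rfl
    obtain ⟨H, hH, -⟩ := WfDvdMonoid.exists_irreducible_factor (a := W)
      (fun h => hW (natDegree_eq_zero_of_isUnit h)) hW0
    exact hfree H hH.prime (by simp)
  have hDN : D < N := lt_of_le_of_lt (Nat.le_mul_of_pos_left D (by omega)) hN
  set δ := weightedEuler k N with hδ
  have hprime : ∀ H, Prime H → H ∣ W → ∃ i < d, ¬ H ∣ δ^[i] W := by
    intro H hH hHW
    have hfin : FiniteMultiplicity H W := FiniteMultiplicity.of_prime_left hH hW0
    obtain ⟨V, hV, hHV⟩ := hfin.exists_eq_pow_mul_and_not_dvd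
    refine ⟨multiplicity H W, ?_, ?_⟩
    · by_contra! h
      exact hfree H hH ((pow_dvd_pow H h).trans ⟨V, hV⟩)
    · nth_rw 2 [hV]
      refine Derivation.not_dvd_iterate δ hH (fun h => ?_) (fun n hn h => ?_) _ hHV
      · rcases dvd_of_dvd_weightedEuler (fun j => (Bivariate.natDegree_coeff_le_of_dvd hHW hW0 hD
          j).trans_lt hDN) hH.not_isUnit h with h | h
        · exact hX (h.trans hHW)
        · exact hY (h.trans hHW)
      · refine hH.not_isUnit (isUnit_of_dvd_unit h ?_)
        have : ((n : ℕ) : k[X][X]) = algebraMap k k[X][X] n := by simp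
        rw [this]
        exact (IsUnit.mk0 (n : k) (by exact_mod_cast hn)).map _
  obtain ⟨c, hc⟩ := exists_isRelPrime_sum (k := k) hW0 _ hprime
  set P := ∑ i ∈ Finset.range d, c ^ i • δ^[i] W with hP
  have hPy : P.natDegree ≤ W.natDegree := by
    refine natDegree_sum_le_of_forall_le _ _ fun i _ => ?_
    exact (natDegree_smul_le _ _).trans (iterate_weightedEuler N W i).1
  have hPx : ∀ j, (P.coeff j).natDegree ≤ D := by
    intro j
    rw [hP, finsetSum_coeff]
    refine natDegree_sum_le_of_forall_le _ _ fun i _ => ?_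
    rw [coeff_smul]
    exact (natDegree_smul_le _ _).trans (((iterate_weightedEuler N W i).2.1 j).trans (hD j))
  have hPt : t ∣ P.eval (X ^ N) := by
    rw [hP, eval_finsetSum]
    refine Finset.dvd_sum fun i hi => ?_
    rw [Finset.mem_range] at hi
    rw [eval_smul, smul_eq_C_mul, (iterate_weightedEuler N W i).2.2, ht]
    refine Dvd.dvd.mul_left ?_ _
    have := pow_dvd_iterate_X_mul_derivative (t := t) (d := d - i) i (p := t ^ d)
      (by rw [Nat.sub_add_cancel hi.le])
    exact (dvd_pow_self t (by omega)).trans this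
  obtain ⟨a, b, -, -, hab⟩ := exists_mul_add_mul_eq_C_resultant W P le_rfl le_rfl (Or.inl hW)
  have hρ := resultant_ne_zero_of_isRelPrime hW0 hc
  have hρd := natDegree_resultant_le hD hPx W.natDegree P.natDegree
  have htρ : t ∣ resultant W P := by
    have h := congrArg (eval (X ^ N)) hab
    rw [eval_C, eval_add, eval_mul, eval_mul, ht] at h
    rw [← h]
    exact dvd_add ((dvd_pow_self t hd).mul_right _) (hPt.mul_right _)
  have h1 := natDegree_le_of_dvd htρ hρ
  have h2 := (le_natDegree_eval_X_pow (fun j => (hD j).trans_lt hDN) hW0).2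
  rw [ht, natDegree_pow] at h2
  have h3 : d * t.natDegree ≤ d * ((W.natDegree + W.natDegree) * D) :=
    Nat.mul_le_mul_left _ (h1.trans (hρd.trans (Nat.mul_le_mul_right _ (by omega))))
  have h4 : 2 * d * D * W.natDegree < N * W.natDegree :=
    Nat.mul_lt_mul_of_pos_right hN (by omega)
  have h5 : d * ((W.natDegree + W.natDegree) * D) = 2 * d * D * W.natDegree := by ring
  omega

/-- A bivariate polynomial of small `x`-degree that becomes a `d`-th power under the substitution
`y = x ^ N` is itself a `d`-th power. -/
theorem exists_eq_pow_of_eval_X_pow_eq_pow {k : Type*} [Field k] [CharZero k] {d D N : ℕ}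
    (hd : d ≠ 0) (hN : 2 * d * D < N) {Φ : k[X][X]} (hD : ∀ j, (Φ.coeff j).natDegree ≤ D)
    (hX : ¬ C X ∣ Φ) (hY : ¬ X ∣ Φ) {h : k[X]} (heval : Φ.eval (X ^ N) = h ^ d) :
    ∃ G, Φ = G ^ d := by
  have hΦ : Φ ≠ 0 := by rintro rfl; simp at hX
  have hDN : D < N := lt_of_le_of_lt (Nat.le_mul_of_pos_left D (by omega)) hN
  obtain ⟨W, S, rfl, hW⟩ := exists_eq_mul_pow_of_wfDvdMonoid hd hΦ
  have hS0 : S ≠ 0 := by rintro rfl; simp [hd] at hΦ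
  have hS : S.eval (X ^ N) ≠ 0 := (le_natDegree_eval_X_pow (fun j =>
    (Bivariate.natDegree_coeff_le_of_dvd ((dvd_pow_self S hd).mul_left W) hΦ hD j).trans_lt hDN)
    hS0).1
  rw [eval_mul, eval_pow] at heval
  obtain ⟨t, rfl⟩ : S.eval (X ^ N) ∣ h :=
    (IsIntegrallyClosed.pow_dvd_pow_iff hd).1 (Dvd.intro_left _ heval)
  have ht : W.eval (X ^ N) = t ^ d := by
    apply mul_right_cancel₀ (pow_ne_zero d hS)
    rw [heval]; ring
  by_cases hw : W.natDegree = 0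
  · obtain ⟨a, rfl⟩ := natDegree_eq_zero.1 hw
    rw [eval_C] at ht
    exact ⟨C t * S, by rw [mul_pow, ht, C_pow]⟩
  · have hdvd : W ∣ W * S ^ d := dvd_mul_right _ _
    exact absurd ht (eval_X_pow_ne_pow hN hw (Bivariate.natDegree_coeff_le_of_dvd hdvd hΦ hD)
      (fun h => hX (h.trans hdvd)) (fun h => hY (h.trans hdvd)) hW t)

/-- Dirichlet's theorem on simultaneous approximation, for rationals with a common denominator. -/
theorem exists_simultaneous_approximation {n Q : ℕ} (hn : 0 < n) (hQ : 0 < Q) (I : Finset ℕ) :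
    ∃ q : ℕ, 0 < q ∧ q ≤ Q ^ I.card ∧
      ∀ e ∈ I, ∃ p r : ℤ, (q * e : ℤ) = p * n + r ∧ Q * |r| < n := by
  have hlt (a : ℕ) : Q * (a % n) / n < Q :=
    Nat.div_lt_of_lt_mul (by rw [mul_comm]; exact Nat.mul_lt_mul_of_pos_right (Nat.mod_lt _ hn) hQ)
  let φ (j : ℕ) : I → Fin Q := fun e => ⟨Q * ((j * e) % n) / n, hlt _⟩
  obtain ⟨i, hi, j, hj, hij, hφ⟩ := Finset.exists_ne_map_eq_of_card_lt_of_maps_to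
    (s := Finset.range (Q ^ I.card + 1)) (t := Finset.univ) (f := φ) (by simp) (by simp)
  wlog hlt' : i < j generalizing i j
  · exact this j hj i hi hij.symm hφ.symm (by omega)
  rw [Finset.mem_range] at hi hj
  refine ⟨j - i, by omega, by omega, fun e he => ?_⟩
  refine ⟨((j * e / n : ℕ) : ℤ) - ((i * e / n : ℕ) : ℤ),
    ((j * e % n : ℕ) : ℤ) - ((i * e % n : ℕ) : ℤ), ?_, ?_⟩
  · have h1 : ((n * (j * e / n) + j * e % n : ℕ) : ℤ) = (j * e : ℕ) := by rw [Nat.div_add_mod]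
    have h2 : ((n * (i * e / n) + i * e % n : ℕ) : ℤ) = (i * e : ℕ) := by rw [Nat.div_add_mod]
    rw [Nat.cast_sub hlt'.le]
    push_cast at h1 h2 ⊢
    linear_combination h2 - h1
  · have h : Q * (i * e % n) / n = Q * (j * e % n) / n :=
      congrArg Fin.val (congrFun hφ ⟨e, he⟩)
    have h1 := Nat.div_add_mod (Q * (i * e % n)) n
    have h2 := Nat.div_add_mod (Q * (j * e % n)) n
    have h3 := Nat.mod_lt (Q * (i * e % n)) hn
    have h4 := Nat.mod_lt (Q * (j * e % n)) hn
    rw [h] at h1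
    have h5 : (Q : ℤ) * |((j * e % n : ℕ) : ℤ) - ((i * e % n : ℕ) : ℤ)| =
        |((Q * (j * e % n) : ℕ) : ℤ) - ((Q * (i * e % n) : ℕ) : ℤ)| := by
      push_cast
      rw [← mul_sub, abs_mul, Nat.abs_cast]
    rw [h5, abs_lt]
    constructor <;> omega

theorem lt_card_support_of_X_sub_C_pow_dvd {R : Type*} [CommRing R] [IsDomain R] [CharZero R]
    {a : R} (ha : a ≠ 0) {m : ℕ} {p : R[X]} (hp : p ≠ 0) (h : (X - C a) ^ m ∣ p) :
    m < p.support.card := by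
  induction m generalizing p with
  | zero => simpa [Finset.card_pos] using hp
  | succ m ih =>
    obtain ⟨v, hv⟩ := support_nonempty.2 hp
    have hcoeff : ∀ r, (X * derivative p - C (v : R) * p).coeff r = (r - v) * p.coeff r := by
      intro r
      rw [coeff_sub, coeff_C_mul]
      cases r with
      | zero => simp
      | succ r => rw [coeff_X_mul, coeff_derivative]; push_cast; ring
    have hdvd : (X - C a) ^ m ∣ X * derivative p - C (v : R) * p := by
      refine dvd_sub (Dvd.dvd.mul_left ?_ _) (((pow_dvd_pow _ m.le_succ).trans h).mul_left _)
      obtain ⟨q, rfl⟩ := h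
      rw [derivative_mul, derivative_pow]
      simp only [Nat.add_sub_cancel]
      exact dvd_add (Dvd.intro_left (C ((m + 1 : ℕ) : R) * derivative (X - C a) * q) (by ring))
        ((pow_dvd_pow _ m.le_succ).mul_right _)
    have hsupp : (X * derivative p - C (v : R) * p).support ⊆ p.support.erase v := by
      intro r hr
      rw [mem_support_iff, hcoeff] at hr
      rw [Finset.mem_erase, mem_support_iff]
      refine ⟨?_, right_ne_zero_of_mul hr⟩
      rintro rfl
      simp at hr
    have hne : X * derivative p - C (v : R) * p ≠ 0 := by
      intro h0
      have hmon : p = C (p.coeff v) * X ^ v := by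
        ext r
        rw [coeff_C_mul_X_pow]
        split_ifs with hr
        · rw [hr]
        · have := hcoeff r
          rw [h0, coeff_zero, eq_comm, mul_eq_zero, sub_eq_zero] at this
          exact this.resolve_left (by exact_mod_cast hr)
      have hroot : p.eval a = 0 := by
        rw [← IsRoot.def, ← dvd_iff_isRoot]
        exact (dvd_pow_self _ m.succ_ne_zero).trans h
      rw [hmon, eval_C_mul, eval_pow, eval_X] at hroot
      exact mul_ne_zero (mem_support_iff.1 hv) (pow_ne_zero _ ha) hroot
    have := (ih hne hdvd).trans_le (Finset.card_le_card hsupp)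
    rw [Finset.card_erase_of_mem hv] at this
    omega

theorem card_support_X_pow_mul {R : Type*} [CommRing R] (s : ℕ) (p : R[X]) :
    (X ^ s * p).support.card = p.support.card := by
  rw [mul_comm]
  symm
  refine Finset.card_bij' (fun i _ => i + s) (fun i _ => i - s) ?_ ?_ ?_ ?_
  · intro i hi
    simpa [coeff_mul_X_pow] using hi
  · intro i hi
    rw [mem_support_iff, coeff_mul_X_pow'] at hi
    split_ifs at hi with h
    · simpa using hi
    · exact absurd rfl hi
  · simp
  · intro i hi
    rw [mem_support_iff, coeff_mul_X_pow'] at hi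
    split_ifs at hi with h
    · exact Nat.sub_add_cancel h
    · exact absurd rfl hi

theorem exists_eq_X_pow_mul {R : Type*} [CommRing R] [IsDomain R] {p : R[X]} (hp : p ≠ 0) :
    ∃ s q, p = X ^ s * q ∧ q.coeff 0 ≠ 0 := by
  obtain ⟨q, hq, hdvd⟩ := exists_eq_pow_rootMultiplicity_mul_and_not_dvd p hp 0
  rw [C_0, sub_zero] at hq hdvd
  exact ⟨_, q, hq, fun h => hdvd (X_dvd_iff.2 h)⟩

theorem card_support_le_one_of_card_support_pow_le {k : Type*} [Field k] [CharZero k]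
    [IsAlgClosed k] {d : ℕ} {g : k[X]} (hg : g ≠ 0) (h : (g ^ d).support.card ≤ d) :
    g.support.card ≤ 1 := by
  obtain ⟨s, q, rfl, hq⟩ := exists_eq_X_pow_mul hg
  rw [card_support_X_pow_mul]
  rw [mul_pow, ← pow_mul, card_support_X_pow_mul] at h
  have hq0 : q ≠ 0 := by rintro rfl; simp at hq
  by_cases hdeg : q.degree = 0
  · rw [eq_C_of_degree_eq_zero hdeg, support_C hq]
    simp
  · obtain ⟨a, ha⟩ := IsAlgClosed.exists_root q hdeg
    have ha0 : a ≠ 0 := by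
      rintro rfl
      rw [IsRoot.def, ← coeff_zero_eq_eval_zero] at ha
      exact hq ha
    have := lt_card_support_of_X_sub_C_pow_dvd ha0 (pow_ne_zero d hq0)
      (pow_dvd_pow_of_dvd (dvd_iff_isRoot.2 ha) d)
    omega

theorem card_support_expand {R : Type*} [CommRing R] {m : ℕ} (hm : 0 < m) (p : R[X]) :
    (expand R m p).support.card = p.support.card := by
  symm
  refine Finset.card_bij' (fun i _ => i * m) (fun i _ => i / m) ?_ ?_ ?_ ?_
  · intro i hi
    simpa [coeff_expand_mul hm] using hi
  · intro i hi
    rw [mem_support_iff, coeff_expand hm] at hi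
    split_ifs at hi with h
    · simpa using hi
    · exact absurd rfl hi
  · intro i _
    exact Nat.mul_div_cancel i hm
  · intro i hi
    rw [mem_support_iff, coeff_expand hm] at hi
    split_ifs at hi with h
    · exact Nat.div_mul_cancel h
    · exact absurd rfl hi

theorem mul_one_add_pow_div_le {B d a b T : ℕ} (hd : 2 ≤ d) (hB : 4 * d ≤ B) (hab : b ≤ a) (ha : 1 ≤ a)
    (hT : T ≤ 1 + B ^ a) : T * (1 + B ^ b / d) ≤ 1 + B ^ (2 * a) := by
  have h1 : B ^ b ≤ B ^ a := Nat.pow_le_pow_right (by omega) hab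
  have h2 : B ^ b / d ≤ B ^ a / 2 :=
    (Nat.div_le_div_right h1).trans (Nat.div_le_div_left hd (by omega))
  have h3 : 2 * (B ^ a / 2) ≤ B ^ a := Nat.mul_div_le _ _
  have h4 : 8 ≤ B ^ a := (show 8 ≤ B by omega).trans (Nat.le_self_pow (by omega) B)
  rw [two_mul a, pow_add]
  set u := B ^ a
  calc T * (1 + B ^ b / d) ≤ (1 + u) * (1 + u / 2) := Nat.mul_le_mul hT (by omega)
    _ ≤ 1 + u * u := by nlinarith

theorem card_support_eq_of_pow_eq_pow {k : Type*} [Field k] {d : ℕ} (hd : d ≠ 0) {p q : k[X]}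
    (h : p ^ d = q ^ d) : p.support.card = q.support.card := by
  have hpq : Associated p q := associated_of_dvd_dvd
    ((IsIntegrallyClosed.pow_dvd_pow_iff hd).1 h.dvd)
    ((IsIntegrallyClosed.pow_dvd_pow_iff hd).1 h.symm.dvd)
  obtain ⟨u, rfl⟩ := hpq
  obtain ⟨c, hc, hu⟩ := Polynomial.isUnit_iff.1 u.isUnit
  rw [← hu]
  congr 1
  ext i
  simp [hc.ne_zero]

/-- The number of terms of `p(x, x ^ N)` in terms of the degree in `y` and the number of powers of
`x` that occur. -/
theorem card_support_eval_X_pow_le {R : Type*} [CommRing R] {N : ℕ} (p : R[X][X]) :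
    (p.eval (X ^ N)).support.card ≤
      (Bivariate.swap p).support.card * (p.natDegree + 1) := by
  classical
  have hsub : (p.eval (X ^ N)).support ⊆
      ((Bivariate.swap p).support ×ˢ Finset.range (p.natDegree + 1)).image
        (fun x => N * x.2 + x.1) := by
    intro e he
    rw [mem_support_iff, eval_eq_sum_range, finsetSum_coeff] at he
    obtain ⟨j, hj, hne⟩ := Finset.exists_ne_zero_of_sum_ne_zero he
    rw [← pow_mul, coeff_mul_X_pow'] at hne
    split_ifs at hne with hle
    · refine Finset.mem_image.2 ⟨(e - N * j, j), Finset.mem_product.2 ⟨?_, hj⟩, by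
        simp only; omega⟩
      rw [mem_support_iff]
      intro h0
      rw [← Bivariate.coeff_coeff_swap, h0, coeff_zero] at hne
      exact hne rfl
    · exact absurd rfl hne
  refine (Finset.card_le_card hsub).trans (Finset.card_image_le.trans ?_)
  rw [Finset.card_product, Finset.card_range]

theorem exists_support_map_eval_eq {k : Type*} [Field k] [Infinite k] (p : k[X][X]) :
    ∃ η : k, (p.map (evalRingHom η)).support = p.support := by
  have hne : ∏ r ∈ p.support, p.coeff r ≠ 0 :=
    Finset.prod_ne_zero_iff.2 fun r hr => mem_support_iff.1 hr
  obtain ⟨η, hη⟩ := exists_eval_ne_zero_of_natDegree_lt_card _ hne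
    (Cardinal.natCast_lt_aleph0.trans_le (Cardinal.aleph0_le_mk k))
  rw [eval_prod, Finset.prod_ne_zero_iff] at hη
  refine ⟨η, Finset.Subset.antisymm (support_map_subset _ _) fun r hr => ?_⟩
  rw [mem_support_iff, coeff_map]
  exact hη r hr

/-- Approximation of the exponents of `F`, normalised so that the remainders `m` are nonnegative
and the extreme exponents have the same remainder. -/
theorem exists_exponent_approximation {d : ℕ} (hd : 0 < d) {F : ℂ[X]} (h0 : F.coeff 0 ≠ 0)
    (hn : 0 < F.natDegree) :
    ∃ (q s : ℕ) (p m : ℕ → ℕ), 0 < q ∧ q ≤ (4 * d) ^ (F.support.card - 2) ∧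
      (∀ e ∈ F.support, q * e + s = p e * F.natDegree + m e) ∧
      (∀ e ∈ F.support, p e ≤ q) ∧ (∀ e ∈ F.support, 2 * d * m e < F.natDegree) ∧
      p 0 = 0 ∧ m 0 = m F.natDegree ∧ ∃ e ∈ F.support, m e = 0 := by
  classical
  set n := F.natDegree with hndef
  have hF : F ≠ 0 := by rintro rfl; simp at h0
  have h0mem : 0 ∈ F.support := mem_support_iff.2 h0
  have hnmem : n ∈ F.support := natDegree_mem_support_of_nonzero hF
  have hcard : ((F.support.erase 0).erase n).card = F.support.card - 2 := by
    rw [Finset.card_erase_of_mem (Finset.mem_erase.2 ⟨hn.ne', hnmem⟩),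
      Finset.card_erase_of_mem h0mem]
    omega
  obtain ⟨q, hq, hqle, happrox⟩ := exists_simultaneous_approximation hn
    (show 0 < 4 * d by omega) ((F.support.erase 0).erase n)
  rw [hcard] at hqle
  have hall : ∀ e ∈ F.support, ∃ (p : ℕ) (r : ℤ), (q * e : ℤ) = p * n + r ∧
      4 * d * |r| < n ∧ p ≤ q ∧ (e = 0 ∨ e = n → r = 0) := by
    intro e he
    by_cases he0 : e = 0
    · exact ⟨0, 0, by simp [he0], by simpa using hn, by omega, fun _ => rfl⟩
    by_cases hen : e = n
    · exact ⟨q, 0, by simp [hen], by simpa using hn, le_rfl, fun _ => rfl⟩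
    obtain ⟨p, r, h1, h2⟩ := happrox e
      (Finset.mem_erase.2 ⟨hen, Finset.mem_erase.2 ⟨he0, he⟩⟩)
    push_cast at h2
    have hd' : (1 : ℤ) ≤ 4 * d := by omega
    have hr : |r| < n := lt_of_le_of_lt (le_mul_of_one_le_left (abs_nonneg r) hd') h2
    rw [abs_lt] at hr
    have hle : (e : ℤ) ≤ n := by exact_mod_cast le_natDegree_of_mem_supp e he
    have hp0 : 0 ≤ p := by
      by_contra! hneg
      nlinarith [mul_nonneg (Int.natCast_nonneg q) (Int.natCast_nonneg e)]
    lift p to ℕ using hp0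
    refine ⟨p, r, h1, h2, ?_, fun h => absurd h (by tauto)⟩
    by_contra! hlt
    have hlt' : (q : ℤ) + 1 ≤ p := by exact_mod_cast hlt
    nlinarith [mul_le_mul_of_nonneg_left hle (Int.natCast_nonneg q)]
  choose! p r h1 h2 h3 h4 using hall
  obtain ⟨e₀, he₀, hmin⟩ := Finset.exists_min_image F.support r ⟨0, h0mem⟩
  have hr0 : r 0 = 0 := h4 0 h0mem (Or.inl rfl)
  have hrn : r n = 0 := h4 n hnmem (Or.inr rfl)
  have he₀le : r e₀ ≤ 0 := hr0 ▸ hmin 0 h0mem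
  have hm : ∀ e ∈ F.support, ((r e - r e₀).toNat : ℤ) = r e - r e₀ := fun e he =>
    Int.toNat_of_nonneg (by linarith [hmin e he])
  have hs : ((-r e₀).toNat : ℤ) = -r e₀ := Int.toNat_of_nonneg (by omega)
  refine ⟨q, (-r e₀).toNat, p, fun e => (r e - r e₀).toNat, hq, hqle, fun e he => ?_, h3,
    fun e he => ?_, ?_, by simp only [hr0, hrn], e₀, he₀, by simp⟩
  · zify
    rw [hs, hm e he, h1 e he]
    ring
  · zify
    rw [hm e he]
    have ha := h2 e he
    have hb := h2 e₀ he₀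
    have hd' : (0 : ℤ) ≤ d := by omega
    nlinarith [mul_le_mul_of_nonneg_left (le_abs_self (r e)) hd',
      mul_le_mul_of_nonneg_left (neg_abs_le (r e₀)) hd']
  · have := h1 0 h0mem
    rw [hr0] at this
    have h' : p 0 * n = 0 := by
      zify
      simpa using this.symm
    exact (Nat.mul_eq_zero.1 h').resolve_right hn.ne'

theorem card_support_le_of_forall_card_support_le {d ℓ T : ℕ} (hd : d ≠ 0) (hℓ : 1 ≤ ℓ)
    (ih : ∀ g : ℂ[X], g ≠ 0 → (g ^ d).support.card ≤ ℓ → g.support.card ≤ T)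
    {g : ℂ[X]} (hg : g ≠ 0) (h : (g ^ d).support.card ≤ ℓ + 1) :
    g.support.card ≤ T * (1 + (4 * d) ^ (ℓ - 1) / d) := by
  classical
  wlog hg0 : g.coeff 0 ≠ 0 generalizing g
  · obtain ⟨s, q, rfl, hq⟩ := exists_eq_X_pow_mul hg
    rw [card_support_X_pow_mul]
    rw [mul_pow, ← pow_mul, card_support_X_pow_mul] at h
    exact this (right_ne_zero_of_mul hg) h hq
  set F := g ^ d with hF
  have hF0 : F.coeff 0 ≠ 0 := by
    rw [hF, coeff_zero_eq_eval_zero, eval_pow, ← coeff_zero_eq_eval_zero]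
    exact pow_ne_zero d hg0
  rcases Nat.eq_zero_or_pos F.natDegree with hn | hn
  · refine (ih g hg ?_).trans (Nat.le_mul_of_pos_right T (Nat.add_pos_left one_pos _))
    change F.support.card ≤ ℓ
    have := card_supp_le_succ_natDegree F
    omega
  obtain ⟨q, s, p, m, hq, hqle, hpm, hpq, hmd, hp0, hm0, e₀, he₀, hme₀⟩ :=
    exists_exponent_approximation (Nat.pos_of_ne_zero hd) hF0 hn
  set n := F.natDegree with hndef
  have h0mem : 0 ∈ F.support := mem_support_iff.2 hF0
  have hnmem : n ∈ F.support :=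
    natDegree_mem_support_of_nonzero (by rw [hF]; exact pow_ne_zero d hg)
  set Φ : ℂ[X][X] := ∑ e ∈ F.support, monomial (p e) (monomial (d * m e) (F.coeff e)) with hΦ
  -- coefficients of the bivariate lift
  have hcoeff : ∀ e ∈ F.support, (Φ.coeff (p e)).coeff (d * m e) = F.coeff e := by
    intro e he
    rw [hΦ, finsetSum_coeff, finsetSum_coeff, Finset.sum_eq_single e]
    · simp
    · intro e' he' hne
      rw [coeff_monomial]
      split_ifs with hp
      · rw [coeff_monomial, if_neg]
        intro hm
        have hm' : m e' = m e := Nat.eq_of_mul_eq_mul_left (Nat.pos_of_ne_zero hd) hm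
        have h1 := hpm e he
        have h2 := hpm e' he'
        rw [hp, hm'] at h2
        exact hne (Nat.eq_of_mul_eq_mul_left hq (by omega))
      · simp
    · exact fun h => absurd he h
  have hdegx : ∀ j, (Φ.coeff j).natDegree ≤ d * ((n - 1) / (2 * d)) := by
    intro j
    rw [hΦ, finsetSum_coeff]
    refine natDegree_sum_le_of_forall_le _ _ fun e he => ?_
    rw [coeff_monomial]
    split_ifs
    · refine (natDegree_monomial_le _).trans (Nat.mul_le_mul_left d ?_)
      rw [Nat.le_div_iff_mul_le (by omega), mul_comm]
      have := hmd e he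
      omega
    · simp
  have hN : 2 * d * (d * ((n - 1) / (2 * d))) < d * n := by
    have h1 : 2 * d * ((n - 1) / (2 * d)) < n := by
      have := Nat.mul_div_le (n - 1) (2 * d)
      omega
    calc 2 * d * (d * ((n - 1) / (2 * d))) = d * (2 * d * ((n - 1) / (2 * d))) := by ring
      _ < d * n := Nat.mul_lt_mul_of_pos_left h1 (Nat.pos_of_ne_zero hd)
  have hX : ¬ C X ∣ Φ := by
    intro hdvd
    have := X_dvd_iff.1 ((C_dvd_iff_dvd_coeff _ _).1 hdvd (p e₀))
    have h' := hcoeff e₀ he₀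
    rw [hme₀, mul_zero, this] at h'
    exact mem_support_iff.1 he₀ h'.symm
  have hY : ¬ X ∣ Φ := by
    intro hdvd
    have h' := hcoeff 0 h0mem
    rw [hp0, X_dvd_iff.1 hdvd, coeff_zero] at h'
    exact hF0 h'.symm
  have heval : Φ.eval (X ^ (d * n)) = (X ^ s * expand ℂ (d * q) g) ^ d := by
    have hexp : expand ℂ (d * q) F = ∑ e ∈ F.support, C (F.coeff e) * X ^ (d * q * e) := by
      conv_lhs => rw [F.as_sum_support_C_mul_X_pow]
      simp [map_sum, pow_mul]
    rw [mul_pow, ← map_pow, ← hF, hexp, hΦ, eval_finsetSum, Finset.mul_sum]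
    refine Finset.sum_congr rfl fun e he => ?_
    rw [eval_monomial, ← C_mul_X_pow_eq_monomial, ← pow_mul, ← pow_mul, mul_assoc, ← pow_add,
      mul_left_comm, ← pow_add]
    congr 2
    linear_combination d * (hpm e he).symm
  obtain ⟨G, hG⟩ := exists_eq_pow_of_eval_X_pow_eq_pow hd hN hdegx hX hY heval
  have hcard : (G.eval (X ^ (d * n))).support.card = g.support.card := by
    rw [hG, eval_pow] at heval
    rw [card_support_eq_of_pow_eq_pow hd heval, card_support_X_pow_mul,
      card_support_expand (Nat.mul_pos (Nat.pos_of_ne_zero hd) hq)]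
  have hdegy : G.natDegree ≤ (4 * d) ^ (ℓ - 1) / d := by
    rw [Nat.le_div_iff_mul_le (Nat.pos_of_ne_zero hd), mul_comm, ← natDegree_pow, ← hG]
    refine le_trans ?_ (hqle.trans (Nat.pow_le_pow_right (by omega) (by omega)))
    refine natDegree_sum_le_of_forall_le _ _ fun e he => ?_
    exact (natDegree_monomial_le _).trans (hpq e he)
  have hT : (Bivariate.swap G).support.card ≤ T := by
    obtain ⟨η, hη⟩ := exists_support_map_eval_eq (Bivariate.swap G)
    rw [← hη]
    refine ih _ ?_ ?_
    · rw [← support_nonempty, hη, support_nonempty]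
      refine (map_ne_zero_iff _ Bivariate.swap.injective).2 ?_
      rintro rfl
      rw [hG, zero_pow hd] at hY
      simp at hY
    · have hsub : ((Bivariate.swap G).map (evalRingHom η) ^ d).support ⊆
          (F.support.erase 0).image fun e => d * m e := by
        rw [← Polynomial.map_pow, ← map_pow, ← hG, hΦ, map_sum]
        refine (support_map_subset _ _).trans fun i hi => ?_
        rw [mem_support_iff, finsetSum_coeff] at hi
        obtain ⟨e, he, hne⟩ := Finset.exists_ne_zero_of_sum_ne_zero hi
        rw [Bivariate.swap_monomial_monomial, coeff_monomial] at hne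
        split_ifs at hne with hi
        · rw [Finset.mem_image]
          by_cases he0 : e = 0
          · refine ⟨n, Finset.mem_erase.2 ⟨hn.ne', hnmem⟩, ?_⟩
            rw [← hi, he0, hm0]
          · exact ⟨e, Finset.mem_erase.2 ⟨he0, he⟩, hi⟩
        · exact absurd rfl hne
      refine (Finset.card_le_card hsub).trans (Finset.card_image_le.trans ?_)
      rw [Finset.card_erase_of_mem h0mem]
      omega
  rw [← hcard]
  refine (card_support_eval_X_pow_le G).trans (Nat.mul_le_mul hT ?_)
  omega

/-- Schinzel's theorem (settling the Rényi–Erdős conjecture): if `g ∈ ℂ[x]` is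
nonzero and its `d`-th power has at most `ℓ` terms, then `g` has at most
`1 + (4d)^(2^(ℓ-d-1)·d)` terms. -/
theorem schinzel_power_terms (d ℓ : ℕ) (hd : 2 ≤ d) (hℓ : d + 1 ≤ ℓ)
    (g : Polynomial ℂ) (hg : g ≠ 0) (h : (g ^ d).support.card ≤ ℓ) :
    g.support.card ≤ 1 + (4 * d) ^ (2 ^ (ℓ - d - 1) * d) := by
  obtain ⟨m, rfl⟩ := Nat.exists_eq_add_of_le hℓ
  rw [show d + 1 + m - d - 1 = m by omega]
  induction m generalizing g with
  | zero =>
    refine (card_support_le_of_forall_card_support_le (by omega) (by omega)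
      (fun _ => card_support_le_one_of_card_support_pow_le) hg h).trans ?_
    rw [one_mul, pow_zero, one_mul]
    exact Nat.add_le_add_left ((Nat.div_le_self _ _).trans
      (Nat.pow_le_pow_right (by omega) (by omega))) 1
  | succ m ih =>
    refine (card_support_le_of_forall_card_support_le (ℓ := d + 1 + m) (by omega) (by omega)
      (fun g hg h => ih g hg (by omega) h) hg h).trans ?_
    have hb : d + 1 + m - 1 ≤ 2 ^ m * d := by
      have := Nat.mul_le_mul_right d (Nat.lt_two_pow_self (n := m))
      have := Nat.le_mul_of_pos_right m (show 0 < d by omega)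
      rw [Nat.succ_mul] at *
      omega
    rw [show 2 ^ (m + 1) * d = 2 * (2 ^ m * d) by ring]
    exact mul_one_add_pow_div_le hd le_rfl hb (Nat.mul_pos (by positivity) (by omega)) le_rfl
end

section
/- Let ℓ be a positive integer and let f, g ∈ ℂ[x] be polynomials with f non-constant. If the composition f(g(x)) has at most ℓ nonzero coefficients, i.e. N(f ∘ g) ≤ ℓ, then N(g) ≤ (4ℓ)^{(2ℓ)^{(3ℓ)^{ℓ+1}}}. -/
open Polynomial

/-- The Euler derivation `X * d/dX` on power series. -/
noncomputable def eulerOp : Derivation ℂ (PowerSeries ℂ) (PowerSeries ℂ) :=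
  (PowerSeries.X : PowerSeries ℂ) • PowerSeries.derivative ℂ

lemma eulerOp_apply (f : PowerSeries ℂ) :
    eulerOp f = PowerSeries.X * PowerSeries.derivative ℂ f := rfl

lemma coeff_eulerOp (f : PowerSeries ℂ) (n : ℕ) :
    PowerSeries.coeff n (eulerOp f) = n * PowerSeries.coeff n f := by
  rw [eulerOp_apply]
  cases n with
  | zero => simp
  | succ n =>
    rw [PowerSeries.coeff_succ_X_mul, PowerSeries.coeff_derivative]
    push_cast
    ring

lemma coeff_eulerOp_iterate (f : PowerSeries ℂ) (i n : ℕ) :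
    PowerSeries.coeff n (eulerOp^[i] f) = (n : ℂ) ^ i * PowerSeries.coeff n f := by
  induction i with
  | zero => simp
  | succ i ih => rw [Function.iterate_succ_apply', coeff_eulerOp, ih]; ring

lemma eulerOp_coe (p : ℂ[X]) :
    eulerOp (p : PowerSeries ℂ) = ((X * derivative p : ℂ[X]) : PowerSeries ℂ) := by
  rw [eulerOp_apply, PowerSeries.derivative_coe]
  simp

lemma natDegree_X_mul_derivative_le (p : ℂ[X]) : (X * derivative p).natDegree ≤ p.natDegree := by
  refine natDegree_le_iff_coeff_eq_zero.2 fun N hN => ?_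
  cases N with
  | zero => simp
  | succ N => rw [coeff_X_mul, coeff_derivative, coeff_eq_zero_of_natDegree_lt hN, zero_mul]

lemma X_pow_dvd_eulerOp_iterate {f : PowerSeries ℂ} {T : ℕ} (h : PowerSeries.X ^ T ∣ f) (i : ℕ) :
    PowerSeries.X ^ T ∣ eulerOp^[i] f := by
  rw [PowerSeries.X_pow_dvd_iff] at h ⊢
  intro m hm
  rw [coeff_eulerOp_iterate, h m hm, mul_zero]

/-- A nonzero power series killed by a differential operator has an exponent of the operator as
its order. -/
lemma indicial_eval_eq_zero {r s : ℕ} (P : Fin (r + 1) → PowerSeries ℂ)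
    (hs : ∀ i, ∀ m < s, PowerSeries.coeff m (P i) = 0) (y : PowerSeries ℂ)
    (h : ∑ i, P i * eulerOp^[i] y = 0) (o : ℕ) (ho : ∀ m < o, PowerSeries.coeff m y = 0) :
    (∑ i, PowerSeries.coeff s (P i) * (o : ℂ) ^ (i : ℕ)) * PowerSeries.coeff o y = 0 := by
  have h1 := congrArg (PowerSeries.coeff (s + o)) h
  rw [map_sum, map_zero] at h1
  rw [← h1, Finset.sum_mul]
  refine Finset.sum_congr rfl fun i _ => ?_
  rw [PowerSeries.coeff_mul, Finset.sum_eq_single (s, o)]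
  · rw [coeff_eulerOp_iterate]; ring
  · rintro ⟨a, b⟩ hab hne
    rw [Finset.HasAntidiagonal.mem_antidiagonal] at hab
    simp only at hab ⊢
    rcases lt_trichotomy a s with ha | ha | ha
    · rw [hs i a ha, zero_mul]
    · exact absurd (by ext <;> simp <;> omega) hne
    · rw [coeff_eulerOp_iterate, ho b (by omega)]; simp
  · intro h; simp at h

/-- A linear differential operator of order at most `r` has a solution space of dimension at most
`r`. -/
lemma not_linearIndependent_of_eulerOp {r : ℕ} (P : Fin (r + 1) → PowerSeries ℂ) (hP : P ≠ 0)
    (y : Fin (r + 1) → PowerSeries ℂ) (h : ∀ j, ∑ i, P i * eulerOp^[i] (y j) = 0) :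
    ¬ LinearIndependent ℂ y := by
  classical
  intro hli
  have hex : ∃ s, ∃ i, PowerSeries.coeff s (P i) ≠ 0 := by
    by_contra! hcon
    exact hP (funext fun i => PowerSeries.ext fun s => by simpa using hcon s i)
  let s := Nat.find hex
  obtain ⟨i₀, hi₀⟩ := Nat.find_spec hex
  have hs : ∀ i, ∀ m < s, PowerSeries.coeff m (P i) = 0 := by
    intro i m hm
    by_contra hne
    exact Nat.find_min hex hm ⟨i, hne⟩
  let I : ℂ[X] := ∑ i : Fin (r + 1), C (PowerSeries.coeff s (P i)) * X ^ (i : ℕ)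
  have hIc : ∀ i : Fin (r + 1), I.coeff i = PowerSeries.coeff s (P i) := by
    intro i
    simp only [I, finsetSum_coeff, coeff_C_mul, coeff_X_pow]
    rw [Finset.sum_eq_single i]
    · simp
    · intro j _ hj
      rw [if_neg (fun h => hj (Fin.ext h.symm)), mul_zero]
    · simp
  have hI : I ≠ 0 := by
    intro h0
    apply hi₀
    have := hIc i₀
    rw [h0] at this
    simpa using this.symm
  have hdeg : I.natDegree ≤ r := by
    refine natDegree_sum_le_of_forall_le _ _ fun i _ => ?_
    refine (natDegree_C_mul_X_pow_le _ _).trans (by omega)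
  let R : Finset ℂ := I.roots.toFinset
  have hR : R.card ≤ r :=
    (Multiset.toFinset_card_le _).trans ((card_roots' I).trans hdeg)
  let R' : Finset ℕ := R.preimage (Nat.cast : ℕ → ℂ) (Nat.cast_injective.injOn)
  have hR' : R'.card ≤ r := by
    refine le_trans ?_ hR
    exact Finset.card_le_card_of_injOn (fun n : ℕ => (n : ℂ))
      (fun n hn => by simpa [R'] using hn) Nat.cast_injective.injOn
  let V := Submodule.span ℂ (Set.range y)
  have hV : ∀ v ∈ V, ∑ i, P i * eulerOp^[i] v = 0 := by
    intro v hv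
    induction hv using Submodule.span_induction with
    | mem x hx => obtain ⟨j, rfl⟩ := hx; exact h j
    | zero => simp [iterate_map_zero]
    | add a b _ _ ha hb =>
      simp only [iterate_map_add, mul_add, Finset.sum_add_distrib, ha, hb, add_zero]
    | smul c a _ ha =>
      have : ∀ i : ℕ, eulerOp^[i] (c • a) = c • eulerOp^[i] a := by
        intro i
        induction i with
        | zero => rfl
        | succ i ih => rw [Function.iterate_succ_apply', ih, Function.iterate_succ_apply',
            Derivation.map_smul]
      simp only [this, mul_smul_comm, ← Finset.smul_sum, ha, smul_zero]
  let φ : PowerSeries ℂ →ₗ[ℂ] (R' → ℂ) := LinearMap.pi fun o => PowerSeries.coeff (o : ℕ)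
  have hφ : Function.Injective (φ ∘ₗ V.subtype) := by
    rw [← LinearMap.ker_eq_bot, LinearMap.ker_eq_bot']
    rintro ⟨v, hv⟩ hv0
    by_contra hne
    have hv1 : v ≠ 0 := fun h => hne (by ext1; exact h)
    have hex2 : ∃ o, PowerSeries.coeff o v ≠ 0 := by
      by_contra! hcon
      exact hv1 (PowerSeries.ext fun s => by simpa using hcon s)
    let o := Nat.find hex2
    have ho : PowerSeries.coeff o v ≠ 0 := Nat.find_spec hex2
    have key := indicial_eval_eq_zero P hs v (hV v hv) o
      (fun m hm => by_contra fun hne => Nat.find_min hex2 hm hne)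
    have hroot : I.eval (o : ℂ) = 0 := by
      rcases mul_eq_zero.1 key with h | h
      · simpa [I, eval_finsetSum] using h
      · exact absurd h ho
    have hoR : o ∈ R' := by
      simp only [R', R, Finset.mem_preimage, Multiset.mem_toFinset]
      exact (mem_roots hI).2 hroot
    exact ho (congrFun hv0 ⟨o, hoR⟩)
  have hfr := LinearMap.finrank_le_finrank_of_injective hφ
  rw [finrank_span_eq_card hli] at hfr
  simp at hfr
  omega

/-- If `δ * ϑ u = A * u`, then `δ ^ i * ϑ ^ i u` is a polynomial multiple of `u`. -/
lemma exists_poly_mul_eq_eulerOp_iterate (δ A : ℂ[X]) (E : ℕ) (hδ : δ.natDegree ≤ E)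
    (hA : A.natDegree ≤ E) (u : PowerSeries ℂ) (hu : (δ : PowerSeries ℂ) * eulerOp u = A * u)
    (i : ℕ) : ∃ Q : ℂ[X], Q.natDegree ≤ i * E ∧
      (δ : PowerSeries ℂ) ^ i * eulerOp^[i] u = Q * u := by
  induction i with
  | zero => exact ⟨1, by simp, by simp⟩
  | succ i ih =>
    obtain ⟨Q, hQ, h⟩ := ih
    refine ⟨A * Q + δ * (X * derivative Q) - C (i : ℂ) * (X * derivative δ) * Q, ?_, ?_⟩
    · have h1 := natDegree_X_mul_derivative_le Q
      have h2 := natDegree_X_mul_derivative_le δ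
      have e : (i + 1) * E = E + i * E := by ring
      rw [e]
      refine (natDegree_sub_le_of_le (m := E + i * E) ?_ ?_).trans (max_self _).le
      · refine natDegree_add_le_of_degree_le ?_ ?_
        · exact natDegree_mul_le_of_le hA hQ
        · exact natDegree_mul_le_of_le hδ (h1.trans hQ)
      · refine natDegree_mul_le_of_le ?_ hQ
        exact (natDegree_C_mul_le _ _).trans (h2.trans hδ)
    · have h3 := congrArg (fun f => (δ : PowerSeries ℂ) * eulerOp f) h
      simp only [Derivation.leibniz, smul_eq_mul, Derivation.leibniz_pow, nsmul_eq_mul,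
        eulerOp_coe] at h3
      rw [Function.iterate_succ_apply']
      have h4 : (i : PowerSeries ℂ) * δ ^ (i - 1) * δ = i * δ ^ i := by
        cases i with
        | zero => simp
        | succ i => rw [Nat.add_sub_cancel, pow_succ]; ring
      push_cast at h3 ⊢
      simp only [map_natCast] at h3 ⊢
      have : (δ : PowerSeries ℂ) ^ (i + 1) * eulerOp (eulerOp^[i] u)
        = δ * ((δ : PowerSeries ℂ) ^ i * eulerOp (eulerOp^[i] u)) := by ring
      rw [this]
      linear_combination h3 + (Q : PowerSeries ℂ) * hu
        - ((PowerSeries.X : PowerSeries ℂ) * ↑(derivative δ)) * (i : PowerSeries ℂ) * h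
        - eulerOp^[i] u * ((PowerSeries.X : PowerSeries ℂ) * ↑(derivative δ)) * h4

lemma X_pow_dvd_coe_iff {T : ℕ} {p : ℂ[X]} :
    (PowerSeries.X : PowerSeries ℂ) ^ T ∣ p ↔ (X : ℂ[X]) ^ T ∣ p := by
  rw [PowerSeries.X_pow_dvd_iff, Polynomial.X_pow_dvd_iff]
  simp

lemma natDegree_det_le_of_row {m : ℕ} (M : Matrix (Fin m) (Fin m) ℂ[X]) (j₀ : Fin m) (n : ℕ)
    (e : Fin m → ℕ) (h₀ : ∀ i, (M i j₀).natDegree ≤ n + e i)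
    (h : ∀ i j, j ≠ j₀ → (M i j).natDegree ≤ e i) :
    M.det.natDegree ≤ n + ∑ i, e i := by
  classical
  rw [Matrix.det_apply]
  refine natDegree_sum_le_of_forall_le _ _ fun σ _ => ?_
  refine (natDegree_smul_le _ _).trans ?_
  refine (natDegree_prod_le _ _).trans ?_
  have hle : ∀ i, (M (σ i) i).natDegree ≤ (if i = j₀ then n else 0) + e (σ i) := by
    intro i
    split_ifs with hi
    · rw [hi]; exact h₀ _
    · rw [zero_add]; exact h _ _ hi
  refine (Finset.sum_le_sum fun i _ => hle i).trans ?_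
  rw [Finset.sum_add_distrib, Equiv.sum_comp σ e]
  simp

/-- Zero estimate: a polynomial `q` of degree at most `n` that agrees to high order with a
combination of the independent series `u j`, all solutions of first order equations, is itself a
combination of them. -/
theorem coe_mem_span_of_X_pow_dvd_aux {r : ℕ} (δ : ℂ[X]) (hδ0 : δ ≠ 0) (E : ℕ)
    (hδ : δ.natDegree ≤ E) (u : Fin r → PowerSeries ℂ) (A : Fin r → ℂ[X])
    (hA : ∀ j, (A j).natDegree ≤ E) (hu : ∀ j, (δ : PowerSeries ℂ) * eulerOp (u j) = A j * u j)
    (hli : LinearIndependent ℂ u) (q : ℂ[X]) (n : ℕ) (hq : q.natDegree ≤ n) (T : ℕ)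
    (hT : n + r * (r + 1) * E < T) (c : Fin r → ℂ)
    (hG : PowerSeries.X ^ T ∣ (q : PowerSeries ℂ) - ∑ j, c j • u j) :
    (q : PowerSeries ℂ) ∈ Submodule.span ℂ (Set.range u) := by
  classical
  have hδ' : (δ : PowerSeries ℂ) ≠ 0 := by simpa using hδ0
  choose Q hQdeg hQ using fun (i : ℕ) (j : Fin r) =>
    exists_poly_mul_eq_eulerOp_iterate δ (A j) E hδ (hA j) (u j) (hu j) i
  have hpe : ∀ i : ℕ, ∃ qi : ℂ[X], qi.natDegree ≤ n ∧
      (qi : PowerSeries ℂ) = eulerOp^[i] (q : PowerSeries ℂ) := by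
    intro i
    induction i with
    | zero => exact ⟨q, hq, rfl⟩
    | succ i ih =>
      obtain ⟨qi, h1, h2⟩ := ih
      refine ⟨X * derivative qi, (natDegree_X_mul_derivative_le _).trans h1, ?_⟩
      rw [Function.iterate_succ_apply', ← h2, eulerOp_coe]
  choose qi hqideg hqi using hpe
  let M : Matrix (Fin (r + 1)) (Fin (r + 1)) ℂ[X] := fun i j =>
    Fin.cases (δ ^ (i : ℕ) * qi i) (fun j => Q i j) j
  have hMdeg : M.det.natDegree ≤ n + r * (r + 1) * E := by
    refine (natDegree_det_le_of_row M 0 n (fun i => i * E) ?_ ?_).trans ?_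
    · intro i
      simp only [M, Fin.cases_zero]
      rw [add_comm n]
      exact natDegree_mul_le_of_le (natDegree_pow_le_of_le _ hδ) (hqideg _)
    · intro i j hj
      obtain ⟨j, rfl⟩ := Fin.exists_succ_eq.2 hj
      simpa [M] using hQdeg i j
    · gcongr
      refine (Finset.sum_le_card_nsmul _ _ (r * E) fun i _ => ?_).trans ?_
      · exact Nat.mul_le_mul_right _ (by omega)
      · simp; nlinarith
  let σ : PowerSeries ℂ := (q : PowerSeries ℂ) - ∑ j, c j • u j
  have hσ : ∀ i : ℕ, eulerOp^[i] σ = eulerOp^[i] (q : PowerSeries ℂ)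
      - ∑ j, c j • eulerOp^[i] (u j) := by
    intro i
    induction i with
    | zero => rfl
    | succ i ih =>
      simp only [Function.iterate_succ_apply']
      rw [ih]
      simp
  have hdet : M.det = 0 := by
    have hdvd : (X : ℂ[X]) ^ T ∣ M.det := by
      rw [← X_pow_dvd_coe_iff]
      let N : Matrix (Fin (r + 1)) (Fin (r + 1)) (PowerSeries ℂ) :=
        M.map Polynomial.coeToPowerSeries.ringHom
      have hN : ((M.det : ℂ[X]) : PowerSeries ℂ) = N.det := by
        have := RingHom.map_det Polynomial.coeToPowerSeries.ringHom M
        simpa using this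
      let c' : Fin (r + 1) → PowerSeries ℂ := fun j =>
        Fin.cases 1 (fun j => - (c j • u j)) j
      have hcol : (N.updateCol 0 (fun k => ∑ i, c' i • N k i)).det = N.det := by
        rw [Matrix.det_updateCol_sum]
        simp [c']
      rw [hN, ← hcol, Matrix.det_succ_column_zero]
      refine Finset.dvd_sum fun k _ => Dvd.dvd.mul_right (Dvd.dvd.mul_left ?_ _) _
      have hk : ∑ i, c' i • N k i = (δ : PowerSeries ℂ) ^ (k : ℕ) * eulerOp^[k] σ := by
        have h0 : N k 0 = (δ : PowerSeries ℂ) ^ (k : ℕ) * eulerOp^[k] (q : PowerSeries ℂ) := by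
          change Polynomial.coeToPowerSeries.ringHom (δ ^ (k : ℕ) * qi k) = _
          simp [hqi]
        have h1 : ∀ j : Fin r, N k j.succ = (Q k j : PowerSeries ℂ) := fun j => rfl
        have h2 : ∀ j : Fin r, c' j.succ • N k j.succ
            = - ((δ : PowerSeries ℂ) ^ (k : ℕ) * (c j • eulerOp^[k] (u j))) := fun j => by
          rw [h1, mul_smul_comm, hQ]
          simp only [c', Fin.cases_succ, smul_eq_mul, neg_mul, smul_mul_assoc]
          rw [mul_comm]
        have h3 : c' 0 = 1 := rfl
        rw [Fin.sum_univ_succ, hσ, mul_sub, Finset.mul_sum, h0, h3, one_smul,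
          Finset.sum_congr rfl fun j _ => h2 j, Finset.sum_neg_distrib, sub_eq_add_neg]
      rw [Matrix.updateCol_self, hk]
      exact Dvd.dvd.mul_left (X_pow_dvd_eulerOp_iterate hG _) _
    by_contra hne
    have := natDegree_le_of_dvd hdvd hne
    rw [natDegree_X_pow] at this
    omega
  obtain ⟨v, hv, hvM⟩ := Matrix.exists_vecMul_eq_zero_iff.2 hdet
  have hv' : ∀ j, ∑ i, v i * M i j = 0 := fun j => congrFun hvM j
  have hdep := not_linearIndependent_of_eulerOp
    (P := fun i => (v i : PowerSeries ℂ) * (δ : PowerSeries ℂ) ^ (i : ℕ)) (by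
      intro h0
      apply hv
      funext i
      have := congrFun h0 i
      simpa [hδ'] using this) (Fin.cons (q : PowerSeries ℂ) u) (by
      intro j
      refine Fin.cases ?_ (fun j => ?_) j
      · have := congrArg Polynomial.coeToPowerSeries.ringHom (hv' 0)
        simpa [M, hqi, mul_assoc] using this
      · have := congrArg Polynomial.coeToPowerSeries.ringHom (hv' j.succ)
        simp only [M, Fin.cases_succ, map_sum, map_mul, map_zero,
          coeToPowerSeries.ringHom_apply] at this
        simp only [Fin.cons_succ, mul_assoc, hQ]
        simp only [← mul_assoc, ← Finset.sum_mul, this, zero_mul])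
  by_contra hnot
  exact hdep (linearIndependent_finCons.2 ⟨hli, hnot⟩)

theorem coe_mem_span_of_X_pow_dvd {ι : Type*} [Fintype ι] (δ : ℂ[X]) (hδ0 : δ ≠ 0) (E : ℕ)
    (hδ : δ.natDegree ≤ E) (u : ι → PowerSeries ℂ)
    (hu : ∀ j, ∃ A : ℂ[X], A.natDegree ≤ E ∧ (δ : PowerSeries ℂ) * eulerOp (u j) = A * u j)
    (q : ℂ[X]) (n : ℕ) (hq : q.natDegree ≤ n) (T : ℕ)
    (hT : n + Fintype.card ι * (Fintype.card ι + 1) * E < T) (G : PowerSeries ℂ)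
    (hGu : G ∈ Submodule.span ℂ (Set.range u))
    (hG : PowerSeries.X ^ T ∣ (q : PowerSeries ℂ) - G) :
    (q : PowerSeries ℂ) ∈ Submodule.span ℂ (Set.range u) := by
  classical
  obtain ⟨b, hb, hspan, hli⟩ := exists_linearIndependent ℂ (Set.range u)
  have hfin : b.Finite := (Set.finite_range u).subset hb
  have := hfin.fintype
  have hcard : Fintype.card b ≤ Fintype.card ι := by
    rw [← Set.toFinset_card]
    refine (Finset.card_le_card (t := Finset.univ.image u) fun x hx => ?_).trans
      Finset.card_image_le
    simpa using hb (Set.mem_toFinset.1 hx)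
  let e := Fintype.equivFin b
  have hrange : Set.range (fun i => (e.symm i : PowerSeries ℂ)) = b := by
    have : (fun i => (e.symm i : PowerSeries ℂ)) = Subtype.val ∘ e.symm := rfl
    rw [this, e.symm.surjective.range_comp, Subtype.range_coe]
  have hli' : LinearIndependent ℂ (fun i => (e.symm i : PowerSeries ℂ)) :=
    hli.comp _ e.symm.injective
  have hA : ∀ i, ∃ A : ℂ[X], A.natDegree ≤ E ∧
      (δ : PowerSeries ℂ) * eulerOp (e.symm i : PowerSeries ℂ) = A * (e.symm i) := by
    intro i
    obtain ⟨j, hj⟩ := hb (e.symm i).2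
    rw [← hj]
    exact hu j
  choose A hA1 hA2 using hA
  rw [← hspan, ← hrange] at hGu ⊢
  obtain ⟨c, rfl⟩ := (Submodule.mem_span_range_iff_exists_fun ℂ).1 hGu
  refine coe_mem_span_of_X_pow_dvd_aux δ hδ0 E hδ _ A hA1 hA2 hli' q n hq T ?_ c hG
  refine lt_of_le_of_lt ?_ hT
  gcongr

lemma exists_powerSeries_root_one_add_X (d : ℕ) (hd : 1 ≤ d) :
    ∃ B : PowerSeries ℂ, B ^ d = 1 + PowerSeries.X ∧ PowerSeries.constantCoeff B = 1 := by
  have hd0 : (d : ℂ) ≠ 0 := by exact_mod_cast (by omega : d ≠ 0)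
  refine ⟨PowerSeries.binomialSeries ℂ ((d : ℂ)⁻¹), ?_, by simp⟩
  have h : ∀ k : ℕ, PowerSeries.binomialSeries ℂ ((d : ℂ)⁻¹) ^ k
      = PowerSeries.binomialSeries ℂ ((k : ℂ) * (d : ℂ)⁻¹) := by
    intro k
    induction k with
    | zero => simp
    | succ k ih =>
      rw [pow_succ, ih, ← PowerSeries.binomialSeries_add]
      congr 1
      push_cast
      ring
  rw [h, mul_inv_cancel₀ hd0]
  have := PowerSeries.binomialSeries_nat (R := ℂ) (A := ℂ) 1
  simpa using this

lemma exists_powerSeries_root (d : ℕ) (hd : 1 ≤ d) (f : PowerSeries ℂ)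
    (hf : PowerSeries.constantCoeff f = 1) :
    ∃ θ : PowerSeries ℂ, θ ^ d = f ∧ PowerSeries.constantCoeff θ = 1 := by
  obtain ⟨B, hB, hB1⟩ := exists_powerSeries_root_one_add_X d hd
  have hs : PowerSeries.HasSubst (f - 1) :=
    PowerSeries.HasSubst.of_constantCoeff_zero' (by simp [hf])
  refine ⟨B.subst (f - 1), ?_, ?_⟩
  · rw [← PowerSeries.subst_pow hs, hB, PowerSeries.subst_add hs, PowerSeries.subst_X hs]
    have : (1 : PowerSeries ℂ).subst (f - 1) = 1 := by
      rw [← PowerSeries.coe_substAlgHom hs]; exact map_one _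
    rw [this]
    ring
  · have hBX : B = 1 + (B - 1) := by ring
    have : ∃ g, B - 1 = PowerSeries.X * g := PowerSeries.X_dvd_iff.2 (by simp [hB1])
    obtain ⟨g, hg⟩ := this
    rw [hBX, hg, PowerSeries.subst_add hs, PowerSeries.subst_mul hs, PowerSeries.subst_X hs]
    have : (1 : PowerSeries ℂ).subst (f - 1) = 1 := by
      rw [← PowerSeries.coe_substAlgHom hs]; exact map_one _
    rw [this]
    simp [hf]

lemma exists_isUnit_pow_sub_pow (d : ℕ) (hd : 1 ≤ d) (a b : PowerSeries ℂ)
    (ha : PowerSeries.constantCoeff a = 1) (hb : PowerSeries.constantCoeff b = 1) :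
    ∃ S : PowerSeries ℂ, IsUnit S ∧ S * (a - b) = a ^ d - b ^ d := by
  refine ⟨∑ i ∈ Finset.range d, a ^ i * b ^ (d - 1 - i), ?_, geom_sum₂_mul a b d⟩
  rw [PowerSeries.isUnit_iff_constantCoeff]
  simp [ha, hb]
  omega

lemma X_pow_dvd_sub_of_pow (d : ℕ) (hd : 1 ≤ d) (a b : PowerSeries ℂ)
    (ha : PowerSeries.constantCoeff a = 1) (hb : PowerSeries.constantCoeff b = 1) {T : ℕ}
    (h : PowerSeries.X ^ T ∣ a ^ d - b ^ d) : PowerSeries.X ^ T ∣ a - b := by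
  obtain ⟨S, hS, hS'⟩ := exists_isUnit_pow_sub_pow d hd a b ha hb
  rw [← hS'] at h
  exact (hS.dvd_mul_left).1 h

lemma exists_polynomial_approx_root (d : ℕ) (hd : 1 ≤ d) (J : ℕ) :
    ∃ Φ : ℂ[X], Φ.natDegree ≤ J ∧ Φ.coeff 0 = 1 ∧ X ^ (J + 1) ∣ Φ ^ d - (1 + X) := by
  obtain ⟨B, hB, hB1⟩ := exists_powerSeries_root_one_add_X d hd
  refine ⟨B.trunc (J + 1), ?_, ?_, ?_⟩
  · exact Nat.le_of_lt_succ (PowerSeries.natDegree_trunc_lt _ _)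
  · simp [PowerSeries.coeff_trunc, hB1]
  · rw [← X_pow_dvd_coe_iff]
    have h1 : (PowerSeries.X : PowerSeries ℂ) ^ (J + 1) ∣ B.trunc (J + 1) - B := by
      rw [PowerSeries.X_pow_dvd_iff]
      intro m hm
      simp [PowerSeries.coeff_trunc, hm]
    have h2 := h1.trans (sub_dvd_pow_sub_pow ((B.trunc (J + 1) : ℂ[X]) : PowerSeries ℂ) B d)
    simpa [hB] using h2

/-- Approximation of a `d`-th root of `δ + z`, expanded in powers of `z`. -/
lemma exists_root_approx (d : ℕ) (hd : 1 ≤ d) (δ z θ q : PowerSeries ℂ)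
    (hδ : PowerSeries.constantCoeff δ = 1) (hz : PowerSeries.constantCoeff z = 0)
    (hθ : θ ^ d = δ) (hθ1 : PowerSeries.constantCoeff θ = 1)
    (hq1 : PowerSeries.constantCoeff q = 1) (J T : ℕ) (hzT : PowerSeries.X ^ T ∣ z ^ (J + 1))
    (hq : PowerSeries.X ^ T ∣ q ^ d - (δ + z)) :
    ∃ φ : ℕ → ℂ, PowerSeries.X ^ T ∣
      δ ^ J * q - ∑ a ∈ Finset.range (J + 1), φ a • (θ * δ ^ (J - a) * z ^ a) := by
  obtain ⟨Φ, hΦdeg, hΦ0, Ψ, hΨ⟩ := exists_polynomial_approx_root d hd J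
  have hδ0 : PowerSeries.constantCoeff δ ≠ 0 := by rw [hδ]; exact one_ne_zero
  have hinv : δ * δ⁻¹ = 1 := PowerSeries.mul_inv_cancel δ hδ0
  set y := z * δ⁻¹ with hy
  have hy0 : PowerSeries.constantCoeff y = 0 := by simp [hy, hz]
  have hyz : δ * y = z := by rw [hy]; linear_combination z * hinv
  have hval : (aeval y Φ) = ∑ a ∈ Finset.range (J + 1), Φ.coeff a • y ^ a :=
    aeval_eq_sum_range' (by omega) y
  have hΦ1 : PowerSeries.constantCoeff (aeval y Φ) = 1 := by
    rw [hval, map_sum, Finset.sum_range_succ']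
    simp [hy0, hΦ0]
  have hpow : (θ * aeval y Φ) ^ d = δ + z + δ * (y ^ (J + 1) * aeval y Ψ) := by
    have h1 := congrArg (aeval y) hΨ
    simp only [map_sub, map_pow, map_add, map_one, aeval_X, map_mul] at h1
    rw [mul_pow, hθ]
    linear_combination δ * h1 + hyz
  have hclose : PowerSeries.X ^ T ∣ q - θ * aeval y Φ := by
    refine X_pow_dvd_sub_of_pow d hd _ _ hq1 (by simp [hθ1, hΦ1]) ?_
    rw [hpow, ← sub_sub]
    refine dvd_sub hq (Dvd.dvd.mul_left (Dvd.dvd.mul_right ?_ _) _)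
    rw [hy, mul_pow]
    exact hzT.mul_right _
  refine ⟨Φ.coeff, ?_⟩
  have : ∑ a ∈ Finset.range (J + 1), Φ.coeff a • (θ * δ ^ (J - a) * z ^ a)
      = δ ^ J * (θ * aeval y Φ) := by
    rw [hval, Finset.mul_sum, Finset.mul_sum]
    refine Finset.sum_congr rfl fun a ha => ?_
    have ha' : a ≤ J := by simpa [Nat.lt_succ_iff] using ha
    rw [mul_smul_comm, mul_smul_comm, ← hyz]
    congr 1
    conv_rhs => rw [← Nat.sub_add_cancel ha', pow_add]
    rw [mul_pow]
    ring
  rw [this, ← mul_sub]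
  exact hclose.mul_left _

lemma card_support_mul_X_pow (p : ℂ[X]) (k : ℕ) : (p * X ^ k).support.card = p.support.card := by
  have : (p * X ^ k).support = p.support.map (addRightEmbedding k) := by
    ext m
    simp only [mem_support_iff, coeff_mul_X_pow', Finset.mem_map, addRightEmbedding_apply]
    constructor
    · intro h
      split_ifs at h with hk
      · exact ⟨m - k, h, by omega⟩
      · exact absurd rfl h
    · rintro ⟨a, ha, rfl⟩
      simpa using ha
  rw [this, Finset.card_map]

lemma card_support_derivative_lt {p : ℂ[X]} (hp : p.coeff 0 ≠ 0) :
    (derivative p).support.card < p.support.card := by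
  have hsub : (derivative p).support.map (addRightEmbedding 1) ⊆ p.support.erase 0 := by
    intro m
    simp only [Finset.mem_map, addRightEmbedding_apply, mem_support_iff, coeff_derivative,
      Finset.mem_erase]
    rintro ⟨a, ha, rfl⟩
    exact ⟨by omega, left_ne_zero_of_mul ha⟩
  have := Finset.card_le_card hsub
  rw [Finset.card_map, Finset.card_erase_of_mem (mem_support_iff.2 hp)] at this
  have : 0 < p.support.card := Finset.card_pos.2 ⟨0, mem_support_iff.2 hp⟩
  omega

/-- A nonzero root of a polynomial with `N` terms has multiplicity less than `N`. -/
lemma eq_zero_of_pow_dvd_of_card_support_le (ζ : ℂ) (hζ : ζ ≠ 0) (N : ℕ) (p : ℂ[X])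
    (hN : p.support.card ≤ N) (h : (X - C ζ) ^ N ∣ p) : p = 0 := by
  induction N generalizing p with
  | zero => simpa using hN
  | succ N ih =>
    by_contra hp
    obtain ⟨r, hr, hr0⟩ := exists_eq_pow_rootMultiplicity_mul_and_not_dvd p hp 0
    rw [C_0, sub_zero] at hr hr0
    set k := rootMultiplicity 0 p
    have hr00 : r.coeff 0 ≠ 0 := fun h0 => hr0 (X_dvd_iff.2 h0)
    have hcard : r.support.card ≤ N + 1 := by
      rwa [hr, mul_comm, card_support_mul_X_pow] at hN
    have hcop : IsCoprime ((X - C ζ) ^ (N + 1)) (X ^ k) := by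
      have : IsCoprime (X - C ζ) (X - C (0 : ℂ)) :=
        isCoprime_X_sub_C_of_isUnit_sub (by simpa using hζ)
      rw [C_0, sub_zero] at this
      exact this.pow
    have hdvd : (X - C ζ) ^ (N + 1) ∣ r := hcop.dvd_of_dvd_mul_left (hr ▸ h)
    have hder : (X - C ζ) ^ N ∣ derivative r := by
      obtain ⟨s, hs⟩ := hdvd
      rw [hs, derivative_mul, derivative_X_sub_C_pow]
      simp only [Nat.add_sub_cancel]
      refine dvd_add (Dvd.dvd.mul_right (Dvd.dvd.mul_left dvd_rfl _) _) (Dvd.dvd.mul_right ?_ _)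
      exact pow_dvd_pow _ (Nat.le_succ _)
    have h0 := ih _ (by have := card_support_derivative_lt hr00; omega) hder
    have hc := derivative_eq_zero.1 h0
    rw [eq_C_of_natDegree_eq_zero hc] at hdvd
    have := natDegree_le_of_dvd hdvd (by simpa using hr00)
    rw [natDegree_pow, natDegree_X_sub_C, natDegree_C] at this
    omega

lemma lt_card_support_of_pow {η δ : ℂ[X]} {d : ℕ} (h : η ^ d = δ) (hδ : δ.natDegree ≠ 0)
    (h0 : δ.coeff 0 ≠ 0) : d < δ.support.card := by
  by_contra hlt
  push Not at hlt
  have hd : d ≠ 0 := by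
    rintro rfl
    rw [pow_zero] at h
    simp [← h] at hδ
  have hηdeg : η.degree ≠ 0 := by
    intro h1
    have h2 : η.natDegree = 0 := natDegree_eq_of_degree_eq_some h1
    exact hδ (by rw [← h, natDegree_pow, h2, mul_zero])
  obtain ⟨ζ, hζ⟩ := IsAlgClosed.exists_root η hηdeg
  have hζ0 : ζ ≠ 0 := by
    rintro rfl
    apply h0
    rw [← h, coeff_zero_eq_eval_zero, eval_pow, hζ.eq_zero, zero_pow hd]
  have hdvd : (X - C ζ) ^ δ.support.card ∣ δ := by
    exact (pow_dvd_pow _ hlt).trans (h ▸ pow_dvd_pow_of_dvd (dvd_iff_isRoot.2 hζ) d)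
  have := eq_zero_of_pow_dvd_of_card_support_le ζ hζ0 _ δ le_rfl hdvd
  rw [this] at h0
  exact h0 rfl

lemma dvd_of_homogeneous_monic_aux {R : Type*} (K : Type*) [Field K] [CommRing R] [Algebra R K]
    [IsFractionRing R K] [IsIntegrallyClosed R]
    {a b : R} (hb : b ≠ 0) (d : ℕ) (k : ℕ → R) (hk : k d = 1)
    (h : ∑ i ∈ Finset.range (d + 1), k i * a ^ i * b ^ (d - i) = 0) : b ∣ a := by
  have hb' : algebraMap R K b ≠ 0 := by
    rwa [Ne, FaithfulSMul.algebraMap_eq_zero_iff]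
  have h_int : IsIntegral R (algebraMap R K a / algebraMap R K b) := by
    refine ⟨∑ i ∈ Finset.range (d + 1), C (k i) * X ^ i, ?_, ?_⟩
    · rw [Finset.sum_range_succ, hk, C_1, one_mul, add_comm]
      refine monic_X_pow_add ?_
      refine (degree_sum_le _ _).trans_lt ?_
      rw [Finset.sup_lt_iff (by exact_mod_cast WithBot.bot_lt_coe d)]
      intro i hi
      refine (degree_C_mul_X_pow_le _ _).trans_lt ?_
      exact_mod_cast Finset.mem_range.1 hi
    · have h1 := congrArg (algebraMap R K) h
      rw [map_sum, map_zero] at h1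
      rw [eval₂_finsetSum]
      have hbd : algebraMap R K b ^ d ≠ 0 := pow_ne_zero _ hb'
      refine (mul_eq_zero.1 ?_).resolve_right hbd
      rw [← h1, Finset.sum_mul]
      refine Finset.sum_congr rfl fun i hi => ?_
      have hi' : i ≤ d := by simpa [Nat.lt_succ_iff] using hi
      simp only [eval₂_mul, eval₂_C, eval₂_pow, eval₂_X, map_mul, map_pow]
      have hsplit : algebraMap R K b ^ d = algebraMap R K b ^ i * algebraMap R K b ^ (d - i) := by
        rw [← pow_add, Nat.add_sub_cancel' hi']
      rw [hsplit, div_pow]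
      field_simp
  obtain ⟨y, hy⟩ := IsIntegrallyClosed.isIntegral_iff.1 h_int
  refine ⟨y, IsFractionRing.injective R K ?_⟩
  rw [map_mul, hy, mul_div_cancel₀ _ hb']


/-- A root of a monic equation in homogenized form is divisible by the homogenizing element. -/
lemma dvd_of_homogeneous_monic {R : Type*} [CommRing R] [IsDomain R] [IsIntegrallyClosed R]
    {a b : R} (hb : b ≠ 0) (d : ℕ) (k : ℕ → R) (hk : k d = 1)
    (h : ∑ i ∈ Finset.range (d + 1), k i * a ^ i * b ^ (d - i) = 0) : b ∣ a :=
  dvd_of_homogeneous_monic_aux (FractionRing R) hb d k hk h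

/-- The specialization `X i ↦ X ^ w i`. -/
noncomputable def monomialSpec {σ : Type*} (w : σ → ℕ) : MvPolynomial σ ℂ →ₐ[ℂ] ℂ[X] :=
  MvPolynomial.aeval fun i => X ^ w i

lemma monomialSpec_monomial {σ : Type*} (w : σ → ℕ) (γ : σ →₀ ℕ) (c : ℂ) :
    monomialSpec w (MvPolynomial.monomial γ c) = monomial (Finsupp.weight w γ) c := by
  rw [monomialSpec, MvPolynomial.aeval_monomial, Finsupp.weight_apply, ← C_mul_X_pow_eq_monomial]
  congr 1
  simp only [Finsupp.prod, Finsupp.sum, ← pow_mul, smul_eq_mul]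
  rw [Finset.prod_pow_eq_pow_sum]
  simp_rw [mul_comm]

lemma monomialSpec_eq_sum {σ : Type*} (w : σ → ℕ) (A : MvPolynomial σ ℂ) :
    monomialSpec w A = ∑ γ ∈ A.support, monomial (Finsupp.weight w γ) (A.coeff γ) := by
  conv_lhs => rw [A.as_sum, map_sum]
  simp_rw [monomialSpec_monomial]

lemma exists_of_coeff_monomialSpec_ne_zero {σ : Type*} (w : σ → ℕ) {A : MvPolynomial σ ℂ} {m : ℕ}
    (h : (monomialSpec w A).coeff m ≠ 0) : ∃ γ ∈ A.support, Finsupp.weight w γ = m := by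
  rw [monomialSpec_eq_sum, finsetSum_coeff] at h
  obtain ⟨γ, hγ, h⟩ := Finset.exists_ne_zero_of_sum_ne_zero h
  refine ⟨γ, hγ, ?_⟩
  by_contra hne
  exact h (coeff_monomial_of_ne _ (Ne.symm hne))

lemma support_monomialSpec_subset {σ : Type*} (w : σ → ℕ) (A : MvPolynomial σ ℂ) :
    (monomialSpec w A).support ⊆ A.support.image (Finsupp.weight w) := by
  intro m hm
  obtain ⟨γ, hγ, h⟩ := exists_of_coeff_monomialSpec_ne_zero w (mem_support_iff.1 hm)
  exact Finset.mem_image.2 ⟨γ, hγ, h⟩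

lemma card_support_monomialSpec_le {σ : Type*} (w : σ → ℕ) (A : MvPolynomial σ ℂ) :
    (monomialSpec w A).support.card ≤ A.support.card :=
  (Finset.card_le_card (support_monomialSpec_subset w A)).trans Finset.card_image_le

/-- All partial degrees are at most `D`. -/
def DegreesBounded {σ : Type*} (A : MvPolynomial σ ℂ) (D : ℕ) : Prop :=
  ∀ γ ∈ A.support, ∀ i, γ i ≤ D

lemma degreesBounded_iff {σ : Type*} {A : MvPolynomial σ ℂ} {D : ℕ} :
    DegreesBounded A D ↔ ∀ i, A.degreeOf i ≤ D := by
  simp only [DegreesBounded, MvPolynomial.degreeOf_le_iff]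
  exact ⟨fun h i γ hγ => h γ hγ i, fun h γ hγ i => h i γ hγ⟩

namespace DegreesBounded

variable {σ : Type*} {A B : MvPolynomial σ ℂ} {D E : ℕ}

lemma mono (h : DegreesBounded A D) (hDE : D ≤ E) : DegreesBounded A E :=
  fun γ hγ i => (h γ hγ i).trans hDE

lemma mul (hA : DegreesBounded A D) (hB : DegreesBounded B E) : DegreesBounded (A * B) (D + E) := by
  rw [degreesBounded_iff] at *
  exact fun i => (MvPolynomial.degreeOf_mul_le i A B).trans (add_le_add (hA i) (hB i))

lemma pow (hA : DegreesBounded A D) (k : ℕ) : DegreesBounded (A ^ k) (k * D) := by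
  rw [degreesBounded_iff] at *
  exact fun i => (MvPolynomial.degreeOf_pow_le i A k).trans (Nat.mul_le_mul_left _ (hA i))

lemma sum {ι : Type*} (s : Finset ι) (A : ι → MvPolynomial σ ℂ)
    (h : ∀ i ∈ s, DegreesBounded (A i) D) : DegreesBounded (∑ i ∈ s, A i) D := by
  rw [degreesBounded_iff]
  intro i
  refine (MvPolynomial.degreeOf_sum_le i s A).trans (Finset.sup_le fun j hj => ?_)
  exact degreesBounded_iff.1 (h j hj) i

lemma smul (hA : DegreesBounded A D) (c : ℂ) : DegreesBounded (c • A) D :=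
  fun γ hγ => hA γ (MvPolynomial.support_smul hγ)

lemma sub (hA : DegreesBounded A D) (hB : DegreesBounded B D) : DegreesBounded (A - B) D := by
  classical
  intro γ hγ
  rcases Finset.mem_union.1 (MvPolynomial.support_sub σ A B hγ) with h | h
  · exact hA γ h
  · exact hB γ h

lemma monomial {γ : σ →₀ ℕ} (hγ : ∀ i, γ i ≤ D) (c : ℂ) :
    DegreesBounded (MvPolynomial.monomial γ c) D := by
  classical
  intro γ' h
  rw [MvPolynomial.support_monomial] at h
  split_ifs at h
  · simp at h
  · rw [Finset.mem_singleton] at h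
    rwa [h]

lemma one : DegreesBounded (1 : MvPolynomial σ ℂ) 0 := by
  have : (1 : MvPolynomial σ ℂ) = MvPolynomial.monomial 0 1 := rfl
  rw [this]
  exact monomial (fun i => le_rfl) 1

end DegreesBounded

/-- Exponent vectors with entries at most `K` are determined by their weight. -/
def WeightInjOn {σ : Type*} (w : σ → ℕ) (K : ℕ) : Prop :=
  ∀ γ γ' : σ →₀ ℕ, (∀ i, γ i ≤ K) → (∀ i, γ' i ≤ K) →
    Finsupp.weight w γ = Finsupp.weight w γ' → γ = γ'

lemma WeightInjOn.coeff_monomialSpec {σ : Type*} {w : σ → ℕ} {K : ℕ} (hw : WeightInjOn w K)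
    {A : MvPolynomial σ ℂ} (hA : DegreesBounded A K) {γ : σ →₀ ℕ} (hγ : ∀ i, γ i ≤ K) :
    (monomialSpec w A).coeff (Finsupp.weight w γ) = A.coeff γ := by
  classical
  rw [monomialSpec_eq_sum, finsetSum_coeff]
  by_cases hmem : γ ∈ A.support
  · rw [Finset.sum_eq_single_of_mem γ hmem]
    · simp
    · intro γ' hγ' hne
      refine coeff_monomial_of_ne _ fun h => hne ?_
      exact (hw _ _ hγ (hA γ' hγ') h).symm
  · rw [MvPolynomial.notMem_support_iff.1 hmem]
    refine Finset.sum_eq_zero fun γ' hγ' => coeff_monomial_of_ne _ fun h => hmem ?_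
    rwa [hw _ _ hγ (hA γ' hγ') h]

lemma WeightInjOn.eq_zero {σ : Type*} {w : σ → ℕ} {K : ℕ} (hw : WeightInjOn w K)
    {A : MvPolynomial σ ℂ} (hA : DegreesBounded A K) (h : monomialSpec w A = 0) : A = 0 := by
  by_contra hne
  obtain ⟨γ, hγ⟩ := MvPolynomial.support_nonempty.2 hne
  have := hw.coeff_monomialSpec hA (hA γ hγ)
  rw [h, coeff_zero] at this
  exact MvPolynomial.mem_support_iff.1 hγ this.symm

/-- The part of a polynomial supported on the exponents satisfying `p`. -/
noncomputable def MvPolynomial.restrictPred {σ : Type*} (p : (σ →₀ ℕ) → Prop)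
    (A : MvPolynomial σ ℂ) : MvPolynomial σ ℂ :=
  open scoped Classical in ∑ γ ∈ A.support.filter p, MvPolynomial.monomial γ (A.coeff γ)

lemma MvPolynomial.mem_support_restrictPred {σ : Type*} {p : (σ →₀ ℕ) → Prop}
    {A : MvPolynomial σ ℂ} {γ : σ →₀ ℕ} :
    γ ∈ (A.restrictPred p).support ↔ γ ∈ A.support ∧ p γ := by
  classical
  rw [MvPolynomial.mem_support_iff, MvPolynomial.mem_support_iff, restrictPred, coeff_sum]
  simp only [coeff_monomial]
  rw [Finset.sum_ite_eq' _ γ]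
  simp
  tauto

lemma MvPolynomial.restrictPred_add_restrictPred_not {σ : Type*} (p : (σ →₀ ℕ) → Prop)
    (A : MvPolynomial σ ℂ) : A.restrictPred p + A.restrictPred (fun γ => ¬ p γ) = A := by
  classical
  unfold restrictPred
  conv_rhs => rw [A.as_sum]
  convert Finset.sum_filter_add_sum_filter_not A.support p
    (fun γ => MvPolynomial.monomial γ (A.coeff γ))

/-- Powers of a polynomial are spanned by few monomials. -/
lemma MvPolynomial.pow_mem_span_monomial {σ : Type*} (z : MvPolynomial σ ℂ) {a J : ℕ}
    (ha : a ≤ J) : z ^ a ∈ Submodule.span ℂ (Set.range fun j : z.support → Fin (J + 1) =>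
      MvPolynomial.monomial (∑ γ : z.support, (j γ : ℕ) • (γ : σ →₀ ℕ)) (1 : ℂ)) := by
  classical
  have hz : z = ∑ γ : z.support, MvPolynomial.monomial (γ : σ →₀ ℕ) (z.coeff γ) := by
    conv_lhs => rw [z.as_sum, ← Finset.sum_coe_sort]
  have hpow : z ^ a = (∑ γ : z.support, MvPolynomial.monomial (γ : σ →₀ ℕ) (z.coeff γ)) ^ a :=
    congrArg (· ^ a) hz
  rw [hpow, Finset.sum_pow_eq_sum_piAntidiag]
  refine Submodule.sum_mem _ fun k hk => ?_
  have hk' : ∀ γ, k γ < J + 1 := by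
    intro γ
    rw [Finset.mem_piAntidiag] at hk
    exact Nat.lt_succ_of_le (((Finset.single_le_sum (f := k) (fun _ _ => Nat.zero_le _)
      (Finset.mem_univ γ)).trans hk.1.le).trans ha)
  have : (∏ γ : z.support, MvPolynomial.monomial (γ : σ →₀ ℕ) (z.coeff γ) ^ k γ)
      = (∏ γ : z.support, z.coeff γ ^ k γ) •
        MvPolynomial.monomial (∑ γ : z.support, k γ • (γ : σ →₀ ℕ)) (1 : ℂ) := by
    simp_rw [MvPolynomial.monomial_pow]
    rw [← MvPolynomial.monomial_sum_prod, MvPolynomial.smul_monomial, smul_eq_mul, mul_one]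
  rw [this, ← nsmul_eq_mul]
  refine nsmul_mem (Submodule.smul_mem _ _ (Submodule.subset_span ?_)) _
  exact ⟨fun γ => ⟨k γ, hk' γ⟩, rfl⟩

/-- `u` satisfies a first order Euler equation with leading coefficient `δ` and coefficients of
degree at most `E`. -/
def EulerFirstOrder (δ : ℂ[X]) (E : ℕ) (u : PowerSeries ℂ) : Prop :=
  ∃ A : ℂ[X], A.natDegree ≤ E ∧ (δ : PowerSeries ℂ) * eulerOp u = A * u

lemma EulerFirstOrder.mul {δ : ℂ[X]} {E : ℕ} {u v : PowerSeries ℂ} (hu : EulerFirstOrder δ E u)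
    (hv : EulerFirstOrder δ E v) : EulerFirstOrder δ E (u * v) := by
  obtain ⟨A, hA, hu⟩ := hu
  obtain ⟨B, hB, hv⟩ := hv
  refine ⟨A + B, natDegree_add_le_of_degree_le hA hB, ?_⟩
  rw [Derivation.leibniz, smul_eq_mul, smul_eq_mul, coe_add]
  linear_combination v * hu + u * hv

lemma EulerFirstOrder.pow {δ : ℂ[X]} {E : ℕ} {u : PowerSeries ℂ} (hu : EulerFirstOrder δ E u)
    (k : ℕ) : EulerFirstOrder δ E (u ^ k) := by
  induction k with
  | zero => exact ⟨0, by simp, by simp⟩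
  | succ k ih => rw [pow_succ]; exact ih.mul hu

lemma eulerFirstOrder_self (δ : ℂ[X]) : EulerFirstOrder δ δ.natDegree δ :=
  ⟨X * derivative δ, natDegree_X_mul_derivative_le δ, by rw [eulerOp_coe, mul_comm]⟩

lemma eulerFirstOrder_X (δ : ℂ[X]) : EulerFirstOrder δ δ.natDegree PowerSeries.X := by
  refine ⟨δ, le_rfl, ?_⟩
  rw [← coe_X, eulerOp_coe]
  simp

lemma eulerFirstOrder_root {δ : ℂ[X]} {θ : PowerSeries ℂ} {d : ℕ} (hd : 1 ≤ d)
    (hθ : θ ^ d = δ) : EulerFirstOrder δ δ.natDegree θ := by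
  have hd0 : (d : ℂ) ≠ 0 := by exact_mod_cast (by omega : d ≠ 0)
  refine ⟨C (d : ℂ)⁻¹ * (X * derivative δ),
    (natDegree_C_mul_le _ _).trans (natDegree_X_mul_derivative_le δ), ?_⟩
  have h := congrArg eulerOp hθ
  rw [Derivation.leibniz_pow, eulerOp_coe, nsmul_eq_mul, smul_eq_mul] at h
  have hdd : PowerSeries.C (d : ℂ)⁻¹ * (d : PowerSeries ℂ) = 1 := by
    rw [← map_natCast (PowerSeries.C (R := ℂ)), ← map_mul, inv_mul_cancel₀ hd0, map_one]
  have hp : θ ^ d = θ * θ ^ (d - 1) := by rw [← pow_succ', Nat.sub_add_cancel hd]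
  rw [coe_mul, ← h, coe_C, ← hθ, hp]
  linear_combination (-(θ * θ ^ (d - 1) * eulerOp θ)) * hdd

lemma monomialSpec_monomial_one {σ : Type*} (w : σ → ℕ) (γ : σ →₀ ℕ) :
    monomialSpec w (MvPolynomial.monomial γ 1) = X ^ Finsupp.weight w γ := by
  rw [monomialSpec_monomial, monomial_one_right_eq_X_pow]

/-- A polynomial `q` with `q ^ d ≡ δ + z` to high order, where `δ` has much smaller degree, is up
to a power of `δ` the product of the `d`-th root of `δ` and a specialization of bounded degree. -/
lemma exists_monomialSpec_of_gap {σ : Type*} (w : σ → ℕ) (Δ Z : MvPolynomial σ ℂ)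
    (J D d n : ℕ) (hd : 1 ≤ d) (q : ℂ[X]) (θ : PowerSeries ℂ)
    (hΔ : DegreesBounded Δ D) (hZ : DegreesBounded Z D)
    (hΔ0 : (monomialSpec w Δ).coeff 0 = 1) (hZ0 : (monomialSpec w Z).coeff 0 = 0)
    (hθ : θ ^ d = monomialSpec w Δ) (hθ1 : PowerSeries.constantCoeff θ = 1)
    (hq : q.natDegree ≤ n) (hq0 : q.coeff 0 = 1)
    (hZT : X ^ (2 * n) ∣ monomialSpec w Z ^ (J + 1))
    (hqT : X ^ (2 * n) ∣ q ^ d - (monomialSpec w Δ + monomialSpec w Z))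
    (hn : (J + (J + 1) ^ (Z.support.card + 1) * ((J + 1) ^ (Z.support.card + 1) + 1)) *
      (monomialSpec w Δ).natDegree < n) :
    ∃ P : MvPolynomial σ ℂ, DegreesBounded P (J * D + Z.support.card * (J * D)) ∧
      ((monomialSpec w Δ ^ J * q : ℂ[X]) : PowerSeries ℂ) = θ * (monomialSpec w P : ℂ[X]) := by
  classical
  set δ := monomialSpec w Δ with hδdef
  set z := monomialSpec w Z with hzdef
  have hδ0 : δ ≠ 0 := by rintro h; rw [h] at hΔ0; simp at hΔ0
  let mon : (Z.support → Fin (J + 1)) → MvPolynomial σ ℂ := fun j =>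
    MvPolynomial.monomial (∑ γ : Z.support, (j γ : ℕ) • (γ : σ →₀ ℕ)) (1 : ℂ)
  let v : Fin (J + 1) × (Z.support → Fin (J + 1)) → MvPolynomial σ ℂ := fun x =>
    Δ ^ (J - x.1) * mon x.2
  let u : Fin (J + 1) × (Z.support → Fin (J + 1)) → PowerSeries ℂ := fun x =>
    θ * (monomialSpec w (v x) : ℂ[X])
  have hv : ∀ x, DegreesBounded (v x) (J * D + Z.support.card * (J * D)) := by
    intro x
    refine ((hΔ.pow _).mono ?_).mul (DegreesBounded.monomial ?_ 1)
    · exact Nat.mul_le_mul_right _ (Nat.sub_le _ _)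
    · intro i
      rw [Finsupp.finsetSum_apply]
      refine (Finset.sum_le_card_nsmul _ _ (J * D) fun γ _ => ?_).trans ?_
      · rw [Finsupp.smul_apply, smul_eq_mul]
        exact Nat.mul_le_mul (Nat.lt_succ_iff.1 (x.2 γ).2) (hZ _ γ.2 i)
      · simp
  have hode : ∀ x, EulerFirstOrder δ δ.natDegree (u x) := by
    intro x
    refine (eulerFirstOrder_root hd hθ).mul ?_
    simp only [v, mon, map_mul, map_pow, monomialSpec_monomial_one, coe_mul, coe_pow,
      coe_X]
    exact ((eulerFirstOrder_self δ).pow _).mul ((eulerFirstOrder_X δ).pow _)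
  obtain ⟨φ, hφ⟩ := exists_root_approx d hd (δ : PowerSeries ℂ) z θ q
    (by simpa using hΔ0) (by simpa using hZ0) hθ hθ1 (by simpa using hq0) J (2 * n)
    (by rw [← coe_pow, X_pow_dvd_coe_iff]; exact hZT)
    (by rw [← coe_pow, ← coe_add, ← coe_sub, X_pow_dvd_coe_iff]; exact hqT)
  have hmem : ∀ a ≤ J, θ * (δ : PowerSeries ℂ) ^ (J - a) * (z : PowerSeries ℂ) ^ a ∈
      Submodule.span ℂ (Set.range u) := by
    intro a ha
    let L : MvPolynomial σ ℂ →ₗ[ℂ] PowerSeries ℂ :=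
      (LinearMap.mulLeft ℂ (θ * (δ : PowerSeries ℂ) ^ (J - a))) ∘ₗ
        (Polynomial.coeToPowerSeries.algHom (R := ℂ) ℂ).toLinearMap ∘ₗ
          (monomialSpec w).toLinearMap
    have hL : ∀ A, L A = θ * (δ : PowerSeries ℂ) ^ (J - a) * (monomialSpec w A : ℂ[X]) := by
      intro A
      simp [L, Polynomial.coeToPowerSeries.algHom_apply, mul_assoc]
    have h1 := Submodule.mem_map_of_mem (f := L) (MvPolynomial.pow_mem_span_monomial Z ha)
    rw [Submodule.map_span, hL, map_pow, coe_pow] at h1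
    refine Submodule.span_mono ?_ h1
    rintro _ ⟨_, ⟨j, rfl⟩, rfl⟩
    refine ⟨(⟨a, by omega⟩, j), ?_⟩
    rw [hL]
    simp only [u, v, mon, map_mul, map_pow, coe_mul, coe_pow]
    ring
  have hspan := coe_mem_span_of_X_pow_dvd δ hδ0 δ.natDegree le_rfl u hode (δ ^ J * q)
    (J * δ.natDegree + n) (natDegree_mul_le_of_le (natDegree_pow_le_of_le _ le_rfl) hq) (2 * n)
    (by
      simp only [Fintype.card_prod, Fintype.card_fin, Fintype.card_fun, Fintype.card_coe]
      rw [← pow_succ']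
      nlinarith [hn])
    _ (Submodule.sum_mem _ fun a ha => Submodule.smul_mem _ (φ a)
      (hmem a (Nat.lt_succ_iff.1 (Finset.mem_range.1 ha))))
    (by simpa using hφ)
  obtain ⟨c, hc⟩ := (Submodule.mem_span_range_iff_exists_fun ℂ).1 hspan
  refine ⟨∑ x, c x • v x, DegreesBounded.sum _ _ fun x _ => (hv x).smul _, ?_⟩
  rw [← hc, map_sum]
  have hcoe : ((∑ x, monomialSpec w (c x • v x) : ℂ[X]) : PowerSeries ℂ)
      = ∑ x, c x • ((monomialSpec w (v x) : ℂ[X]) : PowerSeries ℂ) := by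
    rw [← Polynomial.coeToPowerSeries.ringHom_apply, map_sum]
    refine Finset.sum_congr rfl fun x _ => ?_
    rw [map_smul, Polynomial.coeToPowerSeries.ringHom_apply, coe_smul]
  rw [hcoe, Finset.mul_sum]
  refine Finset.sum_congr rfl fun x _ => ?_
  rw [mul_smul_comm]

lemma exists_polynomial_root {δ q P : ℂ[X]} {θ : PowerSeries ℂ} {d J : ℕ} (hd : 1 ≤ d)
    (hθ : θ ^ d = δ) (hδ : δ ≠ 0) (hq : q ≠ 0)
    (h : ((δ ^ J * q : ℂ[X]) : PowerSeries ℂ) = θ * P) : ∃ η : ℂ[X], (η : PowerSeries ℂ) = θ := by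
  have hP : P ≠ 0 := by
    rintro rfl
    rw [coe_zero, mul_zero, coe_eq_zero_iff] at h
    exact mul_ne_zero (pow_ne_zero _ hδ) hq h
  have h1 : (δ ^ J * q) ^ d = P ^ d * δ := by
    apply Polynomial.coe_injective ℂ
    rw [coe_pow, h, mul_pow, hθ, coe_mul, coe_pow, mul_comm]
  obtain ⟨η, hη⟩ := (IsIntegrallyClosed.pow_dvd_pow_iff (by omega)).1 (Dvd.intro _ h1.symm)
  refine ⟨η, ?_⟩
  rw [hη, coe_mul, mul_comm] at h
  exact mul_right_cancel₀ (by simpa using hP) h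

/-- Pigeonhole: among the scales separated by `Y`, some scale contains no weight. -/
lemma exists_gap {α : Type*} (s : Finset α) (wt : α → ℕ) (S n : ℕ) (Y : ℕ → ℕ) (hY0 : Y 0 = 1)
    (hY : Monotone Y) (hs : s.card ≤ S) (h : ∃ γ ∈ s, n ≤ wt γ) :
    ∃ c < S, ∀ γ ∈ s, n ≤ Y (c + 1) * wt γ → n ≤ Y c * wt γ := by
  classical
  by_contra! hcon
  obtain ⟨γ₀, hγ₀, hn⟩ := h
  have : Nonempty α := ⟨γ₀⟩
  choose! f hf1 hf2 hf3 using hcon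
  have hmaps : ∀ c ∈ Finset.range S, f c ∈ s.erase γ₀ := by
    intro c hc
    have hc := Finset.mem_range.1 hc
    refine Finset.mem_erase.2 ⟨?_, hf1 c hc⟩
    intro heq
    have h1 := hf3 c hc
    have h2 : 1 ≤ Y c := hY0 ▸ hY (Nat.zero_le c)
    rw [heq] at h1
    nlinarith
  have hlt : (s.erase γ₀).card < (Finset.range S).card := by
    rw [Finset.card_erase_of_mem hγ₀, Finset.card_range]
    have : 0 < s.card := Finset.card_pos.2 ⟨_, hγ₀⟩
    omega
  obtain ⟨a, ha, b, hb, hab, heq⟩ := Finset.exists_ne_map_eq_of_card_lt_of_maps_to hlt hmaps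
  have key : ∀ a b, a < S → b < S → f a = f b → ¬ a < b := by
    intro a b ha hb heq hlt
    have h1 := hf2 a ha
    have h2 := hf3 b hb
    rw [← heq] at h2
    have h3 : Y (a + 1) ≤ Y b := hY hlt
    have := Nat.mul_le_mul_right (wt (f a)) h3
    omega
  rw [Finset.mem_range] at ha hb
  rcases lt_trichotomy a b with h | h | h
  · exact key a b ha hb heq h
  · exact hab h
  · exact key b a hb ha heq.symm h

/-- Scales used to separate the exponents of a lacunary polynomial with at most `S` terms. -/
def separationScale (S : ℕ) : ℕ → ℕ
  | 0 => 1
  | c + 1 => (2 * separationScale S c + 1) ^ (2 * S + 4)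

lemma separationScale_le_succ (S c : ℕ) : separationScale S c ≤ separationScale S (c + 1) := by
  have : 2 * separationScale S c + 1 ≤ separationScale S (c + 1) :=
    Nat.le_self_pow (by omega) _
  omega

lemma separationScale_monotone (S : ℕ) : Monotone (separationScale S) :=
  monotone_nat_of_le_succ (separationScale_le_succ S)

lemma one_le_separationScale (S c : ℕ) : 1 ≤ separationScale S c :=
  separationScale_monotone S (Nat.zero_le c)

lemma le_separationScale_succ {S c k : ℕ} (hk : k ≤ S) :
    2 * separationScale S c + (2 * separationScale S c + 1) ^ (k + 1) *
      ((2 * separationScale S c + 1) ^ (k + 1) + 1) ≤ separationScale S (c + 1) := by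
  set y := 2 * separationScale S c + 1 with hy
  have h3 : 3 ≤ y := by have := one_le_separationScale S c; omega
  have h1 : y ^ (k + 1) ≤ y ^ (S + 1) := Nat.pow_le_pow_right (by omega) (by omega)
  have h2 : y ≤ y ^ (S + 1) := Nat.le_self_pow (by omega) _
  have h4 : separationScale S (c + 1) = y ^ (S + 1) * y ^ (S + 1) * (y * y) := by
    rw [← pow_two y, ← pow_add, ← pow_add]
    change y ^ (2 * S + 4) = _
    congr 1
    ring
  rw [h4]
  set x := y ^ (S + 1)
  have h5 : y ^ (k + 1) * (y ^ (k + 1) + 1) ≤ x * (x + 1) := Nat.mul_le_mul h1 (by omega)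
  have h6 : x * x * 9 ≤ x * x * (y * y) := Nat.mul_le_mul_left _ (by nlinarith)
  have h7 : x ≤ x * x := by nlinarith
  nlinarith

lemma X_pow_dvd_monomialSpec {σ : Type*} (w : σ → ℕ) {A : MvPolynomial σ ℂ} {m : ℕ}
    (h : ∀ γ ∈ A.support, m ≤ Finsupp.weight w γ) : X ^ m ∣ monomialSpec w A := by
  rw [X_pow_dvd_iff]
  intro k hk
  by_contra hne
  obtain ⟨γ, hγ, rfl⟩ := exists_of_coeff_monomialSpec_ne_zero w hne
  exact absurd (h γ hγ) (by omega)

/-- From a lift of `δ ^ J * q`, a lift of `q`. -/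
lemma exists_lift_of_mul {σ : Type*} {w : σ → ℕ} {K : ℕ} (hw : WeightInjOn w K)
    {H Δ N : MvPolynomial σ ℂ} {ν : σ →₀ ℕ} {D B J d : ℕ} (hd : 1 ≤ d)
    (hH : DegreesBounded H D) (hΔ : DegreesBounded Δ D) (hN : DegreesBounded N B)
    (hν : ∀ i, ν i ≤ D) (hK : d * (D + B + J * D) ≤ K) {q : ℂ[X]} {c : ℕ → ℂ} (hc : c d = 1)
    (hΔ0 : monomialSpec w Δ ≠ 0)
    (hNq : monomialSpec w Δ ^ J * q = monomialSpec w N)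
    (h : monomialSpec w H =
      ∑ i ∈ Finset.range (d + 1), C (c i) * q ^ i * X ^ (Finsupp.weight w ν * (d - i))) :
    ∃ Q : MvPolynomial σ ℂ, DegreesBounded Q B ∧ monomialSpec w Q = q := by
  have hb : Δ ^ J ≠ 0 := by
    refine pow_ne_zero _ fun h0 => hΔ0 ?_
    rw [h0, map_zero]
  let k : ℕ → MvPolynomial σ ℂ := fun i =>
    c i • MvPolynomial.monomial ν 1 ^ (d - i) - if i = 0 then H else 0
  have hk : ∀ i, DegreesBounded (k i) (d * D) := by
    intro i
    refine DegreesBounded.sub ((((DegreesBounded.monomial hν 1).pow _).mono ?_).smul _) ?_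
    · exact Nat.mul_le_mul_right _ (Nat.sub_le _ _)
    · split_ifs
      · exact hH.mono (Nat.le_mul_of_pos_left _ hd)
      · intro γ hγ
        simp at hγ
  have hkd : k d = 1 := by
    have hd0 : d ≠ 0 := by omega
    simp [k, hc, hd0]
  have hzero : ∑ i ∈ Finset.range (d + 1), k i * N ^ i * (Δ ^ J) ^ (d - i) = 0 := by
    refine hw.eq_zero (DegreesBounded.sum _ _ fun i hi => ?_) ?_
    · have hi' : i ≤ d := Nat.lt_succ_iff.1 (Finset.mem_range.1 hi)
      refine (((hk i).mul (hN.pow i)).mul ((hΔ.pow J).pow (d - i))).mono (le_trans ?_ hK)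
      have h1 : i * B ≤ d * B := Nat.mul_le_mul_right _ hi'
      have h2 : (d - i) * (J * D) ≤ d * (J * D) := Nat.mul_le_mul_right _ (Nat.sub_le _ _)
      nlinarith
    · have hterm : ∀ i ∈ Finset.range (d + 1),
          monomialSpec w (k i * N ^ i * (Δ ^ J) ^ (d - i)) = (monomialSpec w Δ ^ J) ^ d *
            (C (c i) * q ^ i * X ^ (Finsupp.weight w ν * (d - i)) -
              if i = 0 then monomialSpec w H else 0) := by
        intro i hi
        have hi' : i ≤ d := Nat.lt_succ_iff.1 (Finset.mem_range.1 hi)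
        have hsplit : (monomialSpec w Δ ^ J) ^ d
            = (monomialSpec w Δ ^ J) ^ i * (monomialSpec w Δ ^ J) ^ (d - i) := by
          rw [← pow_add, Nat.add_sub_cancel' hi']
        simp only [k, map_mul, map_sub, map_pow, map_smul, monomialSpec_monomial_one, ← hNq,
          smul_eq_C_mul, apply_ite (monomialSpec w), map_zero, ← pow_mul X]
        rw [hsplit, mul_pow (monomialSpec w Δ ^ J)]
        split_ifs with h0
        · subst h0
          simp
          ring
        · ring
      rw [map_sum, Finset.sum_congr rfl hterm, ← Finset.mul_sum, Finset.sum_sub_distrib, ← h]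
      simp
  obtain ⟨Q, hQ⟩ := dvd_of_homogeneous_monic hb d k hkd hzero
  refine ⟨Q, ?_, ?_⟩
  · rw [degreesBounded_iff] at hN ⊢
    intro i
    refine le_trans ?_ (hN i)
    by_cases hQ0 : Q = 0
    · simp [hQ0]
    · rw [hQ, MvPolynomial.degreeOf_mul_eq hb hQ0]
      omega
  · rw [hQ, map_mul, map_pow] at hNq
    exact (mul_left_cancel₀ (pow_ne_zero _ hΔ0) hNq).symm

/-- Lifting theorem: if the exponents are sufficiently independent, then `q` is a specialization of
a polynomial of controlled degrees. -/
theorem exists_lift {σ : Type*} {w : σ → ℕ} (S D Jm K : ℕ)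
    (hJm : 2 * separationScale S S ≤ Jm)
    (hK : S * (D + S * ((S + 1) * (Jm * D)) + Jm * D) ≤ K)
    (hw : WeightInjOn w K) (s : ℕ) (hs : s ≤ S) (H : MvPolynomial σ ℂ)
    (hHs : H.support.card ≤ s) (hH : DegreesBounded H D) (ν : σ →₀ ℕ) (hν : ∀ i, ν i ≤ D)
    (d : ℕ) (hd : 1 ≤ d) (c : ℕ → ℂ) (hc : c d = 1) (hc' : c (d - 1) = 0) (q : ℂ[X])
    (hq : q.natDegree ≤ Finsupp.weight w ν)
    (hn : Finsupp.weight w ν ≤ (monomialSpec w H).natDegree) (hq0 : q.coeff 0 = 1)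
    (h : monomialSpec w H =
      ∑ i ∈ Finset.range (d + 1), C (c i) * q ^ i * X ^ (Finsupp.weight w ν * (d - i))) :
    ∃ Q : MvPolynomial σ ℂ, DegreesBounded Q (s * ((S + 1) * (Jm * D))) ∧
      monomialSpec w Q = q := by
  induction s generalizing H ν d c q with
  | zero =>
    have hH0 : H = 0 := by simpa using hHs
    rw [hH0, map_zero, natDegree_zero] at hn
    have : q = 1 := by
      rw [eq_C_of_natDegree_eq_zero (Nat.le_zero.1 (hq.trans hn)), hq0, C_1]
    exact ⟨1, DegreesBounded.one.mono (Nat.zero_le _), by rw [map_one, this]⟩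
  | succ s ih =>
    set n := Finsupp.weight w ν with hndef
    rcases Nat.eq_zero_or_pos n with hn0 | hnpos
    · have : q = 1 := by
        have hqn : q.natDegree = 0 := by omega
        rw [eq_C_of_natDegree_eq_zero hqn, hq0, C_1]
      exact ⟨1, DegreesBounded.one.mono (Nat.zero_le _), by rw [map_one, this]⟩
    have hH0 : monomialSpec w H ≠ 0 := by
      intro h0
      rw [h0, natDegree_zero] at hn
      omega
    obtain ⟨γ₀, hγ₀, hγ₀n⟩ := exists_of_coeff_monomialSpec_ne_zero w
      (mem_support_iff.1 (natDegree_mem_support_of_nonzero hH0))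
    obtain ⟨k, hkS, hk⟩ := exists_gap H.support (fun γ => Finsupp.weight w γ) S n
      (separationScale S) rfl (separationScale_monotone S) (hHs.trans hs)
      ⟨γ₀, hγ₀, by rw [hγ₀n]; exact hn⟩
    set Δ := H.restrictPred fun γ => separationScale S (k + 1) * Finsupp.weight w γ < n with hΔdef
    set Z := H.restrictPred fun γ => ¬ separationScale S (k + 1) * Finsupp.weight w γ < n
      with hZdef
    have hsum : Δ + Z = H := MvPolynomial.restrictPred_add_restrictPred_not _ H
    have hΔmem : ∀ γ ∈ Δ.support, γ ∈ H.support ∧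
        separationScale S (k + 1) * Finsupp.weight w γ < n :=
      fun γ hγ => MvPolynomial.mem_support_restrictPred.1 hγ
    have hZmem : ∀ γ ∈ Z.support, γ ∈ H.support ∧
        ¬ separationScale S (k + 1) * Finsupp.weight w γ < n :=
      fun γ hγ => MvPolynomial.mem_support_restrictPred.1 hγ
    have hΔD : DegreesBounded Δ D := fun γ hγ => hH γ (hΔmem γ hγ).1
    have hZD : DegreesBounded Z D := fun γ hγ => hH γ (hZmem γ hγ).1
    have hΔcard : Δ.support.card < H.support.card := by
      refine Finset.card_lt_card ⟨fun γ hγ => (hΔmem γ hγ).1, fun hsub => ?_⟩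
      have h1 := (hΔmem γ₀ (hsub hγ₀)).2
      have h2 := one_le_separationScale S (k + 1)
      nlinarith
    have hZcard : Z.support.card ≤ S :=
      (Finset.card_le_card fun γ hγ => (hZmem γ hγ).1).trans (hHs.trans hs)
    set J := 2 * separationScale S k with hJdef
    have hJle : J ≤ Jm := by
      have := separationScale_monotone S hkS.le
      omega
    obtain ⟨m, hm, hmin⟩ : ∃ m, n ≤ separationScale S k * m ∧
        ∀ m', n ≤ separationScale S k * m' → m ≤ m' := by
      have hex : ∃ m, n ≤ separationScale S k * m :=
        ⟨n, Nat.le_mul_of_pos_left _ (one_le_separationScale S k)⟩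
      exact ⟨Nat.find hex, Nat.find_spec hex, fun m' hm' => Nat.find_min' hex hm'⟩
    have hmpos : m ≠ 0 := by
      rintro rfl
      omega
    have hZdvd : X ^ m ∣ monomialSpec w Z := by
      refine X_pow_dvd_monomialSpec w fun γ hγ => hmin _ ?_
      exact hk γ (hZmem γ hγ).1 (not_lt.1 (hZmem γ hγ).2)
    have hZ0 : (monomialSpec w Z).coeff 0 = 0 :=
      X_dvd_iff.1 ((dvd_pow_self X hmpos).trans hZdvd)
    have hZT : X ^ (2 * n) ∣ monomialSpec w Z ^ (J + 1) := by
      refine (pow_dvd_pow X ?_).trans ((pow_mul (X : ℂ[X]) m (J + 1)) ▸ pow_dvd_pow_of_dvd hZdvd _)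
      rw [hJdef]
      nlinarith
    have hqT : X ^ (2 * n) ∣ q ^ d - (monomialSpec w Δ + monomialSpec w Z) := by
      rw [← map_add, hsum, h, Finset.sum_range_succ, hc, Nat.sub_self, mul_zero, pow_zero, C_1,
        one_mul, mul_one, sub_add_cancel_right, dvd_neg]
      refine Finset.dvd_sum fun i hi => ?_
      have hi := Finset.mem_range.1 hi
      by_cases hid : i = d - 1
      · rw [hid, hc', C_0, zero_mul, zero_mul]
        exact dvd_zero _
      · refine Dvd.dvd.mul_left (pow_dvd_pow X ?_) _
        rw [mul_comm 2]
        exact Nat.mul_le_mul_left _ (by omega)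
    have hΔ0 : (monomialSpec w Δ).coeff 0 = 1 := by
      have := X_dvd_iff.1 ((dvd_pow_self X (by omega : 2 * n ≠ 0)).trans hqT)
      rw [coeff_sub, coeff_add, hZ0, coeff_zero_eq_eval_zero, eval_pow, ← coeff_zero_eq_eval_zero,
        hq0, one_pow, add_zero, sub_eq_zero] at this
      exact this.symm
    have hδ0 : monomialSpec w Δ ≠ 0 := by
      intro h0
      rw [h0] at hΔ0
      simp at hΔ0
    obtain ⟨γ₁, hγ₁, hγ₁n⟩ := exists_of_coeff_monomialSpec_ne_zero w
      (mem_support_iff.1 (natDegree_mem_support_of_nonzero hδ0))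
    obtain ⟨θ, hθ, hθ1⟩ := exists_powerSeries_root d hd (monomialSpec w Δ : ℂ[X])
      (by simpa using hΔ0)
    obtain ⟨P, hP, hPq⟩ := exists_monomialSpec_of_gap w Δ Z J D d n hd q θ hΔD hZD hΔ0 hZ0 hθ hθ1
      hq hq0 hZT hqT (by
        refine lt_of_le_of_lt (Nat.mul_le_mul_right _ (le_separationScale_succ hZcard)) ?_
        rw [← hγ₁n]
        exact (hΔmem γ₁ hγ₁).2)
    have hPB : DegreesBounded P ((S + 1) * (Jm * D)) := by
      refine hP.mono ?_
      have h1 : J * D ≤ Jm * D := Nat.mul_le_mul_right _ hJle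
      have h2 : Z.support.card * (J * D) ≤ S * (Jm * D) := Nat.mul_le_mul hZcard h1
      nlinarith
    obtain ⟨η, hη⟩ := exists_polynomial_root hd hθ hδ0 (by rintro rfl; simp at hq0) hPq
    have hηδ : η ^ d = monomialSpec w Δ := by
      apply Polynomial.coe_injective ℂ
      rw [coe_pow, hη, hθ]
    have hη0 : η.coeff 0 = 1 := by
      rw [← hθ1, ← hη]
      simp
    have hηP : monomialSpec w Δ ^ J * q = η * monomialSpec w P := by
      apply Polynomial.coe_injective ℂ
      rw [hPq, coe_mul, hη]
    by_cases hdeg : (monomialSpec w Δ).natDegree = 0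
    · have hδ1 : monomialSpec w Δ = 1 := by
        rw [eq_C_of_natDegree_eq_zero hdeg, hΔ0, C_1]
      have hη1 : η = 1 := by
        have : η.natDegree = 0 := by
          have h1 := congrArg natDegree hηδ
          rw [natDegree_pow, hdeg] at h1
          exact (mul_eq_zero.1 h1).resolve_left (by omega)
        rw [eq_C_of_natDegree_eq_zero this, hη0, C_1]
      refine ⟨P, hPB.mono ?_, ?_⟩
      · nlinarith [Nat.zero_le (s * ((S + 1) * (Jm * D)))]
      · rw [hδ1, hη1, one_pow, one_mul, one_mul] at hηP
        exact hηP.symm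
    · have hdS : d ≤ S := by
        have h1 := lt_card_support_of_pow hηδ hdeg (by rw [hΔ0]; exact one_ne_zero)
        have h2 := card_support_monomialSpec_le w Δ
        omega
      have hηdeg : η.natDegree ≤ (monomialSpec w Δ).natDegree := by
        rw [← hηδ, natDegree_pow]
        exact Nat.le_mul_of_pos_left _ hd
      obtain ⟨η', hη'B, hη'⟩ := ih (by omega) Δ (by omega) hΔD γ₁ (hΔD γ₁ hγ₁) d hd
        (fun i => if i = d then 1 else 0) (by simp) (by simp; omega) η (by rw [hγ₁n]; exact hηdeg)
        hγ₁n.le hη0 (by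
          rw [Finset.sum_range_succ, Finset.sum_eq_zero]
          · simp [hηδ]
          · intro i hi
            rw [if_neg (Finset.mem_range.1 hi).ne, C_0, zero_mul, zero_mul])
      refine exists_lift_of_mul hw hd hH hΔD (N := η' * P) (J := J) ?_ hν ?_ hc hδ0 ?_ h
      · refine (hη'B.mul hPB).mono (le_of_eq ?_)
        ring
      · refine le_trans (Nat.mul_le_mul hdS ?_) hK
        have h1 : (s + 1) * ((S + 1) * (Jm * D)) ≤ S * ((S + 1) * (Jm * D)) :=
          Nat.mul_le_mul_right _ hs
        have h2 : J * D ≤ Jm * D := Nat.mul_le_mul_right _ hJle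
        omega
      · rw [map_mul, hη', hηP]

lemma exists_reparametrization_aux {σ : Type*} [Fintype σ] [DecidableEq σ] (K s : ℕ) (w : σ → ℕ)
    (a : σ → ℤ) (hs : (Finset.univ.filter fun i => a i ≠ 0).card ≤ s)
    (ha : ∃ i, a i ≠ 0) (haK : ∀ i, |a i| ≤ K) (hrel : ∑ i, a i * w i = 0) :
    ∃ (N : ℕ) (w' : σ → ℕ) (M : σ → σ → ℕ), 1 ≤ N ∧ (∀ i j, M i j ≤ (2 * K) ^ s) ∧
      (∀ i, N * w i = ∑ j, M i j * w' j) ∧ ∃ j, w' j = 0 := by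
  induction s generalizing w a with
  | zero =>
    obtain ⟨i, hi⟩ := ha
    have : i ∈ Finset.univ.filter fun i => a i ≠ 0 := by simpa using hi
    rw [Nat.le_zero, Finset.card_eq_zero] at hs
    simp [hs] at this
  | succ s ih =>
    have hne : (Finset.univ.filter fun i => a i ≠ 0).Nonempty := by
      obtain ⟨i, hi⟩ := ha
      exact ⟨i, by simpa using hi⟩
    obtain ⟨i, hi, hmin⟩ := Finset.exists_min_image _ (fun i => |a i| * w i) hne
    replace hi : a i ≠ 0 := by simpa using hi
    replace hmin : ∀ j, a j ≠ 0 → |a i| * w i ≤ |a j| * w j := fun j hj => hmin j (by simpa using hj)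
    have hK : 1 ≤ K := by
      have := haK i
      have := abs_pos.2 hi
      omega
    wlog hpos : 0 < a i generalizing a
    · refine this (fun i => -a i) (by simpa using hs) (by simpa using ha) (by simpa using haK)
        (by simpa using hrel) (by simpa using hne) (by simpa using hi) (by simpa using hmin) ?_
      have := lt_of_le_of_ne (not_lt.1 hpos) hi
      omega
    by_cases hneg : ∃ j, a j < 0
    · obtain ⟨j, hj⟩ := hneg
      have hij : i ≠ j := by rintro rfl; omega
      obtain ⟨α, hα⟩ := Int.eq_ofNat_of_zero_le hpos.le
      obtain ⟨b, hb⟩ := Int.eq_ofNat_of_zero_le (neg_nonneg.2 hj.le)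
      have hb' : a j = -b := by omega
      have hαK : α ≤ K := by have := haK i; rw [hα] at this; simpa using this
      have hbK : b ≤ K := by have := haK j; rw [hb'] at this; simpa using this
      have hle : α * w i ≤ b * w j := by
        have := hmin j hj.ne
        rw [hα, hb', abs_neg, Nat.abs_cast, Nat.abs_cast] at this
        exact_mod_cast this
      let w₁ : σ → ℕ := fun k =>
        if k = i then w i else if k = j then b * w j - α * w i else b * w k
      let M₁ : σ → σ → ℕ := fun k l =>
        if k = i then (if l = i then b else 0) else
          (if l = k then 1 else 0) + if k = j ∧ l = i then α else 0
      have hM₁ : ∀ (f : σ → ℕ) k, ∑ l, M₁ k l * f l =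
          if k = i then b * f i else f k + if k = j then α * f i else 0 := by
        intro f k
        by_cases hki : k = i
        · simp [M₁, hki]
        · by_cases hkj : k = j
          · simp [M₁, hkj, hij.symm, add_mul, Finset.sum_add_distrib]
          · simp [M₁, hki, hkj]
      have hw₁ : ∀ k, b * w k = ∑ l, M₁ k l * w₁ l := by
        intro k
        rw [hM₁]
        by_cases hki : k = i
        · simp [w₁, hki]
        · by_cases hkj : k = j
          · simp only [w₁, hkj, if_neg hij.symm, if_true]
            omega
          · simp [w₁, hki, hkj]
      have hrel₁ : ∑ k, Function.update a i 0 k * (w₁ k : ℤ) = 0 := by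
        have hterm : ∀ k, Function.update a i 0 k * (w₁ k : ℤ) =
            b * (a k * w k) - (if k = i then b * (a i * w i) else 0) +
              (if k = j then b * (α * w i) else 0) := by
          intro k
          by_cases hki : k = i
          · subst hki
            simp [hij]
          · by_cases hkj : k = j
            · subst hkj
              simp only [w₁, Function.update_of_ne hki, if_neg hki, if_true, hb']
              push_cast [hle]
              ring
            · simp only [w₁, Function.update_of_ne hki, if_neg hki, if_neg hkj]
              push_cast
              ring
        rw [Finset.sum_congr rfl fun k _ => hterm k, Finset.sum_add_distrib,
          Finset.sum_sub_distrib, ← Finset.mul_sum, hrel]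
        simp [hα]
      have hcard : (Finset.univ.filter fun k => Function.update a i 0 k ≠ 0).card ≤ s := by
        refine Nat.le_of_lt_succ (lt_of_lt_of_le (Finset.card_lt_card ?_) hs)
        refine ⟨fun k hk => ?_, fun hsub => ?_⟩
        · by_cases hki : k = i
          · simp [hki] at hk
          · simpa [Function.update_of_ne hki] using hk
        · have := hsub (show i ∈ _ by simpa using hi)
          simp at this
      obtain ⟨N, w', M, hN, hM, hNw, hzero⟩ := ih w₁ (Function.update a i 0) hcard
        ⟨j, by rw [Function.update_of_ne hij.symm]; exact hj.ne⟩
        (fun k => by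
          by_cases hki : k = i
          · simp [hki]
          · rw [Function.update_of_ne hki]; exact haK k) hrel₁
      refine ⟨N * b, w', fun k m => ∑ l, M₁ k l * M l m, ?_, ?_, ?_, hzero⟩
      · have : 1 ≤ b := by omega
        exact Nat.mul_le_mul hN this
      · intro k m
        change ∑ l, M₁ k l * M l m ≤ _
        rw [hM₁ fun l => M l m, pow_succ]
        have h1 := hM i m
        have h2 := hM k m
        have h3 : b * M i m ≤ K * (2 * K) ^ s := Nat.mul_le_mul hbK h1
        have h4 : α * M i m ≤ K * (2 * K) ^ s := Nat.mul_le_mul hαK h1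
        have h5 : (2 * K) ^ s ≤ K * (2 * K) ^ s := Nat.le_mul_of_pos_left _ hK
        have h6 : (2 * K) ^ s * (2 * K) = K * (2 * K) ^ s + K * (2 * K) ^ s := by ring
        split_ifs <;> omega
      · intro k
        rw [mul_assoc, hw₁, Finset.mul_sum]
        simp_rw [Finset.sum_mul]
        rw [Finset.sum_comm]
        refine Finset.sum_congr rfl fun l _ => ?_
        rw [mul_left_comm, hNw, Finset.mul_sum]
        exact Finset.sum_congr rfl fun m _ => (mul_assoc _ _ _).symm
    · push Not at hneg
      have h0 : a i * w i = 0 :=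
        (Finset.sum_eq_zero_iff_of_nonneg fun k _ => mul_nonneg (hneg k) (Nat.cast_nonneg _)).1
          hrel i (Finset.mem_univ i)
      refine ⟨1, w, fun k l => if k = l then 1 else 0, le_rfl, fun k l => ?_, fun k => by simp,
        i, ?_⟩
      · have : 1 ≤ (2 * K) ^ (s + 1) := Nat.one_le_pow _ _ (by omega)
        change (if k = l then 1 else 0) ≤ _
        split_ifs <;> omega
      · simpa [hi] using h0

/-- A linear relation between weights allows to write them, up to a common factor, in terms of
fewer weights. -/
lemma exists_reparametrization {σ : Type*} [Fintype σ] [DecidableEq σ] (K R : ℕ)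
    (hR : Fintype.card σ ≤ R) (w : σ → ℕ) (hw : ¬ WeightInjOn w K) :
    ∃ (j : σ) (N : ℕ) (w' : {k // k ≠ j} → ℕ) (M : σ → {k // k ≠ j} → ℕ), 1 ≤ N ∧
      (∀ i k, M i k ≤ (2 * K) ^ R) ∧ ∀ i, N * w i = ∑ k, M i k * w' k := by
  unfold WeightInjOn at hw
  push Not at hw
  obtain ⟨γ, γ', hγ, hγ', heq, hne⟩ := hw
  rw [Finsupp.weight_apply, Finsupp.weight_apply, Finsupp.sum_fintype _ _ (by simp),
    Finsupp.sum_fintype _ _ (by simp)] at heq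
  obtain ⟨N, w', M, hN, hM, hNw, j, hj⟩ := exists_reparametrization_aux K R w
    (fun i => (γ i : ℤ) - γ' i) ((Finset.card_le_univ _).trans hR)
    (by
      by_contra! hall
      exact hne (Finsupp.ext fun i => by have := hall i; omega))
    (fun i => by
      have := hγ i
      have := hγ' i
      rw [abs_le]
      omega)
    (by
      have : ∑ i, (γ i : ℤ) * w i = ∑ i, (γ' i : ℤ) * w i := by
        simp only [smul_eq_mul] at heq
        exact_mod_cast heq
      simp only [sub_mul, Finset.sum_sub_distrib, this, sub_self])
  refine ⟨j, N, fun k => w' k, fun i k => M i k, hN, fun i k => hM i k, fun i => ?_⟩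
  rw [hNw, ← Fintype.sum_subtype_add_sum_subtype (fun k => k ≠ j)]
  refine (add_eq_left.2 (Finset.sum_eq_zero fun k _ => ?_))
  rw [not_not.1 k.2, hj, mul_zero]

/-- The action on exponent vectors of the substitution `X i ↦ ∏ k, X k ^ M i k`. -/
noncomputable def monomialSubstExponent {σ τ : Type*} [Fintype σ] [Fintype τ] (M : σ → τ → ℕ)
    (γ : σ →₀ ℕ) : τ →₀ ℕ :=
  Finsupp.equivFunOnFinite.symm fun k => ∑ i, γ i * M i k

lemma weight_monomialSubstExponent {σ τ : Type*} [Fintype σ] [Fintype τ] {M : σ → τ → ℕ}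
    {w : σ → ℕ} {w' : τ → ℕ} {N : ℕ} (h : ∀ i, N * w i = ∑ k, M i k * w' k) (γ : σ →₀ ℕ) :
    Finsupp.weight w' (monomialSubstExponent M γ) = N * Finsupp.weight w γ := by
  rw [Finsupp.weight_apply, Finsupp.weight_apply, Finsupp.sum_fintype _ _ (by simp),
    Finsupp.sum_fintype _ _ (by simp), Finset.mul_sum]
  simp only [monomialSubstExponent, Finsupp.equivFunOnFinite_symm_apply_apply, smul_eq_mul,
    Finset.sum_mul]
  rw [Finset.sum_comm]
  refine Finset.sum_congr rfl fun i _ => ?_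
  rw [mul_left_comm, h, Finset.mul_sum]
  exact Finset.sum_congr rfl fun k _ => mul_assoc _ _ _

lemma monomialSubstExponent_le {σ τ : Type*} [Fintype σ] [Fintype τ] {M : σ → τ → ℕ} {L D : ℕ}
    (hM : ∀ i k, M i k ≤ L) {γ : σ →₀ ℕ} (hγ : ∀ i, γ i ≤ D) (k : τ) :
    monomialSubstExponent M γ k ≤ Fintype.card σ * (D * L) := by
  change ∑ i, γ i * M i k ≤ _
  refine (Finset.sum_le_card_nsmul _ _ (D * L) fun i _ => Nat.mul_le_mul (hγ i) (hM i k)).trans ?_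
  simp

/-- The substitution `X i ↦ ∏ k, X k ^ M i k`. -/
noncomputable def monomialSubst {σ τ : Type*} [Fintype σ] [Fintype τ] (M : σ → τ → ℕ)
    (A : MvPolynomial σ ℂ) : MvPolynomial τ ℂ :=
  ∑ γ ∈ A.support, MvPolynomial.monomial (monomialSubstExponent M γ) (A.coeff γ)

lemma support_monomialSubst_subset {σ τ : Type*} [Fintype σ] [Fintype τ] [DecidableEq τ]
    (M : σ → τ → ℕ) (A : MvPolynomial σ ℂ) :
    (monomialSubst M A).support ⊆ A.support.image (monomialSubstExponent M) := by
  intro γ' h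
  rw [MvPolynomial.mem_support_iff, monomialSubst, MvPolynomial.coeff_sum] at h
  obtain ⟨γ, hγ, h⟩ := Finset.exists_ne_zero_of_sum_ne_zero h
  rw [MvPolynomial.coeff_monomial] at h
  refine Finset.mem_image.2 ⟨γ, hγ, ?_⟩
  by_contra hne
  exact h (if_neg hne)

lemma card_support_monomialSubst_le {σ τ : Type*} [Fintype σ] [Fintype τ]
    (M : σ → τ → ℕ) (A : MvPolynomial σ ℂ) :
    (monomialSubst M A).support.card ≤ A.support.card := by
  classical
  exact (Finset.card_le_card (support_monomialSubst_subset M A)).trans Finset.card_image_le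

lemma DegreesBounded.monomialSubst {σ τ : Type*} [Fintype σ] [Fintype τ] {M : σ → τ → ℕ}
    {L D : ℕ} (hM : ∀ i k, M i k ≤ L) {A : MvPolynomial σ ℂ} (hA : DegreesBounded A D) :
    DegreesBounded (monomialSubst M A) (Fintype.card σ * (D * L)) := by
  classical
  intro γ' h
  obtain ⟨γ, hγ, rfl⟩ := Finset.mem_image.1 (support_monomialSubst_subset M A h)
  exact monomialSubstExponent_le hM (hA γ hγ)

lemma monomialSpec_monomialSubst {σ τ : Type*} [Fintype σ] [Fintype τ] {M : σ → τ → ℕ}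
    {w : σ → ℕ} {w' : τ → ℕ} {N : ℕ} (h : ∀ i, N * w i = ∑ k, M i k * w' k)
    (A : MvPolynomial σ ℂ) :
    monomialSpec w' (monomialSubst M A) = expand ℂ N (monomialSpec w A) := by
  rw [monomialSpec_eq_sum w, monomialSubst, map_sum, map_sum]
  refine Finset.sum_congr rfl fun γ _ => ?_
  rw [monomialSpec_monomial, expand_monomial, weight_monomialSubstExponent h, mul_comm]

lemma card_support_expand_s7 {N : ℕ} (hN : 1 ≤ N) (q : ℂ[X]) :
    q.support.card ≤ (expand ℂ N q).support.card := by
  refine Finset.card_le_card_of_injOn (· * N) (fun m hm => ?_) fun a _ b _ hab =>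
    Nat.eq_of_mul_eq_mul_right hN hab
  have : q.coeff m ≠ 0 := by simpa using hm
  simpa [coeff_expand_mul hN] using this

lemma DegreesBounded.card_support_le {σ : Type*} [Fintype σ] {A : MvPolynomial σ ℂ} {B : ℕ}
    (hA : DegreesBounded A B) : A.support.card ≤ (B + 1) ^ Fintype.card σ := by
  classical
  have : A.support.card ≤ Fintype.card (σ → Fin (B + 1)) := by
    rw [← Finset.card_univ]
    refine Finset.card_le_card_of_injOn (fun γ i => Fin.ofNat (B + 1) (γ i)) (by simp) ?_
    intro γ hγ γ' hγ' heq
    ext i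
    have h1 := congrArg Fin.val (congrFun heq i)
    simp only [Fin.val_ofNat] at h1
    rwa [Nat.mod_eq_of_lt (Nat.lt_succ_of_le (hA γ hγ i)),
      Nat.mod_eq_of_lt (Nat.lt_succ_of_le (hA γ' hγ' i))] at h1
  simpa using this

/-- The constant governing the degrees in the lifting theorem. -/
def liftingConstant (S : ℕ) : ℕ := (S + 2) ^ 3 * (2 * separationScale S S)

lemma one_le_liftingConstant (S : ℕ) : 1 ≤ liftingConstant S :=
  Nat.mul_pos (by positivity) (by have := one_le_separationScale S S; omega)

theorem card_support_le_of_homogeneous_identity (S R r : ℕ) (hR : 1 ≤ R) (hrR : r ≤ R)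
    {σ : Type} [Fintype σ] (hσ : Fintype.card σ ≤ r) (w : σ → ℕ) (D : ℕ) (hD : 1 ≤ D)
    (H : MvPolynomial σ ℂ) (hHs : H.support.card ≤ S) (hH : DegreesBounded H D)
    (ν : σ →₀ ℕ) (hν : ∀ i, ν i ≤ D) (d : ℕ) (hd : 1 ≤ d) (c : ℕ → ℂ) (hc : c d = 1)
    (hc' : c (d - 1) = 0) (q : ℂ[X]) (hq : q.natDegree ≤ Finsupp.weight w ν)
    (hn : Finsupp.weight w ν ≤ (monomialSpec w H).natDegree) (hq0 : q.coeff 0 = 1)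
    (h : monomialSpec w H =
      ∑ i ∈ Finset.range (d + 1), C (c i) * q ^ i * X ^ (Finsupp.weight w ν * (d - i))) :
    q.support.card ≤ (2 * liftingConstant S * R * D) ^ (r * (R + 1) ^ r) := by
  classical
  induction r generalizing σ D q with
  | zero =>
    have : IsEmpty σ := Fintype.card_eq_zero_iff.1 (Nat.le_zero.1 hσ)
    have hw0 : Finsupp.weight w ν = 0 := by
      rw [Finsupp.weight_apply, Finsupp.sum_fintype _ _ (by simp)]
      simp
    have : q = 1 := by
      have hqn : q.natDegree = 0 := by omega
      rw [eq_C_of_natDegree_eq_zero hqn, hq0, C_1]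
    rw [this, zero_mul, pow_zero]
    exact (Finset.card_le_card (support_C_subset 1)).trans (by simp)
  | succ r ih =>
    set κ := liftingConstant S with hκ
    have hκ1 : 1 ≤ κ := one_le_liftingConstant S
    by_cases hw : WeightInjOn w (κ * D)
    · set Jm := 2 * separationScale S S with hJm
      have hJm1 : 1 ≤ Jm := by have := one_le_separationScale S S; omega
      have hκJ : κ * D = (S + 2) ^ 3 * (Jm * D) := by rw [hκ, liftingConstant, ← hJm, mul_assoc]
      have hDJ : D ≤ Jm * D := Nat.le_mul_of_pos_left _ hJm1
      obtain ⟨Q, hQ, rfl⟩ := exists_lift S D Jm (κ * D) le_rfl (by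
          rw [hκJ]
          calc S * (D + S * ((S + 1) * (Jm * D)) + Jm * D)
              ≤ S * (Jm * D + S * ((S + 1) * (Jm * D)) + Jm * D) := by gcongr
            _ = (S ^ 3 + S ^ 2 + 2 * S) * (Jm * D) := by ring
            _ ≤ (S + 2) ^ 3 * (Jm * D) := Nat.mul_le_mul_right _ (by ring_nf; omega)) hw S le_rfl
        H hHs hH ν hν d hd c hc hc' q hq hn hq0 h
      have hQ' : DegreesBounded Q (κ * D) := hQ.mono (by
        rw [hκJ, ← mul_assoc]
        exact Nat.mul_le_mul_right _ (by ring_nf; omega))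
      refine (card_support_monomialSpec_le w Q).trans (hQ'.card_support_le.trans ?_)
      have hpos : 1 ≤ κ * D := Nat.mul_pos hκ1 hD
      have hbase : κ * D + 1 ≤ 2 * κ * R * D := by
        have : κ * D ≤ R * (κ * D) := Nat.le_mul_of_pos_left _ hR
        have : 2 * κ * R * D = R * (κ * D) + R * (κ * D) := by ring
        omega
      refine (Nat.pow_le_pow_left hbase _).trans (Nat.pow_le_pow_right (by omega) (hσ.trans ?_))
      exact Nat.le_mul_of_pos_right _ (by positivity)
    · obtain ⟨j, N, w', M, hN, hM, hNw⟩ :=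
        exists_reparametrization (κ * D) R (hσ.trans hrR) w hw
      set L := (2 * (κ * D)) ^ R with hL
      have hcard : Fintype.card {k // k ≠ j} ≤ r := by
        have := Fintype.card_subtype_lt (p := fun k => k ≠ j) (x := j) (by simp)
        omega
      have hL1 : 1 ≤ L := Nat.one_le_pow _ _ (by positivity)
      have hσ1 : 1 ≤ Fintype.card σ := Fintype.card_pos_iff.2 ⟨j⟩
      have hres := ih (by omega) hcard w' (Fintype.card σ * (D * L))
        (Nat.mul_pos hσ1 (Nat.mul_pos hD hL1)) (monomialSubst M H)
        ((card_support_monomialSubst_le M H).trans hHs) (hH.monomialSubst hM)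
        (monomialSubstExponent M ν) (monomialSubstExponent_le hM hν) (expand ℂ N q)
        (by
          rw [natDegree_expand, weight_monomialSubstExponent hNw, mul_comm]
          exact Nat.mul_le_mul_left _ hq)
        (by
          rw [monomialSpec_monomialSubst hNw, natDegree_expand, weight_monomialSubstExponent hNw,
            mul_comm]
          exact Nat.mul_le_mul_right _ hn)
        (by
          rw [coeff_expand hN]
          simpa using hq0)
        (by
          rw [monomialSpec_monomialSubst hNw, h, map_sum, weight_monomialSubstExponent hNw]
          refine Finset.sum_congr rfl fun i _ => ?_
          rw [map_mul, map_mul, map_pow, map_pow, expand_C, expand_X, ← pow_mul, mul_assoc N])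
      refine (card_support_expand_s7 hN q).trans (hres.trans ?_)
      have hbase : 2 * κ * R * (Fintype.card σ * (D * L)) ≤ (2 * κ * R * D) ^ (R + 1) := by
        have h1 : R * L ≤ (2 * κ * R * D) ^ R := by
          have : 2 * κ * R * D = R * (2 * (κ * D)) := by ring
          rw [this, mul_pow]
          exact Nat.mul_le_mul_right _ (Nat.le_self_pow (by omega) R)
        calc 2 * κ * R * (Fintype.card σ * (D * L)) ≤ 2 * κ * R * (R * (D * L)) :=
              Nat.mul_le_mul_left _ (Nat.mul_le_mul_right _ (hσ.trans hrR))
          _ = (R * L) * (2 * κ * R * D) := by ring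
          _ ≤ (2 * κ * R * D) ^ R * (2 * κ * R * D) := Nat.mul_le_mul_right _ h1
          _ = (2 * κ * R * D) ^ (R + 1) := (pow_succ _ _).symm
      refine (Nat.pow_le_pow_left hbase _).trans ?_
      rw [← pow_mul]
      refine Nat.pow_le_pow_right (by positivity) ?_
      have : (r + 1) * (R + 1) ^ (r + 1) = (R + 1) * (r * (R + 1) ^ r) + (R + 1) ^ (r + 1) := by
        ring
      omega

theorem two_mul_separationScale_add_one_le (S c : ℕ) :
    2 * separationScale S c + 1 ≤ 3 ^ ((2 * S + 5) ^ c) := by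
  induction c with
  | zero => simp [separationScale]
  | succ c ih =>
    set u := 2 * separationScale S c + 1 with hu
    have h3 : 3 ≤ u := by have := one_le_separationScale S c; omega
    have h1 : 1 ≤ u ^ (2 * S + 4) := Nat.one_le_pow _ _ (by omega)
    calc 2 * separationScale S (c + 1) + 1 = 2 * u ^ (2 * S + 4) + 1 := rfl
      _ ≤ u ^ (2 * S + 4) * 3 := by omega
      _ ≤ u ^ (2 * S + 4) * u := Nat.mul_le_mul_left _ h3
      _ = u ^ (2 * S + 5) := by rw [← pow_succ]
      _ ≤ (3 ^ ((2 * S + 5) ^ c)) ^ (2 * S + 5) := Nat.pow_le_pow_left ih _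
      _ = 3 ^ ((2 * S + 5) ^ (c + 1)) := by rw [← pow_mul, ← pow_succ]

theorem add_three_le_three_pow {l : ℕ} (hl : 2 ≤ l) : l + 3 ≤ 3 ^ l := by
  induction l, hl using Nat.le_induction with
  | base => norm_num
  | succ n hn ih => rw [pow_succ]; omega

theorem two_mul_liftingConstant_mul_le {l : ℕ} (hl : 2 ≤ l) :
    2 * liftingConstant (l + 1) * (l + 2) ≤ 3 ^ ((2 * l + 7) ^ (l + 2)) := by
  have h1 := two_mul_separationScale_add_one_le (l + 1) (l + 1)
  have h2 := add_three_le_three_pow hl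
  have h3 : 4 * l + 1 + (2 * l + 7) ^ (l + 1) ≤ (2 * l + 7) ^ (l + 2) := by
    have : (2 * l + 7) ^ 1 ≤ (2 * l + 7) ^ (l + 1) := Nat.pow_le_pow_right (by omega) (by omega)
    rw [pow_succ _ (l + 1)]
    nlinarith
  calc 2 * liftingConstant (l + 1) * (l + 2)
      = 2 * ((l + 3) ^ 3 * (l + 2)) * (2 * separationScale (l + 1) (l + 1)) := by
        unfold liftingConstant; ring
    _ ≤ 3 * ((3 ^ l) ^ 3 * 3 ^ l) * 3 ^ ((2 * (l + 1) + 5) ^ (l + 1)) := by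
        gcongr
        · norm_num
        · omega
        · omega
    _ = 3 ^ (4 * l + 1 + (2 * l + 7) ^ (l + 1)) := by
        rw [show 2 * (l + 1) + 5 = 2 * l + 7 by ring]; ring
    _ ≤ _ := Nat.pow_le_pow_right (by norm_num) h3

theorem normalized_bound_add_one_le {l : ℕ} (hl : 2 ≤ l) :
    (2 * liftingConstant (l + 1) * (l + 2)) ^ ((l + 2) * (l + 3) ^ (l + 2)) + 1 ≤
      (4 * l) ^ ((2 * l) ^ ((3 * l) ^ (l + 1))) := by
  set E := (2 * l + 7) ^ (2 * l + 5) with hE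
  have h1 : (2 * liftingConstant (l + 1) * (l + 2)) ^ ((l + 2) * (l + 3) ^ (l + 2)) ≤ 3 ^ E := by
    calc _ ≤ (3 ^ ((2 * l + 7) ^ (l + 2))) ^ ((l + 2) * (l + 3) ^ (l + 2)) :=
          Nat.pow_le_pow_left (two_mul_liftingConstant_mul_le hl) _
      _ ≤ (3 ^ ((2 * l + 7) ^ (l + 2))) ^ ((2 * l + 7) * (2 * l + 7) ^ (l + 2)) := by
          gcongr <;> first | omega | exact Nat.one_le_pow _ _ (by norm_num)
      _ = 3 ^ E := by rw [← pow_mul, hE]; congr 1; ring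
  have hE1 : E ≠ 0 := by rw [hE]; positivity
  have h2 : 3 ^ E + 1 ≤ (4 * l) ^ E := by
    have : 3 ^ E < (4 * l) ^ E := Nat.pow_lt_pow_left (by omega) hE1
    omega
  have h3 : E ≤ (2 * l) ^ ((3 * l) ^ (l + 1)) := by
    have h4 : 4 * l + 10 ≤ (3 * l) ^ (l + 1) := by
      have : (3 * l) ^ 3 ≤ (3 * l) ^ (l + 1) := Nat.pow_le_pow_right (by omega) (by omega)
      nlinarith [Nat.mul_le_mul hl hl, Nat.mul_le_mul (Nat.mul_le_mul hl hl) (le_refl l)]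
    calc E ≤ ((2 * l) ^ 2) ^ (2 * l + 5) := Nat.pow_le_pow_left (by nlinarith) _
      _ = (2 * l) ^ (4 * l + 10) := by rw [← pow_mul]; congr 1; ring
      _ ≤ _ := Nat.pow_le_pow_right (by omega) h4
  calc _ ≤ (4 * l) ^ E := by omega
    _ ≤ _ := Nat.pow_le_pow_right (by omega) h3

theorem four_mul_le_bound {l : ℕ} (hl : 1 ≤ l) :
    4 * l ≤ (4 * l) ^ ((2 * l) ^ ((3 * l) ^ (l + 1))) :=
  Nat.le_self_pow (by positivity) _

theorem card_support_add_C_le (p : ℂ[X]) (t : ℂ) :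
    (p + C t).support.card ≤ p.support.card + 1 :=
  (Finset.card_le_card support_add).trans <| (Finset.card_union_le _ _).trans <|
    Nat.add_le_add_left ((Finset.card_le_card (support_C_subset t)).trans (by simp)) _

theorem card_support_C_mul_le (p : ℂ[X]) (t : ℂ) :
    (C t * p).support.card ≤ p.support.card := by
  rw [← smul_eq_C_mul]
  exact Finset.card_le_card (support_smul t p)

theorem card_support_reverse (p : ℂ[X]) : p.reverse.support.card = p.support.card := by
  rw [reverse, reflect_support, Finset.card_image_of_injective _ (revAt p.natDegree).injective]

theorem reflect_pow_of_natDegree_le {n : ℕ} {g : ℂ[X]} (hg : g.natDegree ≤ n) (i : ℕ) :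
    reflect (n * i) (g ^ i) = reflect n g ^ i := by
  induction i with
  | zero => simp
  | succ i ih =>
    rw [pow_succ, mul_add_one, reflect_mul _ _ _ hg, ih, pow_succ]
    exact natDegree_pow_le.trans (by rw [mul_comm]; gcongr)

theorem reflect_sum (N : ℕ) {ι : Type*} (s : Finset ι) (p : ι → ℂ[X]) :
    reflect N (∑ i ∈ s, p i) = ∑ i ∈ s, reflect N (p i) := by
  ext k
  simp [coeff_reflect]

theorem reflect_C_mul_pow {n d i : ℕ} (hi : i ≤ d) {g : ℂ[X]} (hg : g.natDegree ≤ n) (a : ℂ) :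
    reflect (n * d) (C a * g ^ i) = C a * reflect n g ^ i * X ^ (n * (d - i)) := by
  rw [reflect_C_mul, mul_assoc, ← reflect_pow_of_natDegree_le hg]
  congr 1
  have h1 : n * d = n * i + n * (d - i) := by rw [← mul_add]; congr 1; omega
  have := reflect_mul (g ^ i) 1 (F := n * i) (G := n * (d - i))
    (natDegree_pow_le.trans (by rw [mul_comm]; gcongr)) (by simp)
  rw [h1, ← mul_one (g ^ i), this, mul_one]
  congr 1
  simp

theorem reverse_comp_eq_sum {f g : ℂ[X]} :
    (f.comp g).reverse = ∑ i ∈ Finset.range (f.natDegree + 1),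
      C (f.coeff i) * g.reverse ^ i * X ^ (g.natDegree * (f.natDegree - i)) := by
  rw [reverse, natDegree_comp, mul_comm, comp_eq_sum_left, sum_over_range _ (by simp),
    reflect_sum]
  refine Finset.sum_congr rfl fun i hi ↦ ?_
  exact reflect_C_mul_pow (by simpa [Nat.lt_succ_iff] using hi) le_rfl _

theorem card_support_le_of_normalized {S : ℕ} {f g : ℂ[X]} (hfm : f.Monic) (hf : 2 ≤ f.natDegree)
    (hf1 : f.coeff (f.natDegree - 1) = 0) (hgm : g.Monic)
    (h : (f.comp g).support.card ≤ S) (h0 : (f.comp g).coeff 0 ≠ 0) :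
    g.support.card ≤ (2 * liftingConstant S * (S + 1)) ^ ((S + 1) * (S + 2) ^ (S + 1)) := by
  set p := (f.comp g).reverse with hp
  set n := g.natDegree with hn
  have hpS : p.support.card ≤ S := by rwa [hp, card_support_reverse]
  have hpd : p.natDegree = f.natDegree * n := by
    rw [hp, reverse_natDegree, natDegree_comp,
      natTrailingDegree_eq_zero.2 (Or.inr h0), Nat.sub_zero]
  let w : ↥(insert n p.support) → ℕ := Subtype.val
  let H : MvPolynomial ↥(insert n p.support) ℂ := ∑ e ∈ p.support.attach,
    MvPolynomial.monomial (Finsupp.single ⟨e.1, Finset.mem_insert_of_mem e.2⟩ 1) (p.coeff e.1)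
  let ν : ↥(insert n p.support) →₀ ℕ := Finsupp.single ⟨n, Finset.mem_insert_self _ _⟩ 1
  have hν : Finsupp.weight w ν = n := by simp [w, ν, Finsupp.weight_single]
  have hH : monomialSpec w H = p := by
    simp only [H, map_sum, monomialSpec_monomial, Finsupp.weight_single, w, one_smul]
    rw [Finset.sum_attach p.support fun e ↦ monomial e (p.coeff e)]
    exact p.as_sum_support.symm
  have hHs : H.support.card ≤ S := by
    classical
    refine (Finset.card_le_card MvPolynomial.support_sum).trans <|
      Finset.card_biUnion_le.trans ((Finset.sum_le_card_nsmul _ _ 1 fun e _ ↦ ?_).trans ?_)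
    · exact (Finset.card_le_card MvPolynomial.support_monomial_subset).trans (by simp)
    · simpa using hpS
  have hHD : DegreesBounded H 1 := DegreesBounded.sum _ _ fun e _ ↦
    DegreesBounded.monomial (fun i ↦ by rw [Finsupp.single_apply]; split_ifs <;> simp) _
  have key := card_support_le_of_homogeneous_identity S (S + 1) (S + 1) (by omega) le_rfl
    (σ := ↥(insert n p.support))
    (by simpa using (Finset.card_insert_le n p.support).trans (by omega)) w 1 le_rfl H hHs hHD ν
    (fun i ↦ by simp only [ν, Finsupp.single_apply]; split_ifs <;> simp) f.natDegree (by omega)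
    f.coeff hfm hf1 g.reverse (by rw [hν]; exact reverse_natDegree_le g)
    (by rw [hν, hH, hpd]; nlinarith) (by rw [coeff_zero_reverse]; exact hgm)
    (by rw [hν, hH]; exact reverse_comp_eq_sum)
  simpa [card_support_reverse] using key

theorem exists_translate_centered {f : ℂ[X]} (hfm : f.Monic) (hf : 1 ≤ f.natDegree) :
    ∃ μ : ℂ, (taylor μ f).coeff (f.natDegree - 1) = 0 := by
  set d := f.natDegree with hd
  have hd0 : (d : ℂ) ≠ 0 := by exact_mod_cast (by omega : d ≠ 0)
  refine ⟨-(f.coeff (d - 1)) / d, ?_⟩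
  have hdeg : (hasseDeriv (d - 1) f).natDegree ≤ 1 := by
    have := natDegree_hasseDeriv_le f (d - 1)
    omega
  rw [taylor_coeff, eval_eq_sum_range' (n := 2) (by omega), Finset.sum_range_succ,
    Finset.sum_range_one, hasseDeriv_coeff, hasseDeriv_coeff,
    show 1 + (d - 1) = d by omega, show f.coeff d = 1 from hfm,
    show (d.choose (d - 1) : ℂ) = d by
      rw [Nat.choose_symm_of_eq_add (show d = (d - 1) + 1 by omega), Nat.choose_one_right]]
  simp
  field_simp
  simp

theorem exists_normalized {f g : ℂ[X]} (hf : 2 ≤ f.natDegree) (hg : 1 ≤ g.natDegree) :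
    ∃ f₁ g₁ : ℂ[X], f₁.Monic ∧ f₁.natDegree = f.natDegree ∧ f₁.coeff (f₁.natDegree - 1) = 0 ∧
      g₁.Monic ∧ (f₁.comp g₁).coeff 0 ≠ 0 ∧
      (f₁.comp g₁).support.card ≤ (f.comp g).support.card + 1 ∧
      g.support.card ≤ g₁.support.card + 1 := by
  have hf0 : f ≠ 0 := by rintro rfl; simp at hf
  have hg0 : g ≠ 0 := by rintro rfl; simp at hg
  set a := g.leadingCoeff with ha
  have ha0 : a ≠ 0 := leadingCoeff_ne_zero.2 hg0
  have hCX : (C a * X : ℂ[X]).natDegree = 1 := natDegree_C_mul_X a ha0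
  set b := (f.comp (C a * X)).leadingCoeff with hb
  have hfc : (f.comp (C a * X)).natDegree = f.natDegree := by rw [natDegree_comp, hCX, mul_one]
  have hb0 : b ≠ 0 := leadingCoeff_ne_zero.2 fun h ↦ by rw [h, natDegree_zero] at hfc; omega
  set f₀ := C b⁻¹ * f.comp (C a * X) with hf₀
  have hf₀m : f₀.Monic := by
    rw [Monic, hf₀, leadingCoeff_mul, leadingCoeff_C, inv_mul_cancel₀ hb0]
  have hf₀d : f₀.natDegree = f.natDegree := by
    rw [hf₀, natDegree_C_mul (inv_ne_zero hb0), hfc]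
  obtain ⟨μ, hμ⟩ := exists_translate_centered hf₀m (by omega)
  set f₁ := taylor μ f₀ with hf₁
  set g₁ := C a⁻¹ * g + C (-μ) with hg₁
  have hf₁d : f₁.natDegree = f.natDegree := by rw [hf₁, natDegree_taylor, hf₀d]
  have hf₁m : f₁.Monic := by rw [Monic, hf₁, leadingCoeff_taylor]; exact hf₀m
  have hcomp : f₁.comp g₁ = C b⁻¹ * f.comp g := by
    have : C a * (C a⁻¹ * g) = g := by
      rw [← mul_assoc, ← C_mul, mul_inv_cancel₀ ha0, C_1, one_mul]
    simp [hf₁, hg₁, hf₀, taylor_apply, comp_assoc, this]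
  set t := 1 - (f₁.comp g₁).coeff 0 with ht
  have hdeg : (C t).degree < f₁.degree :=
    degree_C_le.trans_lt (natDegree_pos_iff_degree_pos.1 (by omega))
  have hd2 : (f₁ + C t).natDegree = f.natDegree := by rw [natDegree_add_C, hf₁d]
  have hg₁m : g₁.Monic := by
    have h1 : (C a⁻¹ * g).Monic := by
      rw [Monic, leadingCoeff_mul, leadingCoeff_C, ← ha, inv_mul_cancel₀ ha0]
    refine h1.add_of_left (degree_C_le.trans_lt (natDegree_pos_iff_degree_pos.1 ?_))
    rw [natDegree_C_mul (inv_ne_zero ha0)]; omega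
  have hgg : g = C a * (g₁ + C μ) := by
    rw [hg₁, C_neg, neg_add_cancel_right, ← mul_assoc, ← C_mul, mul_inv_cancel₀ ha0, C_1, one_mul]
  refine ⟨f₁ + C t, g₁, hf₁m.add_of_left hdeg, hd2, ?_, hg₁m, ?_, ?_, ?_⟩
  · rw [hd2, coeff_add, coeff_C, if_neg (by omega), add_zero, ← hf₀d, hμ]
  · rw [add_comp, C_comp, coeff_add, coeff_C_zero, ht]; simp
  · rw [add_comp, C_comp]
    refine (card_support_add_C_le _ _).trans ?_
    rw [hcomp]
    exact Nat.add_le_add_right (card_support_C_mul_le _ _) 1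
  · conv_lhs => rw [hgg]
    exact (card_support_C_mul_le _ _).trans (card_support_add_C_le _ _)

theorem card_support_le_of_natDegree_eq_one {f g : ℂ[X]} (hf : f.natDegree = 1) :
    g.support.card ≤ (f.comp g).support.card + 1 := by
  have ha : f.coeff 1 ≠ 0 := by
    rw [← hf]
    exact leadingCoeff_ne_zero.2 fun h ↦ by simp [h] at hf
  have hg : g = C (f.coeff 1)⁻¹ * (f.comp g + C (-f.coeff 0)) := by
    conv_rhs => rw [eq_X_add_C_of_natDegree_le_one hf.le]
    simp only [coeff_add, coeff_C_mul, coeff_X_zero, coeff_X_one, coeff_C_zero, coeff_C_succ,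
      mul_zero, mul_one, zero_add, add_zero, add_comp, mul_comp, C_comp, X_comp, C_neg,
      add_neg_cancel_right]
    rw [← mul_assoc, ← C_mul, inv_mul_cancel₀ ha, C_1, one_mul]
  conv_lhs => rw [hg]
  exact (card_support_C_mul_le _ _).trans (card_support_add_C_le _ _)

theorem card_support_le_two_of_comp {f g : ℂ[X]} (hf : 0 < f.natDegree)
    (h : (f.comp g).support.card ≤ 1) : g.support.card ≤ 2 := by
  obtain ⟨r, hr⟩ := IsAlgClosed.exists_root f (natDegree_pos_iff_degree_pos.1 hf).ne'
  obtain ⟨f', rfl⟩ := dvd_iff_isRoot.2 hr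
  by_cases h0 : ((X - C r) * f').comp g = 0
  · have hg : g.natDegree = 0 := by
      have := congrArg natDegree h0
      rw [natDegree_comp, natDegree_zero, mul_eq_zero] at this
      omega
    rw [eq_C_of_natDegree_eq_zero hg]
    exact (Finset.card_le_card (support_C_subset _)).trans (by simp)
  obtain ⟨m, c, hc, hm⟩ := card_support_eq_one.1
    (le_antisymm h (Finset.card_pos.2 (nonempty_support_iff.2 h0)))
  have hdvd : g - C r ∣ X ^ m := by
    have : g - C r ∣ C c * X ^ m := by rw [← hm, mul_comp]; simp
    rwa [IsUnit.dvd_mul_left (isUnit_C.2 hc.isUnit)] at this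
  obtain ⟨i, -, hi⟩ := (dvd_prime_pow prime_X m).1 hdvd
  obtain ⟨u, hu⟩ := hi.symm
  obtain ⟨v, -, hv⟩ := isUnit_iff.1 u.isUnit
  have hg : g = C v * X ^ i + C r := by rw [hv, mul_comm, hu]; ring
  rw [hg]
  exact (card_support_add_C_le _ _).trans
    (Nat.add_le_add_right (card_support_C_mul_X_pow_le_one) 1)

/-- Zannier's theorem (proving Schinzel's conjecture), with Karolus' explicit
bound: if `f` is non-constant and `f(g(x))` has at most `ℓ` terms, then `g`
has at most `(4ℓ)^((2ℓ)^((3ℓ)^(ℓ+1)))` terms. -/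
theorem zannier_composite_lacunary (ℓ : ℕ) (hℓ : 1 ≤ ℓ) (f g : Polynomial ℂ)
    (hf : 0 < f.natDegree) (h : (f.comp g).support.card ≤ ℓ) :
    g.support.card ≤ (4 * ℓ) ^ ((2 * ℓ) ^ ((3 * ℓ) ^ (ℓ + 1))) := by
  have hbd := four_mul_le_bound hℓ
  rcases Nat.eq_zero_or_pos g.natDegree with hg | hg
  · have : g.support.card ≤ 1 := by
      rw [eq_C_of_natDegree_eq_zero hg]
      exact (Finset.card_le_card (support_C_subset _)).trans (by simp)
    omega
  rcases Nat.lt_or_ge f.natDegree 2 with hf1 | hf2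
  · have := card_support_le_of_natDegree_eq_one (g := g) (show f.natDegree = 1 by omega)
    omega
  rcases Nat.lt_or_ge ℓ 2 with hl | hl
  · have := card_support_le_two_of_comp hf (h.trans (by omega))
    omega
  obtain ⟨f₁, g₁, hm, hd, hc, hgm, h0, hs, hgs⟩ := exists_normalized hf2 hg
  have key := card_support_le_of_normalized hm (hd ▸ hf2) hc hgm
    (hs.trans (Nat.add_le_add_right h 1)) h0
  have := normalized_bound_add_one_le hl
  exact (hgs.trans (Nat.add_le_add_right key 1)).trans this
end
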